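/- arXiv:2604.23682 — 2 statements merged into one kernel-verified Lean document; each statement's English description precedes it below -/
import Mathlib

section
/- There exists a constant C_n < ∞ depending only on n such that for every T > 0 and every S > T, ∫_T^S V(t) dt ≤ C_n μ_T ( ∫_T^S F(t) dt + 1 ), where μ_T := sup_{s ≥ T} F₀(s) and V(t) := Σ_{k≥0} 2^{−k(n+2)} F₀(t + k log 2) ∫_t^{t + k log 2} F(τ) dτ. -/
open MeasureTheory Metric Filter Topology Pointwise

noncomputable section

abbrev En (n : ℕ) := EuclideanSpace ℝ (Fin n)

/-- symmetric trace-free matrices -/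
def S0 {n : ℕ} (B : Matrix (Fin n) (Fin n) ℝ) : Prop := B.IsSymm ∧ B.trace = 0

/-- ψ_B(x) = (1/2) x·Bx -/
def psiM {n : ℕ} (B : Matrix (Fin n) (Fin n) ℝ) (x : En n) : ℝ :=
  (1/2) * ∑ i, ∑ j, B i j * x i * x j

/-- p₀(x) = |x|²/(2n) -/
def p0 (n : ℕ) (x : En n) : ℝ := ‖x‖^2 / (2*n)

/-- q_B = p₀ + ψ_B -/
def qB {n : ℕ} (B : Matrix (Fin n) (Fin n) ℝ) (x : En n) : ℝ := p0 n x + psiM B x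

/-- surface measure on the unit sphere -/
def sphMeas (n : ℕ) : Measure (En n) :=
  (Measure.hausdorffMeasure ((n:ℝ) - 1)).restrict (sphere (0:En n) 1)

/-- total surface area of the unit sphere -/
def sphArea (n : ℕ) : ℝ := (sphMeas n Set.univ).toReal

/-- u is a C^{1,1} solution of Δu = χ_{|∇u|>0} in B₁ with 0 a free boundary point. -/
def SolutionHyp {n : ℕ} (u : En n → ℝ) : Prop :=
  (∀ x ∈ ball (0:En n) 1, DifferentiableAt ℝ u x) ∧
  (∃ L : NNReal, LipschitzOnWith L (fun x => gradient u x) (ball (0:En n) 1)) ∧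
  (∀ᵐ x ∂(volume.restrict (ball (0:En n) 1)),
      ∃ D : En n →L[ℝ] En n, HasFDerivAt (fun y => gradient u y) D x ∧
        ((gradient u x = 0 → LinearMap.trace ℝ (En n) (D : En n →ₗ[ℝ] En n) = 0) ∧
         (gradient u x ≠ 0 → LinearMap.trace ℝ (En n) (D : En n →ₗ[ℝ] En n) = 1))) ∧
  ((0:En n) ∈ frontier {x | x ∈ ball (0:En n) 1 ∧ gradient u x ≠ 0}) ∧
  gradient u 0 = 0

/-- the quadratic rescaling u_t(x) = e^{2t}(u(e^{-t}x)-u(0)) -/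
def ut {n : ℕ} (u : En n → ℝ) (t : ℝ) (x : En n) : ℝ :=
  Real.exp (2*t) * (u (Real.exp (-t) • x) - u 0)

/-- Λ = {x ∈ B₁ : ∇u(x)=0} -/
def Lam {n : ℕ} (u : En n → ℝ) : Set (En n) :=
  {x | x ∈ ball (0:En n) 1 ∧ gradient u x = 0}

/-- Λ_t = e^t Λ -/
def LamT {n : ℕ} (u : En n → ℝ) (t : ℝ) : Set (En n) := Real.exp t • Lam u

/-- B(t) is the L²(∂B₁)-projection coefficient of u_t - p₀ -/
def BProp {n : ℕ} (u : En n → ℝ) (B : ℝ → Matrix (Fin n) (Fin n) ℝ) : Prop :=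
  ∀ t, 0 < t → S0 (B t) ∧
    ∀ C, S0 C →
      ∫ x, (ut u t x - p0 n x - psiM (B t) x) * psiM C x ∂(sphMeas n) = 0

/-- remainder R_t = u_t - q_{B(t)} -/
def Rt {n : ℕ} (u : En n → ℝ) (B : ℝ → Matrix (Fin n) (Fin n) ℝ) (t : ℝ) (x : En n) : ℝ :=
  ut u t x - qB (B t) x

/-- F(t) = ∫_{Λ_t ∩ B₁} |x|² dx -/
def Fdef {n : ℕ} (u : En n → ℝ) (t : ℝ) : ℝ :=
  ∫ x in LamT u t ∩ ball (0:En n) 1, ‖x‖^2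

/-- I(t) = ∫_{Λ_t ∩ B₁} x·∇R_t dx -/
def Idef {n : ℕ} (u : En n → ℝ) (B : ℝ → Matrix (Fin n) (Fin n) ℝ) (t : ℝ) : ℝ :=
  ∫ x in LamT u t ∩ ball (0:En n) 1, ∑ i, x i * gradient (Rt u B t) x i

/-- the origin is a singular point -/
def IsSingular {n : ℕ} (u : En n → ℝ) : Prop :=
  ∃ (r : ℕ → ℝ) (Bstar : Matrix (Fin n) (Fin n) ℝ),
    (∀ k, 0 < r k) ∧ Tendsto r atTop (nhds 0) ∧ S0 Bstar ∧
    (∀ K : Set (En n), IsCompact K →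
      TendstoUniformlyOn (fun k x => (u (r k • x) - u 0) / (r k)^2) (qB Bstar) atTop K ∧
      TendstoUniformlyOn (fun k x => gradient (fun y => (u (r k • y) - u 0) / (r k)^2) x)
        (fun x => gradient (qB Bstar) x) atTop K)

/-- Frobenius norm -/
def frob {n : ℕ} (M : Matrix (Fin n) (Fin n) ℝ) : ℝ := Real.sqrt (∑ i, ∑ j, (M i j)^2)

/-- the annulus 1/2 < |x| < 1 -/
def ann0 (n : ℕ) : Set (En n) := {x | 1/2 < ‖x‖ ∧ ‖x‖ < 1}

/-- the dyadic annulus 2^{-k-1} < |x| < 2^{-k} -/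
def annK (n : ℕ) (k : ℕ) : Set (En n) :=
  {x | (2:ℝ)^(-(k:ℤ)-1) < ‖x‖ ∧ ‖x‖ < (2:ℝ)^(-(k:ℤ))}

def F0 {n : ℕ} (u : En n → ℝ) (t : ℝ) : ℝ := ∫ x in LamT u t ∩ ann0 n, ‖x‖^2

def Fk {n : ℕ} (u : En n → ℝ) (k : ℕ) (t : ℝ) : ℝ := ∫ x in LamT u t ∩ annK n k, ‖x‖^2

def I0 {n : ℕ} (u : En n → ℝ) (B : ℝ → Matrix (Fin n) (Fin n) ℝ) (t : ℝ) : ℝ :=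
  ∫ x in LamT u t ∩ ann0 n, ∑ i, x i * gradient (Rt u B t) x i

def Ik {n : ℕ} (u : En n → ℝ) (B : ℝ → Matrix (Fin n) (Fin n) ℝ) (k : ℕ) (t : ℝ) : ℝ :=
  ∫ x in LamT u t ∩ annK n k, ∑ i, x i * gradient (Rt u B t) x i

/-- ε(t) = sup_{1/2 ≤ |x| ≤ 1} |∇R_t(x)| -/
def epsd {n : ℕ} (u : En n → ℝ) (B : ℝ → Matrix (Fin n) (Fin n) ℝ) (t : ℝ) : ℝ :=
  ⨆ x ∈ {x : En n | 1/2 ≤ ‖x‖ ∧ ‖x‖ ≤ 1}, ‖gradient (Rt u B t) x‖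

/-- trace-free part of a matrix -/
def tf {n : ℕ} (M : Matrix (Fin n) (Fin n) ℝ) : Matrix (Fin n) (Fin n) ℝ :=
  Matrix.of fun i j => M i j - (M.trace / n) * (if i = j then 1 else 0)

/-- second moment matrix of Λ_t ∩ B₁ -/
def momMat {n : ℕ} (u : En n → ℝ) (t : ℝ) : Matrix (Fin n) (Fin n) ℝ :=
  Matrix.of fun i j => ∫ x in LamT u t ∩ ball (0:En n) 1, x i * x j

/-- V(t) -/
def Vdef {n : ℕ} (u : En n → ℝ) (t : ℝ) : ℝ :=
  ∑' k : ℕ, (2:ℝ)^(-((k * (n+2) : ℕ) : ℤ)) * F0 u (t + k * Real.log 2) *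
    ∫ τ in t..(t + k * Real.log 2), Fdef u τ


/-- A bounded measurable function on `ℝ` is interval integrable. -/
lemma intervalIntegrable_of_measurable_of_bounded {f : ℝ → ℝ} {M : ℝ} (hf : Measurable f)
    (hM : ∀ t, |f t| ≤ M) (a b : ℝ) : IntervalIntegrable f volume a b :=
  (intervalIntegrable_const (c := M)).mono_fun hf.aestronglyMeasurable
    (Eventually.of_forall fun t => (hM t).trans (le_abs_self M))

section Window

variable {F : ℝ → ℝ} {ω : ℝ}

lemma window_integral_nonneg (hF0 : ∀ t, 0 ≤ F t) {h : ℝ} (hh : 0 ≤ h) (t : ℝ) :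
    0 ≤ ∫ τ in t..(t + h), F τ :=
  intervalIntegral.integral_nonneg_of_forall (by linarith) hF0

lemma window_integral_le (hF0 : ∀ t, 0 ≤ F t) (hFω : ∀ t, F t ≤ ω) {h : ℝ} (hh : 0 ≤ h) (t : ℝ) :
    ∫ τ in t..(t + h), F τ ≤ ω * h := by
  have := intervalIntegral.norm_integral_le_of_norm_le_const (a := t) (b := t + h) (f := F) (C := ω)
    (fun x _ => by rw [Real.norm_of_nonneg (hF0 x)]; exact hFω x)
  rw [add_sub_cancel_left, abs_of_nonneg hh] at this
  exact (le_abs_self _).trans this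

lemma continuous_window_integral (hF : Measurable F) (hF0 : ∀ t, 0 ≤ F t) (hFω : ∀ t, F t ≤ ω)
    (h : ℝ) : Continuous fun t => ∫ τ in t..(t + h), F τ := by
  have hi := intervalIntegrable_of_measurable_of_bounded hF
    (fun t => by rw [abs_of_nonneg (hF0 t)]; exact hFω t)
  have hG := intervalIntegral.continuous_primitive hi 0
  have : (fun t => ∫ τ in t..(t + h), F τ)
      = fun t => (∫ τ in (0 : ℝ)..(t + h), F τ) - ∫ τ in (0 : ℝ)..t, F τ := by
    funext t
    rw [intervalIntegral.integral_interval_sub_left (hi _ _) (hi _ _)]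
  rw [this]
  exact (hG.comp (continuous_id.add continuous_const)).sub hG

/-- Averaging over windows of length `h` costs a factor `h` and a boundary term. -/
lemma integral_window_integral_le (hF : Measurable F) (hF0 : ∀ t, 0 ≤ F t) (hFω : ∀ t, F t ≤ ω)
    {h : ℝ} (hh : 0 ≤ h) (T S : ℝ) :
    ∫ t in T..S, ∫ τ in t..(t + h), F τ ≤ h * ((∫ t in T..S, F t) + ω * h) := by
  have hi := intervalIntegrable_of_measurable_of_bounded hF
    (fun t => by rw [abs_of_nonneg (hF0 t)]; exact hFω t)
  set G : ℝ → ℝ := fun t => ∫ τ in (0 : ℝ)..t, F τ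
  have hG : Continuous G := intervalIntegral.continuous_primitive hi 0
  have hGsub : ∀ a b, ∫ τ in a..b, F τ = G b - G a := fun a b =>
    (intervalIntegral.integral_interval_sub_left (hi _ _) (hi _ _)).symm
  have hmono : Monotone G := fun a b hab => by
    have := intervalIntegral.integral_nonneg_of_forall (μ := volume) hab hF0
    rw [hGsub] at this
    linarith
  have hGi : ∀ a b, IntervalIntegrable G volume a b := fun a b => hG.intervalIntegrable a b
  have hswap : ∫ t in T..S, ∫ τ in t..(t + h), F τ
      = (∫ t in S..(S + h), G t) - ∫ t in T..(T + h), G t := by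
    simp_rw [hGsub]
    have hshift : Continuous fun t => G (t + h) := hG.comp (by fun_prop)
    rw [intervalIntegral.integral_sub (hshift.intervalIntegrable T S) (hGi _ _),
      intervalIntegral.integral_comp_add_right (fun t => G t) h]
    have e1 := intervalIntegral.integral_add_adjacent_intervals (hGi T (T + h)) (hGi (T + h) (S + h))
    have e2 := intervalIntegral.integral_add_adjacent_intervals (hGi T S) (hGi S (S + h))
    linarith
  have hup : ∫ t in S..(S + h), G t ≤ h * G (S + h) := by
    have := intervalIntegral.integral_mono_on (by linarith) (hGi S (S + h))
      (intervalIntegrable_const (c := G (S + h))) (fun x hx => hmono hx.2)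
    simpa using this
  have hlow : h * G T ≤ ∫ t in T..(T + h), G t := by
    have := intervalIntegral.integral_mono_on (by linarith) (intervalIntegrable_const (c := G T))
      (hGi T (T + h)) (fun x hx => hmono hx.1)
    simpa using this
  have hend := window_integral_le hF0 hFω hh S
  rw [hGsub] at hend
  rw [hswap, hGsub]
  nlinarith

/-- The absorption estimate for a weighted series of window integrals. -/
lemma integral_tsum_window_le {f : ℝ → ℝ} {a h : ℕ → ℝ} (hF : Measurable F) (hF0 : ∀ t, 0 ≤ F t)
    (hFω : ∀ t, F t ≤ ω) (hf : Measurable f) (hf0 : ∀ t, 0 ≤ f t) (hfω : ∀ t, f t ≤ ω)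
    (ha : ∀ k, 0 ≤ a k) (hh : ∀ k, 0 ≤ h k) (hs1 : Summable fun k => a k * h k)
    (hs2 : Summable fun k => a k * h k ^ 2) {T S : ℝ} (hTS : T ≤ S) :
    IntegrableOn (fun t => ∑' k, a k * f (t + h k) * ∫ τ in t..(t + h k), F τ) (Set.Ioc T S) ∧
    ∫ t in T..S, ∑' k, a k * f (t + h k) * ∫ τ in t..(t + h k), F τ
      ≤ ((∑' k, a k * h k) + ω * ∑' k, a k * h k ^ 2) * (⨆ s ∈ Set.Ici T, f s) *
        ((∫ t in T..S, F t) + 1) := by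
  have hω : 0 ≤ ω := (hF0 0).trans (hFω 0)
  set μ : ℝ := ⨆ s ∈ Set.Ici T, f s
  have hμ : ∀ s, T ≤ s → f s ≤ μ := fun s hs => by
    refine le_ciSup_of_le ⟨ω, ?_⟩ s ?_
    · rintro _ ⟨r, rfl⟩
      exact Real.iSup_le (fun _ => hfω r) hω
    · rw [ciSup_pos (show s ∈ Set.Ici T from hs)]
  have hμ0 : 0 ≤ μ := (hf0 T).trans (hμ T le_rfl)
  set v : ℕ → ℝ → ℝ := fun k t => a k * f (t + h k) * ∫ τ in t..(t + h k), F τ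
  have hW := fun k => continuous_window_integral hF hF0 hFω (h k)
  have hvm : ∀ k, Measurable (v k) := fun k =>
    ((hf.comp (measurable_id.add_const (h k))).const_mul (a k)).mul (hW k).measurable
  have hv0 : ∀ k t, 0 ≤ v k t := fun k t =>
    mul_nonneg (mul_nonneg (ha k) (hf0 _)) (window_integral_nonneg hF0 (hh k) t)
  have hvb : ∀ k t, v k t ≤ ω ^ 2 * (a k * h k) := fun k t => by
    calc v k t ≤ a k * ω * (ω * h k) :=
          mul_le_mul (mul_le_mul_of_nonneg_left (hfω _) (ha k))
            (window_integral_le hF0 hFω (hh k) t) (window_integral_nonneg hF0 (hh k) t)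
            (mul_nonneg (ha k) hω)
      _ = ω ^ 2 * (a k * h k) := by ring
  have hbs : Summable fun k => ω ^ 2 * (a k * h k) := hs1.mul_left _
  have hvs : ∀ t, Summable fun k => v k t := fun t =>
    Summable.of_nonneg_of_le (fun k => hv0 k t) (fun k => hvb k t) hbs
  refine ⟨Measure.integrableOn_of_bounded (M := ∑' k, ω ^ 2 * (a k * h k)) (by simp)
    (Measurable.tsum hvm).aestronglyMeasurable (Eventually.of_forall fun t => ?_), ?_⟩
  · rw [Real.norm_of_nonneg (tsum_nonneg fun k => hv0 k t)]
    exact (hvs t).tsum_le_tsum (fun k => hvb k t) hbs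
  have hsum : HasSum (fun k => ∫ t in T..S, v k t) (∫ t in T..S, ∑' k, v k t) :=
    intervalIntegral.hasSum_integral_of_dominated_convergence
      (fun k _ => ω ^ 2 * (a k * h k)) (fun k => (hvm k).aestronglyMeasurable)
      (fun k => Eventually.of_forall fun t _ => by
        rw [Real.norm_of_nonneg (hv0 k t)]; exact hvb k t)
      (Eventually.of_forall fun _ _ => hbs) intervalIntegrable_const
      (Eventually.of_forall fun t _ => (hvs t).hasSum)
  set J : ℝ := ∫ t in T..S, F t
  have hJ0 : 0 ≤ J := intervalIntegral.integral_nonneg_of_forall hTS hF0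
  have hterm : ∀ k, ∫ t in T..S, v k t ≤ μ * J * (a k * h k) + μ * ω * (a k * h k ^ 2) := fun k => by
    have hle : ∫ t in T..S, v k t ≤ ∫ t in T..S, a k * μ * ∫ τ in t..(t + h k), F τ := by
      refine intervalIntegral.integral_mono_on hTS
        (intervalIntegrable_of_measurable_of_bounded (hvm k)
          (fun t => by rw [abs_of_nonneg (hv0 k t)]; exact hvb k t) T S)
        ((hW k).const_mul _ |>.intervalIntegrable T S) fun t ht => ?_
      exact mul_le_mul_of_nonneg_right
        (mul_le_mul_of_nonneg_left (hμ _ (by linarith [ht.1, hh k])) (ha k))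
        (window_integral_nonneg hF0 (hh k) t)
    rw [intervalIntegral.integral_const_mul] at hle
    have := mul_le_mul_of_nonneg_left (integral_window_integral_le hF hF0 hFω (hh k) T S)
      (mul_nonneg (ha k) hμ0)
    calc _ ≤ _ := hle.trans this
      _ = _ := by ring
  have hbound := hasSum_le hterm hsum
    ((hs1.hasSum.mul_left (μ * J)).add (hs2.hasSum.mul_left (μ * ω)))
  have hA1 : 0 ≤ ∑' k, a k * h k := tsum_nonneg fun k => mul_nonneg (ha k) (hh k)
  have hA2 : 0 ≤ ∑' k, a k * h k ^ 2 := tsum_nonneg fun k => mul_nonneg (ha k) (sq_nonneg _)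
  refine hbound.trans ?_
  have h1 := mul_nonneg hA1 hμ0
  have h2 := mul_nonneg (mul_nonneg (mul_nonneg hω hA2) hμ0) hJ0
  linear_combination h1 + h2

end Window

lemma measurableSet_Lam {n : ℕ} {u : En n → ℝ} (hu : SolutionHyp u) : MeasurableSet (Lam u) := by
  obtain ⟨-, ⟨L, hL⟩, -⟩ := hu
  have ho := hL.continuousOn.isOpen_inter_preimage isOpen_ball (isOpen_compl_singleton (x := 0))
  have : Lam u = ball 0 1 \ (ball 0 1 ∩ (fun x => gradient u x) ⁻¹' {0}ᶜ) := by
    ext x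
    simp only [Lam, Set.mem_ofPred_eq, Set.mem_sdiff, Set.mem_inter_iff, Set.mem_preimage,
      Set.mem_compl_iff, Set.mem_singleton_iff]
    tauto
  rw [this]
  exact measurableSet_ball.diff ho.measurableSet

/-- Second moments of the dilates of a measurable set inside a fixed set depend measurably on the
dilation parameter. -/
lemma measurable_setIntegral_exp_smul {n : ℕ} {A K : Set (En n)} (hA : MeasurableSet A)
    (hK : MeasurableSet K) : Measurable fun t : ℝ => ∫ x in (Real.exp t • A) ∩ K, ‖x‖ ^ 2 := by
  have hmem : ∀ t : ℝ, Real.exp t • A = {x | Real.exp (-t) • x ∈ A} := fun t => by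
    ext x
    rw [Set.mem_smul_set_iff_inv_smul_mem₀ (Real.exp_ne_zero t), ← Real.exp_neg]
    rfl
  have hmap : Measurable fun p : ℝ × En n => Real.exp (-p.1) • p.2 := by fun_prop
  have hset : MeasurableSet {p : ℝ × En n | Real.exp (-p.1) • p.2 ∈ A ∧ p.2 ∈ K} :=
    (hmap hA).inter (measurable_snd hK)
  have hint : ∀ t : ℝ, ∫ x in (Real.exp t • A) ∩ K, ‖x‖ ^ 2
      = ∫ x, {p : ℝ × En n | Real.exp (-p.1) • p.2 ∈ A ∧ p.2 ∈ K}.indicator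
          (fun p => ‖p.2‖ ^ 2) (t, x) := fun t => by
    rw [← integral_indicator ((hA.const_smul₀ _).inter hK), hmem t]
    rfl
  simp_rw [hint]
  have hm : Measurable ({p : ℝ × En n | Real.exp (-p.1) • p.2 ∈ A ∧ p.2 ∈ K}.indicator
      (fun p => ‖p.2‖ ^ 2)) := Measurable.indicator (by fun_prop) hset
  exact (StronglyMeasurable.integral_prod_right
    (f := fun (t : ℝ) (x : En n) => {p : ℝ × En n | Real.exp (-p.1) • p.2 ∈ A ∧ p.2 ∈ K}.indicator
      (fun p => ‖p.2‖ ^ 2) (t, x)) hm.stronglyMeasurable).measurable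

lemma setIntegral_norm_sq_le_of_subset_ball {n : ℕ} {s : Set (En n)} (hs : s ⊆ ball 0 1) :
    ∫ x in s, ‖x‖ ^ 2 ≤ volume.real (ball (0 : En n) 1) := by
  have hfin : volume (ball (0 : En n) 1) < ⊤ := measure_ball_lt_top
  have := norm_setIntegral_le_of_norm_le_const (μ := volume) (s := s) (f := fun x : En n => ‖x‖ ^ 2)
    (C := 1) ((measure_mono hs).trans_lt hfin) (fun x hx => by
      have hx' := mem_ball_zero_iff.1 (hs hx)
      rw [Real.norm_of_nonneg (by positivity)]
      exact pow_le_one₀ (norm_nonneg x) hx'.le)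
  rw [one_mul] at this
  exact (le_abs_self _).trans (this.trans (measureReal_mono hs hfin.ne))

lemma summable_two_zpow_mul_pow (n j : ℕ) :
    Summable fun k : ℕ => (2 : ℝ) ^ (-((k * (n + 2) : ℕ) : ℤ)) * ((k : ℝ) * Real.log 2) ^ j := by
  have hr : ‖((2 : ℝ) ^ (n + 2))⁻¹‖ < 1 := by
    rw [norm_inv, norm_pow, Real.norm_ofNat]
    exact inv_lt_one_of_one_lt₀ (one_lt_pow₀ one_lt_two (by omega))
  refine ((summable_pow_mul_geometric_of_norm_lt_one j hr).mul_left (Real.log 2 ^ j)).congr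
    fun k => ?_
  rw [zpow_neg, zpow_natCast, mul_comm k, pow_mul, mul_pow, inv_pow]
  ring

/-- absorption estimate ∫_T^S V ≤ C_n μ_T (∫_T^S F + 1). -/
theorem stmt_17 (n : ℕ) (hn : 2 ≤ n) :
    ∃ Cn : ℝ, ∀ u : En n → ℝ, SolutionHyp u →
      ∀ T S : ℝ, 0 < T → T < S →
        IntegrableOn (Vdef u) (Set.Ioc T S) ∧
        ∫ t in T..S, Vdef u t
          ≤ Cn * (⨆ s ∈ Set.Ici T, F0 u s) * ((∫ t in T..S, Fdef u t) + 1) := by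
  have hlog : 0 ≤ Real.log 2 := Real.log_nonneg one_le_two
  have hann : MeasurableSet (ann0 n) :=
    (measurableSet_lt measurable_const measurable_norm).inter
      (measurableSet_lt measurable_norm measurable_const)
  have hannb : ann0 n ⊆ ball 0 1 := fun x hx => mem_ball_zero_iff.2 hx.2
  refine ⟨(∑' k : ℕ, (2 : ℝ) ^ (-((k * (n + 2) : ℕ) : ℤ)) * ((k : ℝ) * Real.log 2)) +
    volume.real (ball (0 : En n) 1) *
      ∑' k : ℕ, (2 : ℝ) ^ (-((k * (n + 2) : ℕ) : ℤ)) * ((k : ℝ) * Real.log 2) ^ 2,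
    fun u hu T S _ hTS => ?_⟩
  have hLam := measurableSet_Lam hu
  exact integral_tsum_window_le (F := Fdef u) (f := F0 u)
    (measurable_setIntegral_exp_smul hLam measurableSet_ball)
    (fun t => integral_nonneg fun x => sq_nonneg _)
    (fun t => setIntegral_norm_sq_le_of_subset_ball Set.inter_subset_right)
    (measurable_setIntegral_exp_smul hLam hann)
    (fun t => integral_nonneg fun x => sq_nonneg _)
    (fun t => setIntegral_norm_sq_le_of_subset_ball (Set.inter_subset_right.trans hannb))
    (fun k => by positivity) (fun k => by positivity)
    (by simpa using summable_two_zpow_mul_pow n 1) (summable_two_zpow_mul_pow n 2) hTS.le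

end
end

section
/- Assume the origin is a singular point. Then there exists T < ∞ such that ∫_T^∞ F(t) dt < ∞; consequently the quadratic coefficient has finite total variation, ∫_T^∞ |B′(t)| dt < ∞, and there exists B_∞ ∈ S₀ such that B(t) → B_∞ as t → ∞. -/
open MeasureTheory Metric Filter Topology Pointwise

noncomputable section

/-- A continuous compactly supported function times a bounded measurable one is integrable. -/
theorem Continuous.integrable_mul_of_hasCompactSupport {E : Type*}
    [NormedAddCommGroup E] [MeasurableSpace E] [BorelSpace E] {μ : Measure E}
    [IsFiniteMeasureOnCompacts μ] {φ g : E → ℝ} (hφ : Continuous φ) (hφc : HasCompactSupport φ)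
    (hg : AEStronglyMeasurable g μ) {C : ℝ} (hC : ∀ x, |g x| ≤ C) :
    Integrable (fun x => φ x * g x) μ := by
  have h := hφ.integrable_of_hasCompactSupport (μ := μ) hφc
  exact h.mul_bdd hg (Eventually.of_forall hC)

section LineDeriv

variable {E : Type*} [NormedAddCommGroup E] [NormedSpace ℝ E]

theorem lineDeriv_eq_zero_of_notMem_tsupport {g : E → ℝ} {x : E} (hx : x ∉ tsupport g) (v : E) :
    lineDeriv ℝ g x v = 0 := by
  have h : g =ᶠ[𝓝 x] fun _ => 0 := notMem_tsupport_iff_eventuallyEq.1 hx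
  rw [h.lineDeriv_eq]
  simp [lineDeriv]

variable [MeasurableSpace E] [BorelSpace E]

variable [FiniteDimensional ℝ E] {μ : Measure E} [μ.IsAddHaarMeasure] {C D : NNReal} {f g : E → ℝ}

theorem LipschitzWith.integrable_lineDeriv_of_hasCompactSupport (hg : LipschitzWith D g)
    (hgc : HasCompactSupport g) (w : E) : Integrable (fun x => lineDeriv ℝ g x w) μ := by
  have h1 : IntegrableOn (fun x => lineDeriv ℝ g x w) (tsupport g) μ :=
    (hg.locallyIntegrable_lineDeriv w).integrableOn_isCompact hgc
  exact (integrableOn_iff_integrable_of_support_subset fun x hx => by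
    by_contra h; exact hx (lineDeriv_eq_zero_of_notMem_tsupport h w)).1 h1

/-- The integral of a product of two line derivatives of Lipschitz functions, one of them
compactly supported, is symmetric in the two directions. -/
theorem LipschitzWith.integral_lineDeriv_mul_lineDeriv_comm
    (hf : LipschitzWith C f) (hg : LipschitzWith D g) (hgc : HasCompactSupport g) (v w : E) :
    ∫ x, lineDeriv ℝ f x v * lineDeriv ℝ g x w ∂μ =
      ∫ x, lineDeriv ℝ f x w * lineDeriv ℝ g x v ∂μ := by
  set K := cthickening ‖v‖ (tsupport g) with hK
  have K_compact : IsCompact K := IsCompact.cthickening hgc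
  have hbd : ∀ x, ‖lineDeriv ℝ f x w‖ ≤ C * ‖w‖ := fun x =>
    norm_lineDeriv_le_of_lipschitz ℝ hf
  have hmeas : AEStronglyMeasurable (fun x => lineDeriv ℝ f x w) μ :=
    aestronglyMeasurable_lineDeriv hf.continuous μ
  have h_int : Integrable (K.indicator fun x => lineDeriv ℝ f x w) μ := by
    rw [integrable_indicator_iff K_compact.measurableSet]
    exact (hf.locallyIntegrable_lineDeriv w).integrableOn_isCompact K_compact
  have T1 := integral_inv_smul_sub_mul_tendsto_integral_lineDeriv_mul (μ := μ) hf
    (hg.integrable_lineDeriv_of_hasCompactSupport (μ := μ) hgc w) v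
  have T2 := integral_inv_smul_sub_mul_tendsto_integral_lineDeriv_mul (μ := μ) hg h_int (-v)
  have hlim : ∫ x, lineDeriv ℝ g x (-v) * K.indicator (fun x => lineDeriv ℝ f x w) x ∂μ =
      - ∫ x, lineDeriv ℝ f x w * lineDeriv ℝ g x v ∂μ := by
    rw [← integral_neg]
    congr 1; ext x
    rw [lineDeriv_neg]
    by_cases hx : x ∈ tsupport g
    · rw [Set.indicator_of_mem (self_subset_cthickening _ hx)]; ring
    · rw [lineDeriv_eq_zero_of_notMem_tsupport hx]; ring
  rw [hlim] at T2
  have T3 := T2.neg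
  rw [neg_neg] at T3
  refine tendsto_nhds_unique T1 (T3.congr' ?_)
  filter_upwards [Ioc_mem_nhdsGT (zero_lt_one (α := ℝ))] with t ht
  have t_pos : 0 < t := ht.1
  have hk : LipschitzWith (‖t⁻¹‖₊ * (C + C)) (fun x => t⁻¹ • (f (x + t • v) - f x)) := by
    have h1 : LipschitzWith (C + C) (fun x => f (x + t • v) - f x) := by
      have := (hf.comp (isometry_add_right (t • v)).lipschitz).sub hf
      simpa using this
    exact (lipschitzWith_smul t⁻¹).comp h1
  have IBP := hk.integral_lineDeriv_mul_eq (μ := μ) hg hgc w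
  have hder : ∀ᵐ x ∂μ, lineDeriv ℝ (fun x => t⁻¹ • (f (x + t • v) - f x)) x w =
      t⁻¹ • (lineDeriv ℝ f (x + t • v) w - lineDeriv ℝ f x w) := by
    have h1 := hf.ae_lineDifferentiableAt (μ := μ) w
    have h2 : ∀ᵐ x ∂μ, LineDifferentiableAt ℝ f (x + t • v) w :=
      (measurePreserving_add_right μ (t • v)).quasiMeasurePreserving.ae h1
    filter_upwards [h1, h2] with x hx1 hx2
    have a1 := hx1.hasLineDerivAt
    have a2 := hx2.hasLineDerivAt
    have a3 : HasLineDerivAt ℝ (fun x => f (x + t • v)) (lineDeriv ℝ f (x + t • v) w) x w := by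
      unfold HasLineDerivAt at a2 ⊢
      convert a2 using 3
      abel
    have a4 : HasLineDerivAt ℝ (fun x => t⁻¹ • (f (x + t • v) - f x))
        (t⁻¹ • (lineDeriv ℝ f (x + t • v) w - lineDeriv ℝ f x w)) x w := by
      unfold HasLineDerivAt at *
      exact (a3.sub a1).const_smul t⁻¹
    exact a4.lineDeriv
  have e1 : ∫ x, (t⁻¹ • (f (x + t • v) - f x)) * lineDeriv ℝ g x w ∂μ =
      - ∫ x, (t⁻¹ • (lineDeriv ℝ f (x + t • v) w - lineDeriv ℝ f x w)) * g x ∂μ := by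
    have h0 : ∫ x, lineDeriv ℝ (fun x => t⁻¹ • (f (x + t • v) - f x)) x w * g x ∂μ =
        ∫ x, (t⁻¹ • (lineDeriv ℝ f (x + t • v) w - lineDeriv ℝ f x w)) * g x ∂μ :=
      integral_congr_ae (hder.mono fun x hx => congrArg (· * g x) hx)
    rw [← h0, IBP, ← integral_neg]
    congr 1; ext x; rw [lineDeriv_neg]; ring
  rw [e1]
  congr 1
  have i1 : Integrable (fun x => g x * lineDeriv ℝ f (x + t • v) w) μ :=
    hg.continuous.integrable_mul_of_hasCompactSupport hgc
      (hmeas.comp_quasiMeasurePreserving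
        (measurePreserving_add_right μ (t • v)).quasiMeasurePreserving) (fun x => hbd _)
  have i2 : Integrable (fun x => g x * lineDeriv ℝ f x w) μ :=
    hg.continuous.integrable_mul_of_hasCompactSupport hgc hmeas hbd
  have i3 : Integrable (fun x => g (x - t • v) * lineDeriv ℝ f x w) μ := by
    have := i1.comp_sub_right (t • v)
    simpa using this
  have e2 : ∫ x, g x * lineDeriv ℝ f (x + t • v) w ∂μ =
      ∫ x, g (x - t • v) * lineDeriv ℝ f x w ∂μ := by
    rw [← integral_sub_right_eq_self _ (t • v)]; simp
  have e3 : ∀ x, (t⁻¹ • (g (x + t • -v) - g x)) * K.indicator (fun x => lineDeriv ℝ f x w) x =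
      t⁻¹ * (g (x - t • v) * lineDeriv ℝ f x w - g x * lineDeriv ℝ f x w) := by
    intro x
    rw [smul_neg, ← sub_eq_add_neg]
    by_cases hx : x ∈ K
    · rw [Set.indicator_of_mem hx]; simp only [smul_eq_mul]; ring
    · have A : g x = 0 := by
        by_contra h; exact hx (self_subset_cthickening _ (subset_tsupport _ h))
      have B : g (x - t • v) = 0 := by
        by_contra h
        apply hx
        apply mem_cthickening_of_dist_le _ _ (‖v‖) (tsupport g) (subset_tsupport _ h)
        simp only [dist_eq_norm, sub_sub_cancel, norm_smul, Real.norm_eq_abs,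
          abs_of_nonneg t_pos.le]
        exact mul_le_of_le_one_left (norm_nonneg v) ht.2
      rw [A, B]; simp
  have e4 : ∀ x, (t⁻¹ • (lineDeriv ℝ f (x + t • v) w - lineDeriv ℝ f x w)) * g x =
      t⁻¹ * (g x * lineDeriv ℝ f (x + t • v) w - g x * lineDeriv ℝ f x w) := by
    intro x; simp only [smul_eq_mul]; ring
  simp_rw [e3, e4]
  rw [integral_const_mul, integral_const_mul, integral_sub i1 i2, integral_sub i3 i2, e2]

/-- The line derivative of a compactly supported Lipschitz function has zero integral. -/
theorem LipschitzWith.integral_lineDeriv_eq_zero (hg : LipschitzWith D g)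
    (hgc : HasCompactSupport g) (v : E) : ∫ x, lineDeriv ℝ g x v ∂μ = 0 := by
  have h := (LipschitzWith.const (1 : ℝ) :
    LipschitzWith 0 fun _ : E => (1 : ℝ)).integral_lineDeriv_mul_eq
    (μ := μ) hg hgc (-v)
  have h0 : ∀ x : E, lineDeriv ℝ (fun _ : E => (1 : ℝ)) x (-v) = 0 := fun x => by simp [lineDeriv]
  simpa [h0] using h.symm

end LineDeriv

section Weights

variable {n : ℕ}

/-- The smooth radial cutoff function vanishing outside the unit ball. -/
def cutoff (x : En n) : ℝ := Real.smoothTransition (1 - ‖x‖ ^ 2)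

/-- The nonnegative radial density `κ` with `∇ cutoff = -κ x`. -/
def cutoffDensity (x : En n) : ℝ := 2 * deriv Real.smoothTransition (1 - ‖x‖ ^ 2)

/-- Continuous functions vanishing outside the unit ball. -/
structure IsWeight (φ : En n → ℝ) : Prop where
  cont : Continuous φ
  zero : ∀ x, 1 ≤ ‖x‖ → φ x = 0

theorem IsWeight.hasCompactSupport {φ : En n → ℝ} (h : IsWeight φ) : HasCompactSupport φ :=
  HasCompactSupport.intro (isCompact_closedBall 0 1) fun x hx => h.zero x <| by
    simpa using (not_le.1 fun h' => hx (mem_closedBall_zero_iff.2 h')).le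

theorem cutoff_contDiff : ContDiff ℝ 1 (cutoff (n := n)) :=
  (Real.smoothTransition.contDiff (n := 1)).comp (contDiff_const.sub (contDiff_norm_sq ℝ))

theorem cutoff_isWeight : IsWeight (cutoff (n := n)) where
  cont := cutoff_contDiff.continuous
  zero x hx := Real.smoothTransition.zero_of_nonpos (by nlinarith [norm_nonneg x])

theorem cutoff_nonneg (x : En n) : 0 ≤ cutoff x := Real.smoothTransition.nonneg _

theorem cutoff_le_one (x : En n) : cutoff x ≤ 1 := Real.smoothTransition.le_one _

theorem cutoff_lower {x : En n} (hx : ‖x‖ ≤ 1 / 2) :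
    Real.smoothTransition (3 / 4) ≤ cutoff x :=
  Real.smoothTransition.monotone (by nlinarith [norm_nonneg x])

theorem cutoffDensity_isWeight : IsWeight (cutoffDensity (n := n)) where
  cont := by
    have h : Continuous (deriv Real.smoothTransition) :=
      (Real.smoothTransition.contDiff (n := 1)).continuous_deriv (by simp)
    unfold cutoffDensity
    fun_prop
  zero x hx := by
    have h : IsLocalMin Real.smoothTransition (1 - ‖x‖ ^ 2) := by
      refine Eventually.of_forall fun y => ?_
      rw [Real.smoothTransition.zero_of_nonpos (by nlinarith [norm_nonneg x])]
      exact Real.smoothTransition.nonneg y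
    rw [cutoffDensity, h.deriv_eq_zero, mul_zero]

theorem cutoffDensity_nonneg (x : En n) : 0 ≤ cutoffDensity x :=
  mul_nonneg zero_le_two Real.smoothTransition.monotone.deriv_nonneg

theorem cutoff_hasLineDerivAt (x v : En n) :
    HasLineDerivAt ℝ cutoff (-(cutoffDensity x * inner ℝ x v)) x v := by
  have h1 : HasFDerivAt (fun y : En n => 1 - ‖y‖ ^ 2) (-(2 • innerSL ℝ x)) x :=
    (hasStrictFDerivAt_norm_sq x).hasFDerivAt.const_sub 1
  have h2 : HasDerivAt Real.smoothTransition (deriv Real.smoothTransition (1 - ‖x‖ ^ 2))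
      (1 - ‖x‖ ^ 2) :=
    ((Real.smoothTransition.contDiff (n := 1)).differentiable (by simp)).differentiableAt.hasDerivAt
  have h3 := (h2.comp_hasFDerivAt x h1).hasLineDerivAt v
  have h4 : (deriv Real.smoothTransition (1 - ‖x‖ ^ 2) • (-(2 • innerSL ℝ x))) v =
      -(cutoffDensity x * inner ℝ x v) := by
    simp [cutoffDensity]
    ring
  rwa [h4] at h3

end Weights

section LocBdd

variable {n : ℕ}

/-- Locally bounded measurable functions. -/
structure LocBdd (f : En n → ℝ) : Prop where
  meas : AEStronglyMeasurable f volume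
  bdd : ∀ r, ∃ C, ∀ x, ‖x‖ ≤ r → |f x| ≤ C

theorem LocBdd.of_continuous {f : En n → ℝ} (h : Continuous f) : LocBdd f where
  meas := h.aestronglyMeasurable
  bdd r := by
    obtain ⟨C, hC⟩ := (isCompact_closedBall (0 : En n) r).exists_bound_of_continuousOn
      h.continuousOn
    exact ⟨C, fun x hx => hC x (mem_closedBall_zero_iff.2 hx)⟩

variable {f g : En n → ℝ}

theorem LocBdd.add (hf : LocBdd f) (hg : LocBdd g) : LocBdd fun x => f x + g x where
  meas := hf.meas.add hg.meas
  bdd r := by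
    obtain ⟨C, hC⟩ := hf.bdd r
    obtain ⟨D, hD⟩ := hg.bdd r
    exact ⟨C + D, fun x hx => (abs_add_le _ _).trans (add_le_add (hC x hx) (hD x hx))⟩

theorem LocBdd.mul (hf : LocBdd f) (hg : LocBdd g) : LocBdd fun x => f x * g x where
  meas := hf.meas.mul hg.meas
  bdd r := by
    obtain ⟨C, hC⟩ := hf.bdd r
    obtain ⟨D, hD⟩ := hg.bdd r
    refine ⟨C * D, fun x hx => ?_⟩
    rw [abs_mul]
    exact mul_le_mul (hC x hx) (hD x hx) (abs_nonneg _) ((abs_nonneg _).trans (hC x hx))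

theorem LocBdd.neg (hf : LocBdd f) : LocBdd fun x => -f x where
  meas := hf.meas.neg
  bdd r := by simpa using hf.bdd r

theorem LocBdd.sub (hf : LocBdd f) (hg : LocBdd g) : LocBdd fun x => f x - g x := by
  simpa [sub_eq_add_neg] using hf.add hg.neg

theorem LocBdd.sq (hf : LocBdd f) : LocBdd fun x => f x ^ 2 := by
  simpa [pow_two] using hf.mul hf

theorem LocBdd.const (c : ℝ) : LocBdd fun _ : En n => c := .of_continuous continuous_const

theorem LocBdd.coord (i : Fin n) : LocBdd fun x : En n => x i := .of_continuous (by fun_prop)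

theorem LocBdd.sum {ι : Type*} (s : Finset ι) {f : ι → En n → ℝ} (h : ∀ i, LocBdd (f i)) :
    LocBdd fun x => ∑ i ∈ s, f i x := by
  classical
  induction s using Finset.induction_on with
  | empty => simpa using LocBdd.const 0
  | insert a s ha ih => simpa [Finset.sum_insert ha] using (h a).add ih

theorem IsWeight.integrable_mul {φ : En n → ℝ} (hφ : IsWeight φ) (hf : LocBdd f) :
    Integrable fun x => φ x * f x := by
  obtain ⟨C, hC⟩ := hf.bdd 1
  have h : Integrable fun x => φ x * (closedBall (0 : En n) 1).indicator f x :=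
    hφ.cont.integrable_mul_of_hasCompactSupport hφ.hasCompactSupport
      (hf.meas.indicator measurableSet_closedBall) (C := max C 0) fun x => by
        by_cases hx : x ∈ closedBall (0 : En n) 1
        · rw [Set.indicator_of_mem hx]
          exact (hC x (mem_closedBall_zero_iff.1 hx)).trans (le_max_left _ _)
        · rw [Set.indicator_of_notMem hx]; simp
  refine h.congr (Eventually.of_forall fun x => ?_)
  by_cases hx : x ∈ closedBall (0 : En n) 1
  · simp [Set.indicator_of_mem hx]
  · have : φ x = 0 := hφ.zero x (not_le.1 fun h' => hx (mem_closedBall_zero_iff.2 h')).le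
    simp [this]

end LocBdd

section Partials

variable {n : ℕ} {w : En n → En n} {K : NNReal}

/-- The partial derivative `∂ⱼ wᵢ` of a vector field. -/
def pd (w : En n → En n) (i j : Fin n) (x : En n) : ℝ :=
  lineDeriv ℝ (fun y => w y i) x (EuclideanSpace.single j 1)

theorem LipschitzWith.coord (hw : LipschitzWith K w) (i : Fin n) :
    LipschitzWith K fun y => w y i :=
  LipschitzWith.of_dist_le_mul fun x y => by
    refine le_trans ?_ (hw.dist_le_mul x y)
    rw [dist_eq_norm, dist_eq_norm]
    exact PiLp.norm_apply_le (w x - w y) i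

theorem LipschitzWith.pd_locBdd (hw : LipschitzWith K w) (i j : Fin n) : LocBdd (pd w i j) where
  meas := aestronglyMeasurable_lineDeriv (hw.coord i).continuous _
  bdd _ := ⟨K, fun x _ => by
    simpa [pd] using norm_lineDeriv_le_of_lipschitz ℝ (v := EuclideanSpace.single j (1 : ℝ))
      (x₀ := x) (hw.coord i)⟩

theorem LipschitzWith.coord_locBdd (hw : LipschitzWith K w) (i : Fin n) : LocBdd fun x => w x i :=
  .of_continuous (hw.coord i).continuous

theorem LipschitzWith.ae_hasLineDerivAt_pd (hw : LipschitzWith K w) :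
    ∀ᵐ x, ∀ i j, HasLineDerivAt ℝ (fun y => w y i) (pd w i j x) x (EuclideanSpace.single j 1) := by
  rw [ae_all_iff]; intro i
  rw [ae_all_iff]; intro j
  filter_upwards [(hw.coord i).ae_lineDifferentiableAt (μ := volume) (EuclideanSpace.single j 1)]
    with x hx using hx.hasLineDerivAt

/-- The product of two Lipschitz functions, one compactly supported, is Lipschitz. -/
theorem LipschitzWith.exists_mul_of_hasCompactSupport {E : Type*} [NormedAddCommGroup E]
    {φ f : E → ℝ} {C D : NNReal} (hφ : LipschitzWith C φ) (hφc : HasCompactSupport φ)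
    (hf : LipschitzWith D f) : ∃ L, LipschitzWith L fun x => φ x * f x := by
  obtain ⟨M, hM⟩ := hφc.exists_bound_of_continuous hφ.continuous
  obtain ⟨N, hN⟩ := hφc.isCompact.exists_bound_of_continuousOn hf.continuous.continuousOn
  have key : ∀ x y, x ∈ tsupport φ → |φ x * f x - φ y * f y| ≤
      (max M 0 * D + max N 0 * C) * ‖x - y‖ := by
    intro x y hx
    have h1 := hφ.norm_sub_le x y
    have h2 := hf.norm_sub_le x y
    have h3 : |φ y| ≤ max M 0 := (hM y).trans (le_max_left _ _)
    have h4 : |f x| ≤ max N 0 := (hN x hx).trans (le_max_left _ _)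
    rw [Real.norm_eq_abs] at h1 h2
    calc |φ x * f x - φ y * f y| = |φ y * (f x - f y) + f x * (φ x - φ y)| := by ring_nf
      _ ≤ |φ y| * |f x - f y| + |f x| * |φ x - φ y| := by
        rw [← abs_mul, ← abs_mul]; exact abs_add_le _ _
      _ ≤ max M 0 * (D * ‖x - y‖) + max N 0 * (C * ‖x - y‖) := by gcongr
      _ = _ := by ring
  refine ⟨⟨max M 0 * D + max N 0 * C, by positivity⟩, LipschitzWith.of_dist_le_mul fun x y => ?_⟩
  rw [dist_eq_norm, dist_eq_norm, Real.norm_eq_abs]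
  by_cases hx : x ∈ tsupport φ
  · exact key x y hx
  by_cases hy : y ∈ tsupport φ
  · rw [abs_sub_comm, norm_sub_rev]; exact key y x hy
  · rw [image_eq_zero_of_notMem_tsupport hx, image_eq_zero_of_notMem_tsupport hy]
    simp only [zero_mul, sub_self, abs_zero]
    exact mul_nonneg (NNReal.coe_nonneg _) (norm_nonneg _)

/-- For a compactly supported field `g` and a field `s` whose derivative is symmetric on the support
of `g`, the Dirichlet pairing equals the pairing of divergences. -/
theorem integral_pd_mul_pd_eq_div_mul_div {g s : En n → En n} {C : NNReal} {D : Fin n → NNReal}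
    (hs : LipschitzWith C s)
    (hg : ∀ i, LipschitzWith (D i) fun x => g x i) (hgc : ∀ i, HasCompactSupport fun x => g x i)
    (hsymm : ∀ᵐ x, ∀ i j, x ∈ tsupport (fun x => g x i) → pd s i j x = pd s j i x) :
    ∫ x, ∑ i, ∑ j, pd g i j x * pd s i j x = ∫ x, (∑ i, pd g i i x) * ∑ j, pd s j j x := by
  have h_int : ∀ i j k l, Integrable fun x => pd g i j x * pd s k l x := fun i j k l => by
    have h1 : Integrable (pd g i j) :=
      (hg i).integrable_lineDeriv_of_hasCompactSupport (hgc i) (EuclideanSpace.single j 1)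
    exact h1.mul_bdd (hs.pd_locBdd k l).meas (c := C) (Eventually.of_forall fun x => by
      simpa [pd] using norm_lineDeriv_le_of_lipschitz ℝ (v := EuclideanSpace.single l (1 : ℝ))
        (x₀ := x) (hs.coord k))
  have hL : ∫ x, ∑ i, ∑ j, pd g i j x * pd s i j x =
      ∑ i, ∑ j, ∫ x, pd g i j x * pd s i j x := by
    rw [integral_finsetSum _ fun i _ => integrable_finsetSum _ fun j _ => h_int i j i j]
    exact Finset.sum_congr rfl fun i _ => integral_finsetSum _ fun j _ => h_int i j i j
  have hR : ∫ x, (∑ i, pd g i i x) * ∑ j, pd s j j x =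
      ∑ i, ∑ j, ∫ x, pd g i i x * pd s j j x := by
    simp_rw [Finset.sum_mul_sum]
    rw [integral_finsetSum _ fun i _ => integrable_finsetSum _ fun j _ => h_int i i j j]
    exact Finset.sum_congr rfl fun i _ => integral_finsetSum _ fun j _ => h_int i i j j
  rw [hL, hR]
  refine Finset.sum_congr rfl fun i _ => Finset.sum_congr rfl fun j _ => ?_
  have h1 : ∫ x, pd g i j x * pd s i j x = ∫ x, pd s j i x * pd g i j x := by
    refine integral_congr_ae ?_
    filter_upwards [hsymm] with x hx
    by_cases h : x ∈ tsupport (fun x => g x i)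
    · rw [hx i j h, mul_comm]
    · have : pd g i j x = 0 := lineDeriv_eq_zero_of_notMem_tsupport h _
      simp [this]
  have h2 := (hs.coord j).integral_lineDeriv_mul_lineDeriv_comm (μ := volume) (hg i) (hgc i)
    (EuclideanSpace.single i 1) (EuclideanSpace.single j 1)
  rw [h1]
  refine h2.trans (integral_congr_ae (Eventually.of_forall fun x => mul_comm _ _))

end Partials

section Energy

variable {n : ℕ}

/-- The radial derivative `∑ⱼ xⱼ ∂ⱼ wᵢ`. -/
def radD (w : En n → En n) (i : Fin n) (x : En n) : ℝ := ∑ j, x j * pd w i j x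

/-- The divergence of a vector field. -/
def divF (w : En n → En n) (x : En n) : ℝ := ∑ i, pd w i i x

/-- The indicator function of `{w ≠ 0}`. -/
def chi (w : En n → En n) : En n → ℝ := Set.indicator {y | w y ≠ 0} 1

/-- The defect of one-homogeneity, `w - x · ∇w`. -/
def homDefect (w : En n → En n) (i : Fin n) (x : En n) : ℝ := w x i - radD w i x

/-- The boundary flux density appearing in the energy comparison. -/
def flux (w : En n → En n) (i : Fin n) (x : En n) : ℝ := (1 - chi w x) * x i - homDefect w i x

/-- The Dirichlet energy density. -/
def dirE (w : En n → En n) (x : En n) : ℝ := ∑ i, ∑ j, pd w i j x ^ 2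

theorem chi_of_eq {w : En n → En n} {x : En n} (h : w x = 0) : chi w x = 0 := by
  simp [chi, h]

theorem chi_of_ne {w : En n → En n} {x : En n} (h : w x ≠ 0) : chi w x = 1 := by
  simp [chi, h]

theorem chi_mul_self (w : En n → En n) (x : En n) : chi w x * chi w x = chi w x := by
  by_cases h : w x = 0
  · simp [chi_of_eq h]
  · simp [chi_of_ne h]

theorem chi_le_one (w : En n → En n) (x : En n) : chi w x ≤ 1 := by
  by_cases h : w x = 0
  · simp [chi_of_eq h]
  · simp [chi_of_ne h]

theorem chi_nonneg (w : En n → En n) (x : En n) : 0 ≤ chi w x := by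
  by_cases h : w x = 0
  · simp [chi_of_eq h]
  · simp [chi_of_ne h]

variable {w d s : En n → En n} {K C D : NNReal}

theorem chi_locBdd (hw : Continuous w) : LocBdd (chi w) where
  meas := by
    have h : MeasurableSet {y | w y ≠ 0} := (isOpen_ne_fun hw continuous_const).measurableSet
    exact (measurable_one.indicator h).aestronglyMeasurable
  bdd _ := ⟨1, fun x _ => by
    rw [abs_of_nonneg (chi_nonneg w x)]; exact chi_le_one w x⟩

theorem LipschitzWith.radD_locBdd (hw : LipschitzWith K w) (i : Fin n) : LocBdd (radD w i) :=
  .sum _ fun j => (LocBdd.coord j).mul (hw.pd_locBdd i j)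

theorem LipschitzWith.divF_locBdd (hw : LipschitzWith K w) : LocBdd (divF w) :=
  .sum _ fun i => hw.pd_locBdd i i

theorem LipschitzWith.homDefect_locBdd (hw : LipschitzWith K w) (i : Fin n) :
    LocBdd (homDefect w i) := (hw.coord_locBdd i).sub (hw.radD_locBdd i)

theorem LipschitzWith.flux_locBdd (hw : LipschitzWith K w) (i : Fin n) : LocBdd (flux w i) :=
  (((LocBdd.const 1).sub (chi_locBdd hw.continuous)).mul (.coord i)).sub (hw.homDefect_locBdd i)

theorem LipschitzWith.dirE_locBdd (hw : LipschitzWith K w) : LocBdd (dirE w) :=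
  .sum _ fun i => .sum _ fun j => (hw.pd_locBdd i j).sq

theorem HasLineDerivAt.mul_real {E : Type*} [NormedAddCommGroup E] [NormedSpace ℝ E]
    {f g : E → ℝ} {f' g' : ℝ} {x v : E} (hf : HasLineDerivAt ℝ f f' x v)
    (hg : HasLineDerivAt ℝ g g' x v) :
    HasLineDerivAt ℝ (fun y => f y * g y) (f' * g x + f x * g') x v := by
  have h := HasDerivAt.mul hf hg
  simp only [zero_smul, add_zero] at h
  exact h

theorem cutoff_mul_lipschitz (hd : LipschitzWith D d) (i : Fin n) :
    ∃ L, LipschitzWith L fun x => (cutoff x • d x) i := by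
  obtain ⟨L, hL⟩ := cutoff_contDiff.lipschitzWith_of_hasCompactSupport
    cutoff_isWeight.hasCompactSupport (n := 1) (by simp)
  exact hL.exists_mul_of_hasCompactSupport cutoff_isWeight.hasCompactSupport (hd.coord i)

theorem cutoff_mul_hasCompactSupport (d : En n → En n) (i : Fin n) :
    HasCompactSupport fun x => (cutoff x • d x) i :=
  cutoff_isWeight.hasCompactSupport.mul_right (f' := fun x => d x i)

theorem pd_cutoff_smul (hd : LipschitzWith D d) :
    ∀ᵐ x, ∀ i j, pd (fun y => cutoff y • d y) i j x =
      cutoff x * pd d i j x - cutoffDensity x * (x j * d x i) := by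
  filter_upwards [hd.ae_hasLineDerivAt_pd] with x hx i j
  have h := ((cutoff_hasLineDerivAt x (EuclideanSpace.single j 1)).mul_real (hx i j)).lineDeriv
  rw [pd]
  refine h.trans ?_
  rw [EuclideanSpace.inner_single_right]
  simp
  ring

/-- Vanishing of the integral of the divergence of `cutoff • d`. -/
theorem integral_cutoff_mul_divF (hd : LipschitzWith D d) :
    ∫ x, cutoff x * divF d x = ∫ x, cutoffDensity x * ∑ i, x i * d x i := by
  have i1 := cutoff_isWeight.integrable_mul hd.divF_locBdd
  have i2 := cutoffDensity_isWeight.integrable_mul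
    (LocBdd.sum Finset.univ fun i => (LocBdd.coord i).mul (hd.coord_locBdd i))
  have h0 : ∫ x, ∑ i, pd (fun y => cutoff y • d y) i i x = 0 := by
    rw [integral_finsetSum _ fun i _ => ?_]
    · refine Finset.sum_eq_zero fun i _ => ?_
      obtain ⟨L, hL⟩ := cutoff_mul_lipschitz hd i
      exact hL.integral_lineDeriv_eq_zero (cutoff_mul_hasCompactSupport d i) _
    · obtain ⟨L, hL⟩ := cutoff_mul_lipschitz hd i
      exact hL.integrable_lineDeriv_of_hasCompactSupport (cutoff_mul_hasCompactSupport d i) _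
  rw [← sub_eq_zero, ← integral_sub i1 i2, ← h0]
  refine integral_congr_ae ?_
  filter_upwards [pd_cutoff_smul hd] with x hx
  simp only [hx, divF, Finset.mul_sum, Finset.sum_sub_distrib]

/-- The Dirichlet pairing of two fields, the second one having symmetric derivative. -/
theorem integral_cutoff_dirichlet_pairing (hd : LipschitzWith D d) (hs : LipschitzWith C s)
    {R : ℝ} (hR : 1 < R) (hsymm : ∀ᵐ x, x ∈ ball (0 : En n) R → ∀ i j, pd s i j x = pd s j i x) :
    ∫ x, cutoff x * ∑ i, ∑ j, pd d i j x * pd s i j x =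
      (∫ x, cutoffDensity x * ∑ i, d x i * radD s i x) +
      ((∫ x, cutoff x * (divF d x * divF s x)) -
        ∫ x, cutoffDensity x * ((∑ i, x i * d x i) * divF s x)) := by
  have i1 := cutoff_isWeight.integrable_mul (LocBdd.sum Finset.univ fun i =>
    LocBdd.sum Finset.univ fun j => (hd.pd_locBdd i j).mul (hs.pd_locBdd i j))
  have i2 := cutoffDensity_isWeight.integrable_mul (LocBdd.sum Finset.univ fun i =>
    (hd.coord_locBdd i).mul (hs.radD_locBdd i))
  have i3 := cutoff_isWeight.integrable_mul (hd.divF_locBdd.mul hs.divF_locBdd)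
  have i4 := cutoffDensity_isWeight.integrable_mul ((LocBdd.sum Finset.univ fun i =>
    (LocBdd.coord i).mul (hd.coord_locBdd i)).mul hs.divF_locBdd)
  choose L hL using cutoff_mul_lipschitz hd
  have key := integral_pd_mul_pd_eq_div_mul_div (g := fun y => cutoff y • d y) hs hL
    (cutoff_mul_hasCompactSupport d) (by
      filter_upwards [hsymm] with x hx i j hxi
      refine hx ?_ i j
      have h1 : tsupport (fun x => (cutoff x • d x) i) ⊆ closedBall (0 : En n) 1 := by
        refine closure_minimal (fun y hy => ?_) isClosed_closedBall
        by_contra h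
        refine hy ?_
        have : cutoff y = 0 := cutoff_isWeight.zero y
          (not_le.1 fun h' => h (mem_closedBall_zero_iff.2 h')).le
        simp [this]
      exact closedBall_subset_ball hR (h1 hxi))
  have eL : ∫ x, ∑ i, ∑ j, pd (fun y => cutoff y • d y) i j x * pd s i j x =
      (∫ x, cutoff x * ∑ i, ∑ j, pd d i j x * pd s i j x) -
        ∫ x, cutoffDensity x * ∑ i, d x i * radD s i x := by
    rw [← integral_sub i1 i2]
    refine integral_congr_ae ?_
    filter_upwards [pd_cutoff_smul hd] with x hx
    simp only [hx, radD, Finset.mul_sum, ← Finset.sum_sub_distrib]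
    exact Finset.sum_congr rfl fun i _ => Finset.sum_congr rfl fun j _ => by ring
  have eR : ∫ x, (∑ i, pd (fun y => cutoff y • d y) i i x) * ∑ j, pd s j j x =
      (∫ x, cutoff x * (divF d x * divF s x)) -
        ∫ x, cutoffDensity x * ((∑ i, x i * d x i) * divF s x) := by
    rw [← integral_sub i3 i4]
    refine integral_congr_ae ?_
    filter_upwards [pd_cutoff_smul hd] with x hx
    simp only [hx, Finset.sum_sub_distrib, ← Finset.mul_sum]
    change (cutoff x * divF d x - _) * divF s x = _
    ring
  rw [eL, eR] at key
  linarith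

end Energy

section CritField

variable {n : ℕ}

/-- A Lipschitz field `w` with symmetric derivative and `div w = 1_{w ≠ 0}` in the ball of
radius `R`. -/
structure CritField (R : ℝ) (w : En n → En n) : Prop where
  lip : ∃ K, LipschitzWith K w
  zero : w 0 = 0
  symm : ∀ᵐ x, x ∈ ball (0 : En n) R → ∀ i j, pd w i j x = pd w j i x
  div : ∀ᵐ x, x ∈ ball (0 : En n) R → divF w x = chi w x
  null : ∀ᵐ x, x ∈ ball (0 : En n) R → w x = 0 → ∀ i j, pd w i j x = 0

/-- The boundary-adjusted energy. -/
def energy (w : En n → En n) : ℝ :=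
  (∫ x, cutoff x * (dirE w x + chi w x)) - ∫ x, cutoffDensity x * ‖w x‖ ^ 2

/-- The boundary term of the energy. -/
def bdry (w : En n → En n) : ℝ := ∫ x, cutoffDensity x * ‖w x‖ ^ 2

/-- The weighted measure of the zero set. -/
def zeroMass (w : En n → En n) : ℝ := ∫ x, cutoff x * (1 - chi w x)

theorem norm_sq_eq_sum (x : En n) : ‖x‖ ^ 2 = ∑ i, x i * x i := by
  rw [EuclideanSpace.norm_sq_eq]
  simp [pow_two]

theorem IsWeight.integral_congr {φ f g : En n → ℝ} (hφ : IsWeight φ)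
    (h : ∀ᵐ x, x ∈ ball (0 : En n) 1 → f x = g x) : ∫ x, φ x * f x = ∫ x, φ x * g x := by
  refine integral_congr_ae ?_
  filter_upwards [h] with x hx
  by_cases h1 : x ∈ ball (0 : En n) 1
  · rw [hx h1]
  · rw [hφ.zero x (not_lt.1 fun h' => h1 (mem_ball_zero_iff.2 h'))]; simp

theorem LipschitzWith.normSq_locBdd {w : En n → En n} {K : NNReal} (hw : LipschitzWith K w) :
    LocBdd fun x => ‖w x‖ ^ 2 :=
  .of_continuous (by have := hw.continuous; fun_prop)

variable {R : ℝ} {v w : En n → En n}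

/-- Equipartition of energy. -/
theorem CritField.integral_cutoff_dirE (hw : CritField R w) (hR : 1 < R) :
    ∫ x, cutoff x * dirE w x = ∫ x, cutoffDensity x * ∑ i, w x i * radD w i x := by
  obtain ⟨K, hK⟩ := hw.lip
  have hsub : ball (0 : En n) 1 ⊆ ball 0 R := ball_subset_ball hR.le
  have h1 := integral_cutoff_dirichlet_pairing hK hK hR hw.symm
  have h2 := integral_cutoff_mul_divF hK
  have e1 : ∫ x, cutoff x * dirE w x = ∫ x, cutoff x * ∑ i, ∑ j, pd w i j x * pd w i j x := by
    simp only [dirE, pow_two]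
  have e2 : ∫ x, cutoff x * (divF w x * divF w x) = ∫ x, cutoff x * divF w x := by
    refine cutoff_isWeight.integral_congr ?_
    filter_upwards [hw.div] with x hx hx1
    rw [hx (hsub hx1), chi_mul_self]
  have e3 : ∫ x, cutoffDensity x * ((∑ i, x i * w x i) * divF w x) =
      ∫ x, cutoffDensity x * ∑ i, x i * w x i := by
    refine cutoffDensity_isWeight.integral_congr ?_
    filter_upwards [hw.div] with x hx hx1
    rw [hx (hsub hx1)]
    by_cases h : w x = 0
    · simp [h]
    · rw [chi_of_ne h, mul_one]
  rw [e1, h1, e2, e3, h2]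
  ring

/-- Comparison of the energies of two critical fields. -/
theorem CritField.energy_sub_energy (hv : CritField R v) (hw : CritField R w) (hR : 1 < R) :
    energy v - energy w =
      ∫ x, cutoffDensity x * ∑ i, (v x i - w x i) * (flux v i x + flux w i x) := by
  obtain ⟨K, hK⟩ := hv.lip
  obtain ⟨L, hL⟩ := hw.lip
  have hsub : ball (0 : En n) 1 ⊆ ball 0 R := ball_subset_ball hR.le
  set d : En n → En n := fun x => v x - w x with hd
  set s : En n → En n := fun x => v x + w x with hs
  have hdL : LipschitzWith (K + L) d := hK.sub hL
  have hsL : LipschitzWith (K + L) s := hK.add hL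
  have pds : ∀ᵐ x, ∀ i j, pd d i j x = pd v i j x - pd w i j x ∧
      pd s i j x = pd v i j x + pd w i j x := by
    filter_upwards [hK.ae_hasLineDerivAt_pd, hL.ae_hasLineDerivAt_pd] with x h1 h2 i j
    exact ⟨HasLineDerivAt.lineDeriv (HasDerivAt.sub (h1 i j) (h2 i j)),
      HasLineDerivAt.lineDeriv (HasDerivAt.add (h1 i j) (h2 i j))⟩
  have hsymm : ∀ᵐ x, x ∈ ball (0 : En n) R → ∀ i j, pd s i j x = pd s j i x := by
    filter_upwards [pds, hv.symm, hw.symm] with x h h1 h2 hx i j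
    rw [(h i j).2, (h j i).2, h1 hx, h2 hx]
  have h1 := integral_cutoff_dirichlet_pairing hdL hsL hR hsymm
  have h2 := integral_cutoff_mul_divF hdL
  have divs : ∀ᵐ x, x ∈ ball (0 : En n) R →
      divF d x = chi v x - chi w x ∧ divF s x = chi v x + chi w x := by
    filter_upwards [pds, hv.div, hw.div] with x h h1 h2 hx
    rw [← h1 hx, ← h2 hx]
    simp only [divF, h, ← Finset.sum_sub_distrib, ← Finset.sum_add_distrib, and_self]
  have cv := chi_locBdd hK.continuous
  have cw := chi_locBdd hL.continuous
  have lxd : LocBdd fun x => ∑ i, x i * d x i :=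
    .sum _ fun i => (LocBdd.coord i).mul (hdL.coord_locBdd i)
  have e1 : ∫ x, cutoff x * ∑ i, ∑ j, pd d i j x * pd s i j x =
      (∫ x, cutoff x * dirE v x) - ∫ x, cutoff x * dirE w x := by
    rw [← integral_sub (cutoff_isWeight.integrable_mul hK.dirE_locBdd)
      (cutoff_isWeight.integrable_mul hL.dirE_locBdd)]
    refine integral_congr_ae ?_
    filter_upwards [pds] with x h
    simp only [dirE, ← mul_sub, ← Finset.sum_sub_distrib]
    congr 1
    refine Finset.sum_congr rfl fun i _ => Finset.sum_congr rfl fun j _ => ?_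
    rw [(h i j).1, (h i j).2]; ring
  have e2 : ∫ x, cutoff x * (divF d x * divF s x) =
      (∫ x, cutoff x * chi v x) - ∫ x, cutoff x * chi w x := by
    rw [← integral_sub (cutoff_isWeight.integrable_mul cv) (cutoff_isWeight.integrable_mul cw)]
    simp only [← mul_sub]
    refine cutoff_isWeight.integral_congr ?_
    filter_upwards [divs] with x h hx
    rw [(h (hsub hx)).1, (h (hsub hx)).2]
    linear_combination chi_mul_self v x - chi_mul_self w x
  have e3 : ∫ x, cutoff x * divF d x =
      (∫ x, cutoff x * chi v x) - ∫ x, cutoff x * chi w x := by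
    rw [← integral_sub (cutoff_isWeight.integrable_mul cv) (cutoff_isWeight.integrable_mul cw)]
    simp only [← mul_sub]
    refine cutoff_isWeight.integral_congr ?_
    filter_upwards [divs] with x h hx
    rw [(h (hsub hx)).1]
  have e4 : energy v - energy w = ((∫ x, cutoff x * dirE v x) - ∫ x, cutoff x * dirE w x) +
      ((∫ x, cutoff x * chi v x) - ∫ x, cutoff x * chi w x) -
      ∫ x, cutoffDensity x * (‖v x‖ ^ 2 - ‖w x‖ ^ 2) := by
    simp only [energy, mul_add, mul_sub]
    rw [integral_add (cutoff_isWeight.integrable_mul hK.dirE_locBdd)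
      (cutoff_isWeight.integrable_mul cv), integral_add
      (cutoff_isWeight.integrable_mul hL.dirE_locBdd) (cutoff_isWeight.integrable_mul cw),
      integral_sub (cutoffDensity_isWeight.integrable_mul hK.normSq_locBdd)
      (cutoffDensity_isWeight.integrable_mul hL.normSq_locBdd)]
    ring
  have lA := LocBdd.sum Finset.univ fun i => (hdL.coord_locBdd i).mul (hsL.radD_locBdd i)
  have lB := lxd.mul hsL.divF_locBdd
  have lC := hK.normSq_locBdd.sub hL.normSq_locBdd
  have e5 : ∫ x, cutoffDensity x * ∑ i, (v x i - w x i) * (flux v i x + flux w i x) =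
      (∫ x, cutoffDensity x * ∑ i, d x i * radD s i x) -
      (∫ x, cutoffDensity x * ((∑ i, x i * d x i) * divF s x)) +
      2 * (∫ x, cutoffDensity x * ∑ i, x i * d x i) -
      ∫ x, cutoffDensity x * (‖v x‖ ^ 2 - ‖w x‖ ^ 2) := by
    have iA := cutoffDensity_isWeight.integrable_mul lA
    have iB := cutoffDensity_isWeight.integrable_mul lB
    have iC := cutoffDensity_isWeight.integrable_mul lC
    have iD := cutoffDensity_isWeight.integrable_mul lxd
    have iAB := iA.sub iB
    have iABD := iAB.add (iD.const_mul 2)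
    simp only [Pi.sub_def, Pi.add_def] at iAB iABD
    rw [← integral_const_mul, ← integral_sub iA iB, ← integral_add iAB (iD.const_mul 2),
      ← integral_sub iABD iC]
    have : ∀ x, cutoffDensity x * ∑ i, d x i * radD s i x -
        cutoffDensity x * ((∑ i, x i * d x i) * divF s x) +
        2 * (cutoffDensity x * ∑ i, x i * d x i) - cutoffDensity x * (‖v x‖ ^ 2 - ‖w x‖ ^ 2) =
        cutoffDensity x * (∑ i, d x i * radD s i x - (∑ i, x i * d x i) * divF s x +
          2 * (∑ i, x i * d x i) - (‖v x‖ ^ 2 - ‖w x‖ ^ 2)) := fun x => by ring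
    simp_rw [this]
    refine cutoffDensity_isWeight.integral_congr ?_
    filter_upwards [divs, pds] with x h h' hx
    rw [(h (hsub hx)).2, norm_sq_eq_sum, norm_sq_eq_sum, Finset.sum_mul, Finset.mul_sum,
      ← Finset.sum_sub_distrib, ← Finset.sum_add_distrib, ← Finset.sum_sub_distrib,
      ← Finset.sum_sub_distrib]
    refine Finset.sum_congr rfl fun i _ => ?_
    have : radD s i x = radD v i x + radD w i x := by
      simp only [radD, (h' _ _).2, mul_add, Finset.sum_add_distrib]
    rw [this]
    simp only [hd, flux, homDefect, PiLp.sub_apply]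
    ring
  rw [e1, e2] at h1
  rw [e3] at h2
  rw [e4, e5, h1, ← h2]
  ring

end CritField

section Dilation

variable {n : ℕ} {w : En n → En n} {K : NNReal} {R : ℝ}

/-- The one-homogeneous rescaling of a vector field. -/
def dil (h : ℝ) (w : En n → En n) (x : En n) : En n := Real.exp h • w (Real.exp (-h) • x)

theorem dil_zero (w : En n → En n) : dil 0 w = w := by
  ext1 x; simp [dil]

theorem dil_add (a b : ℝ) (w : En n → En n) : dil (a + b) w = dil a (dil b w) := by
  ext1 x
  simp only [dil, smul_smul, ← Real.exp_add, neg_add]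
  rw [add_comm (-a) (-b)]

theorem LipschitzWith.dil (hw : LipschitzWith K w) (h : ℝ) : LipschitzWith K (dil h w) := by
  refine LipschitzWith.of_dist_le_mul fun x y => ?_
  have h1 := hw.dist_le_mul (Real.exp (-h) • x) (Real.exp (-h) • y)
  rw [_root_.dil, _root_.dil, dist_smul₀, Real.norm_of_nonneg (Real.exp_pos _).le]
  rw [dist_smul₀, Real.norm_of_nonneg (Real.exp_pos _).le] at h1
  calc _ ≤ Real.exp h * (K * (Real.exp (-h) * dist x y)) := by gcongr
    _ = (Real.exp h * Real.exp (-h)) * (K * dist x y) := by ring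
    _ = _ := by rw [← Real.exp_add]; simp

theorem pd_dil (h : ℝ) (w : En n → En n) (i j : Fin n) (x : En n) :
    pd (dil h w) i j x = pd w i j (Real.exp (-h) • x) := by
  have h1 : (fun t : ℝ => (dil h w (x + t • EuclideanSpace.single j (1 : ℝ))) i) =
      fun t => Real.exp h * (fun s : ℝ =>
        w (Real.exp (-h) • x + s • EuclideanSpace.single j (1 : ℝ)) i) (Real.exp (-h) * t) := by
    ext t
    simp [dil, smul_add, smul_smul]
  rw [pd, lineDeriv, h1, deriv_const_mul_field, deriv_comp_mul_left (Real.exp (-h)) (fun s : ℝ =>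
      w (Real.exp (-h) • x + s • EuclideanSpace.single j (1 : ℝ)) i), mul_zero, smul_eq_mul,
    ← mul_assoc, ← Real.exp_add, add_neg_cancel, Real.exp_zero, one_mul]
  rfl

theorem chi_dil (h : ℝ) (w : En n → En n) (x : En n) :
    chi (dil h w) x = chi w (Real.exp (-h) • x) := by
  by_cases hx : w (Real.exp (-h) • x) = 0
  · rw [chi_of_eq hx, chi_of_eq (by simp [dil, hx])]
  · rw [chi_of_ne hx, chi_of_ne (by simp [dil, hx])]

theorem radD_dil (h : ℝ) (w : En n → En n) (i : Fin n) (x : En n) :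
    radD (dil h w) i x = Real.exp h * radD w i (Real.exp (-h) • x) := by
  have : Real.exp h * Real.exp (-h) = 1 := by rw [← Real.exp_add]; simp
  simp only [radD, pd_dil, Finset.mul_sum, PiLp.smul_apply, smul_eq_mul]
  refine Finset.sum_congr rfl fun j _ => ?_
  linear_combination -(x j * pd w i j (Real.exp (-h) • x)) * this

theorem flux_dil (h : ℝ) (w : En n → En n) (i : Fin n) (x : En n) :
    flux (dil h w) i x = Real.exp h * flux w i (Real.exp (-h) • x) := by
  have : Real.exp h * Real.exp (-h) = 1 := by rw [← Real.exp_add]; simp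
  simp only [flux, homDefect, radD_dil, chi_dil]
  simp only [dil, PiLp.smul_apply, smul_eq_mul]
  linear_combination -((1 - chi w (Real.exp (-h) • x)) * x i) * this

theorem CritField.mono {R' : ℝ} (hw : CritField R w) (h : R' ≤ R) : CritField R' w where
  lip := hw.lip
  zero := hw.zero
  symm := hw.symm.mono fun _ hx h' => hx (ball_subset_ball h h')
  div := hw.div.mono fun _ hx h' => hx (ball_subset_ball h h')
  null := hw.null.mono fun _ hx h' => hx (ball_subset_ball h h')

theorem CritField.rescale (hw : CritField R w) (h : ℝ) : CritField (Real.exp h * R) (dil h w) := by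
  have hq := Measure.quasiMeasurePreserving_smul (volume : Measure (En n)) (Real.exp_pos (-h)).ne'
  have hmem : ∀ x ∈ ball (0 : En n) (Real.exp h * R), Real.exp (-h) • x ∈ ball (0 : En n) R := by
    intro x hx
    rw [mem_ball_zero_iff] at hx ⊢
    rw [norm_smul, Real.norm_of_nonneg (Real.exp_pos _).le]
    calc Real.exp (-h) * ‖x‖ < Real.exp (-h) * (Real.exp h * R) := by gcongr
      _ = R := by rw [← mul_assoc, ← Real.exp_add]; simp
  refine ⟨?_, by simp [dil, hw.zero], ?_, ?_, ?_⟩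
  · obtain ⟨K, hK⟩ := hw.lip
    exact ⟨K, hK.dil h⟩
  · filter_upwards [hq.ae hw.symm] with x hx hx1 i j
    rw [pd_dil, pd_dil]; exact hx (hmem x hx1) i j
  · filter_upwards [hq.ae hw.div] with x hx hx1
    rw [divF, chi_dil, ← hx (hmem x hx1)]
    simp only [pd_dil, divF]
  · filter_upwards [hq.ae hw.null] with x hx hx1 hx2 i j
    rw [pd_dil]
    exact hx (hmem x hx1) (by simpa [dil] using hx2) i j

/-- The difference quotient of the dilation. -/
def dilSlope (w : En n → En n) (h : ℝ) (i : Fin n) (x : En n) : ℝ :=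
  h⁻¹ * (dil h w x i - w x i)

theorem LipschitzWith.norm_le (hw : LipschitzWith K w) (h0 : w 0 = 0) (x : En n) :
    ‖w x‖ ≤ K * ‖x‖ := by
  simpa [h0] using hw.norm_sub_le x 0

theorem dilSlope_bound (hw : LipschitzWith K w) (h0 : w 0 = 0) {h : ℝ} (hh : |h| ≤ 1) (i : Fin n)
    (x : En n) : |dilSlope w h i x| ≤ 8 * K * ‖x‖ := by
  have h1 : |Real.exp h - 1| ≤ 2 * |h| := Real.abs_exp_sub_one_le hh
  have h2 : |Real.exp (-h) - 1| ≤ 2 * |h| := by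
    simpa using Real.abs_exp_sub_one_le (x := -h) (by simpa using hh)
  have h3 : Real.exp (-h) ≤ 3 := by
    have := (abs_le.1 h2).2
    linarith
  have e : dil h w x - w x = (Real.exp h - 1) • w (Real.exp (-h) • x) +
      (w (Real.exp (-h) • x) - w x) := by
    rw [dil, sub_smul, one_smul]; abel
  have b1 : ‖w (Real.exp (-h) • x)‖ ≤ K * (3 * ‖x‖) := by
    refine (hw.norm_le h0 _).trans ?_
    rw [norm_smul, Real.norm_of_nonneg (Real.exp_pos _).le]
    gcongr
  have b2 : ‖w (Real.exp (-h) • x) - w x‖ ≤ K * ((2 * |h|) * ‖x‖) := by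
    refine (hw.norm_sub_le _ _).trans ?_
    have : Real.exp (-h) • x - x = (Real.exp (-h) - 1) • x := by rw [sub_smul, one_smul]
    rw [this, norm_smul]
    gcongr
    exact h2
  have b3 : ‖dil h w x - w x‖ ≤ |h| * (8 * K * ‖x‖) := by
    rw [e]
    refine (norm_add_le _ _).trans ?_
    rw [norm_smul]
    calc _ ≤ (2 * |h|) * (K * (3 * ‖x‖)) + K * ((2 * |h|) * ‖x‖) := by gcongr; exact h1
      _ = _ := by ring
  have b4 : |dil h w x i - w x i| ≤ |h| * (8 * K * ‖x‖) :=
    (PiLp.norm_apply_le (dil h w x - w x) i).trans b3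
  rw [dilSlope, abs_mul, abs_inv]
  rcases eq_or_ne h 0 with rfl | hne
  · simp; positivity
  · rw [inv_mul_le_iff₀ (abs_pos.2 hne)]; exact b4

theorem dilSlope_tendsto (hw : LipschitzWith K w) :
    ∀ᵐ x, ∀ i, Tendsto (fun h => dilSlope w h i x) (𝓝[≠] 0) (𝓝 (homDefect w i x)) := by
  filter_upwards [hw.ae_differentiableAt (μ := volume)] with x hx i
  have hd : HasFDerivAt (fun y => w y i) (fderiv ℝ (fun y => w y i) x) x := by
    have : DifferentiableAt ℝ (fun y => w y i) x :=
      ((EuclideanSpace.proj i : En n →L[ℝ] ℝ).differentiableAt).comp x hx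
    exact this.hasFDerivAt
  have hrad : fderiv ℝ (fun y => w y i) x x = radD w i x := by
    have hxs : x = ∑ j, x j • EuclideanSpace.single j (1 : ℝ) := by
      ext k
      simp [Finset.sum_apply, Pi.single_apply]
    rw [radD]
    have : ∀ j, pd w i j x = fderiv ℝ (fun y => w y i) x (EuclideanSpace.single j 1) :=
      fun j => (hd.hasLineDerivAt _).lineDeriv
    simp only [this]
    conv_lhs => arg 2; rw [hxs]
    simp
  have hc : HasDerivAt (fun h : ℝ => Real.exp (-h) • x) (-x) 0 := by
    have h1 : HasDerivAt (fun h : ℝ => Real.exp (-h)) (-1) 0 := by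
      simpa using (hasDerivAt_neg (0 : ℝ)).exp
    simpa using h1.smul_const x
  have h1 : HasDerivAt (fun h : ℝ => w (Real.exp (-h) • x) i) (-(radD w i x)) 0 := by
    have := HasFDerivAt.comp_hasDerivAt_of_eq (x := (0 : ℝ)) (f := fun h : ℝ => Real.exp (-h) • x)
      (l := fun y => w y i) hd hc (by simp)
    rw [map_neg, hrad] at this
    exact this
  have h2 : HasDerivAt (fun h : ℝ => dil h w x i) (homDefect w i x) 0 := by
    have := (Real.hasDerivAt_exp 0).mul h1
    simp only [Real.exp_zero, neg_zero, one_smul, one_mul] at this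
    exact this
  have h3 := hasDerivAt_iff_tendsto_slope_zero.1 h2
  simpa [dilSlope, dil_zero] using h3

theorem tendsto_integral_of_bounded {ι : Type*} {l : Filter ι} [l.IsCountablyGenerated]
    {F : ι → En n → ℝ} {f : En n → ℝ} {r C : ℝ}
    (hm : ∀ᶠ h in l, AEStronglyMeasurable (F h) volume)
    (hb : ∀ᶠ h in l, ∀ x, ‖x‖ ≤ r → |F h x| ≤ C)
    (h0 : ∀ᶠ h in l, ∀ x, r < ‖x‖ → F h x = 0)
    (hlim : ∀ᵐ x, Tendsto (fun h => F h x) l (𝓝 (f x))) :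
    Tendsto (fun h => ∫ x, F h x) l (𝓝 (∫ x, f x)) := by
  refine tendsto_integral_filter_of_dominated_convergence
    ((closedBall (0 : En n) r).indicator fun _ => C) hm ?_ ?_ hlim
  · filter_upwards [hb, h0] with h hb h0
    refine Eventually.of_forall fun x => ?_
    by_cases hx : ‖x‖ ≤ r
    · rw [Set.indicator_of_mem (mem_closedBall_zero_iff.2 hx)]; exact hb x hx
    · rw [h0 x (not_le.1 hx), norm_zero, Set.indicator_of_notMem]
      rwa [mem_closedBall_zero_iff]
  · exact (integrable_indicator_iff measurableSet_closedBall).2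
      (integrableOn_const measure_closedBall_lt_top.ne)

theorem dilSlope_pairing_tendsto (hw : LipschitzWith K w) (hw0 : w 0 = 0)
    {G : ℝ → Fin n → En n → ℝ} {g : Fin n → En n → ℝ} {C : ℝ}
    (hm : ∀ h i, AEStronglyMeasurable (G h i) volume)
    (hb : ∀ h, |h| ≤ 1 → ∀ i x, ‖x‖ ≤ 3 → |G h i x| ≤ C)
    (h0 : ∀ h, |h| ≤ 1 → ∀ i x, 3 < ‖x‖ → G h i x = 0)
    (hlim : ∀ i x, Tendsto (fun h => G h i x) (𝓝[≠] 0) (𝓝 (g i x))) :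
    Tendsto (fun h => ∫ x, ∑ i, dilSlope w h i x * G h i x) (𝓝[≠] 0)
      (𝓝 (∫ x, ∑ i, homDefect w i x * g i x)) := by
  have hev : ∀ᶠ h : ℝ in 𝓝[≠] 0, |h| ≤ 1 := by
    have : ∀ᶠ h : ℝ in 𝓝 0, |h| ≤ 1 := by
      filter_upwards [closedBall_mem_nhds (0 : ℝ) one_pos] with h hh
      simpa using hh
    exact this.filter_mono nhdsWithin_le_nhds
  refine tendsto_integral_of_bounded (r := 3) (C := ∑ i : Fin n, (8 * K * 3) * C) ?_ ?_ ?_ ?_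
  · refine Eventually.of_forall fun h => ?_
    refine Finset.aestronglyMeasurable_fun_sum _ fun i _ => AEStronglyMeasurable.mul ?_ (hm h i)
    have h1 : Continuous (dil h w) := (hw.dil h).continuous
    have h2 := hw.continuous
    have : Continuous (dilSlope w h i) := by
      unfold dilSlope
      fun_prop
    exact this.aestronglyMeasurable
  · filter_upwards [hev] with h hh x hx
    refine (Finset.abs_sum_le_sum_abs _ _).trans (Finset.sum_le_sum fun i _ => ?_)
    rw [abs_mul]
    have := dilSlope_bound hw hw0 hh i x
    refine mul_le_mul (this.trans ?_) (hb h hh i x hx) (abs_nonneg _) (by positivity)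
    gcongr
  · filter_upwards [hev] with h hh x hx
    exact Finset.sum_eq_zero fun i _ => by rw [h0 h hh i x hx, mul_zero]
  · filter_upwards [dilSlope_tendsto hw] with x hx
    exact tendsto_finsetSum _ fun i _ => (hx i).mul (hlim i x)

end Dilation

section Monotonicity

variable {n : ℕ} {w : En n → En n} {K : NNReal} {R : ℝ}

theorem IsWeight.exists_bound {φ : En n → ℝ} (hφ : IsWeight φ) : ∃ C, ∀ x, |φ x| ≤ C :=
  hφ.hasCompactSupport.exists_bound_of_continuous hφ.cont

theorem bdry_hasDerivAt_dil (hw : LipschitzWith K w) (hw0 : w 0 = 0) :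
    HasDerivAt (fun h => bdry (dil h w))
      (2 * ∫ x, cutoffDensity x * ∑ i, w x i * homDefect w i x) 0 := by
  rw [hasDerivAt_iff_tendsto_slope_zero]
  obtain ⟨C, hC⟩ := (cutoffDensity_isWeight (n := n)).exists_bound
  have hκ := (cutoffDensity_isWeight (n := n)).cont
  have hT := dilSlope_pairing_tendsto hw hw0
    (G := fun h i x => cutoffDensity x * (dil h w x i + w x i))
    (g := fun i x => cutoffDensity x * (w x i + w x i)) (C := C * (K * 3 + K * 3))
    (fun h i => by
      have h1 := ((hw.dil h).coord i).continuous
      have h2 := (hw.coord i).continuous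
      exact (hκ.mul (h1.add h2)).aestronglyMeasurable)
    (fun h _ i x hx => by
      have h0 : dil h w 0 = 0 := by simp [dil, hw0]
      have h1 : |dil h w x i| ≤ K * 3 := (PiLp.norm_apply_le (dil h w x) i).trans
        (((hw.dil h).norm_le h0 x).trans (by gcongr))
      have h2 : |w x i| ≤ K * 3 := (PiLp.norm_apply_le (w x) i).trans
        ((hw.norm_le hw0 x).trans (by gcongr))
      rw [abs_mul]
      exact mul_le_mul (hC x) ((abs_add_le _ _).trans (add_le_add h1 h2)) (abs_nonneg _)
        ((abs_nonneg _).trans (hC x)))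
    (fun h _ i x hx => by
      rw [cutoffDensity_isWeight.zero x (by linarith), zero_mul])
    (fun i x => by
      have h1 : Continuous fun h => dil h w x i :=
        Real.continuous_exp.mul ((hw.coord i).continuous.comp
          ((Real.continuous_exp.comp continuous_neg).smul continuous_const))
      have h2 : Continuous fun h => cutoffDensity x * (dil h w x i + w x i) :=
        continuous_const.mul (h1.add continuous_const)
      have h3 := h2.tendsto 0
      simp only [dil_zero] at h3
      exact h3.mono_left nhdsWithin_le_nhds)
  have e : 2 * ∫ x, cutoffDensity x * ∑ i, w x i * homDefect w i x =
      ∫ x, ∑ i, homDefect w i x * (cutoffDensity x * (w x i + w x i)) := by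
    rw [← integral_const_mul]
    congr 1; ext x
    simp only [Finset.mul_sum]
    exact Finset.sum_congr rfl fun i _ => by ring
  rw [e]
  refine hT.congr fun h => ?_
  simp only [zero_add, dil_zero, bdry]
  rw [← integral_sub (cutoffDensity_isWeight.integrable_mul (hw.dil h).normSq_locBdd)
    (cutoffDensity_isWeight.integrable_mul hw.normSq_locBdd), ← integral_smul]
  congr 1; ext x
  rw [norm_sq_eq_sum, norm_sq_eq_sum, ← mul_sub, ← Finset.sum_sub_distrib, smul_eq_mul,
    Finset.mul_sum, Finset.mul_sum]
  refine Finset.sum_congr rfl fun i _ => ?_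
  rw [dilSlope]; ring

theorem CritField.bdry_hasDerivAt_dil (hw : CritField R w) (hR : 1 < R) :
    HasDerivAt (fun h => bdry (dil h w))
      (-(2 * (energy w - (∫ x : En n, cutoff x) + zeroMass w))) 0 := by
  obtain ⟨K, hK⟩ := hw.lip
  have h := _root_.bdry_hasDerivAt_dil hK hw.zero
  convert h using 1
  have cw := cutoff_isWeight.integrable_mul (chi_locBdd hK.continuous)
  have c1 : Integrable fun x : En n => cutoff x := by
    simpa using cutoff_isWeight.integrable_mul (LocBdd.const (n := n) 1)
  have e1 : zeroMass w = (∫ x : En n, cutoff x) - ∫ x, cutoff x * chi w x := by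
    rw [← integral_sub c1 cw, zeroMass]
    congr 1; ext x; ring
  have e2 : energy w = (∫ x, cutoff x * dirE w x) + (∫ x, cutoff x * chi w x) - bdry w := by
    rw [energy, bdry, ← integral_add (cutoff_isWeight.integrable_mul hK.dirE_locBdd) cw]
    simp only [mul_add]
  have e3 : ∫ x, cutoffDensity x * ∑ i, w x i * homDefect w i x =
      bdry w - ∫ x, cutoffDensity x * ∑ i, w x i * radD w i x := by
    rw [bdry, ← integral_sub (cutoffDensity_isWeight.integrable_mul hK.normSq_locBdd)
      (cutoffDensity_isWeight.integrable_mul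
        (LocBdd.sum _ fun i => (hK.coord_locBdd i).mul (hK.radD_locBdd i)))]
    congr 1; ext x
    rw [norm_sq_eq_sum, ← mul_sub, ← Finset.sum_sub_distrib]
    simp only [homDefect, mul_sub]
  rw [e3, e2, e1, hw.integral_cutoff_dirE hR]
  ring

/-- Change of variables in the energy comparison between a field and its dilation. -/
theorem integral_dilSlope_flux_dil (w : En n → En n) (h : ℝ) :
    ∫ x, cutoffDensity x * ∑ i, dilSlope w h i x * flux (dil h w) i x =
      ∫ x, ∑ i, dilSlope w (-h) i x *
        (Real.exp (n * h) * Real.exp h ^ 2 * cutoffDensity (Real.exp h • x) * flux w i x) := by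
  have hp := Measure.integral_comp_smul (volume : Measure (En n))
    (fun x => cutoffDensity x * ∑ i, dilSlope w h i x * flux (dil h w) i x) (Real.exp h)
  rw [finrank_euclideanSpace_fin, abs_of_pos (by positivity), smul_eq_mul, ← Real.exp_nat_mul,
    ← Real.exp_neg] at hp
  have hinv : Real.exp (n * h) * Real.exp (-(n * h)) = 1 := by rw [← Real.exp_add]; simp
  have hp2 : ∫ x, cutoffDensity x * ∑ i, dilSlope w h i x * flux (dil h w) i x =
      Real.exp (n * h) * ∫ x, cutoffDensity (Real.exp h • x) *
        ∑ i, dilSlope w h i (Real.exp h • x) * flux (dil h w) i (Real.exp h • x) := by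
    rw [hp, ← mul_assoc, hinv, one_mul]
  rw [hp2, ← integral_const_mul]
  congr 1; ext x
  rw [Finset.mul_sum, Finset.mul_sum]
  refine Finset.sum_congr rfl fun i _ => ?_
  have hx : Real.exp (-h) • Real.exp h • x = x := by
    rw [smul_smul, ← Real.exp_add]; simp
  have hee : Real.exp h * Real.exp (-h) = 1 := by rw [← Real.exp_add]; simp
  have e1 : dilSlope w h i (Real.exp h • x) = Real.exp h * dilSlope w (-h) i x := by
    simp only [dilSlope, dil, hx, neg_neg, PiLp.smul_apply, smul_eq_mul, inv_neg]
    linear_combination (h⁻¹ * w (Real.exp h • x) i) * hee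
  rw [e1, flux_dil, hx]
  ring

theorem CritField.energy_hasDerivAt_dil (hw : CritField R w) (hR : 1 < R) :
    HasDerivAt (fun h => energy (dil h w))
      (-(2 * ∫ x, cutoffDensity x * ∑ i, homDefect w i x ^ 2)) 0 := by
  rw [hasDerivAt_iff_tendsto_slope_zero]
  obtain ⟨K, hK⟩ := hw.lip
  obtain ⟨C, hC⟩ := (cutoffDensity_isWeight (n := n)).exists_bound
  have hC0 : 0 ≤ C := (abs_nonneg _).trans (hC 0)
  have hκ := (cutoffDensity_isWeight (n := n)).cont
  have hF : ∀ i, ∃ D, ∀ x, ‖x‖ ≤ 3 → |flux w i x| ≤ D := fun i => (hK.flux_locBdd i).bdd 3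
  choose D hD using hF
  have hD' : ∀ i x, ‖x‖ ≤ 3 → |flux w i x| ≤ ∑ i, |D i| := fun i x hx =>
    ((hD i x hx).trans (le_abs_self _)).trans
      (Finset.single_le_sum (f := fun i => |D i|) (fun i _ => abs_nonneg _) (Finset.mem_univ i))
  have T1 := dilSlope_pairing_tendsto hK hw.zero
    (G := fun _ i x => cutoffDensity x * flux w i x) (g := fun i x => cutoffDensity x * flux w i x)
    (C := C * ∑ i, |D i|)
    (fun _ i => hκ.aestronglyMeasurable.mul (hK.flux_locBdd i).meas)
    (fun _ _ i x hx => by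
      rw [abs_mul]; exact mul_le_mul (hC x) (hD' i x hx) (abs_nonneg _) hC0)
    (fun _ _ i x hx => by rw [cutoffDensity_isWeight.zero x (by linarith), zero_mul])
    (fun i x => tendsto_const_nhds)
  have T2 := dilSlope_pairing_tendsto hK hw.zero
    (G := fun h i x => Real.exp (n * (-h)) * Real.exp (-h) ^ 2 *
      cutoffDensity (Real.exp (-h) • x) * flux w i x)
    (g := fun i x => cutoffDensity x * flux w i x)
    (C := Real.exp n * Real.exp 1 ^ 2 * C * ∑ i, |D i|)
    (fun h i => by
      have : Continuous fun x : En n => Real.exp (n * (-h)) * Real.exp (-h) ^ 2 *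
        cutoffDensity (Real.exp (-h) • x) := by fun_prop
      exact this.aestronglyMeasurable.mul (hK.flux_locBdd i).meas)
    (fun h hh i x hx => by
      have hle : -h ≤ 1 := by linarith [(abs_le.1 hh).1]
      have h1 : Real.exp (n * (-h)) ≤ Real.exp n := Real.exp_le_exp.2
        (mul_le_of_le_one_right (Nat.cast_nonneg n) hle)
      have h2 : Real.exp (-h) ≤ Real.exp 1 := Real.exp_le_exp.2 hle
      rw [abs_mul, abs_mul, abs_of_pos (by positivity : 0 <
        Real.exp (n * (-h)) * Real.exp (-h) ^ 2)]
      have h3 := hC (Real.exp (-h) • x)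
      have h4 := hD' i x hx
      gcongr)
    (fun h hh i x hx => by
      have hle : -1 ≤ -h := by linarith [(abs_le.1 hh).2]
      have h2 : Real.exp (-1) ≤ Real.exp (-h) := Real.exp_le_exp.2 hle
      have h3 : (1 : ℝ) ≤ ‖Real.exp (-h) • x‖ := by
        rw [norm_smul, Real.norm_of_nonneg (Real.exp_pos _).le]
        have h5 : Real.exp 1 * Real.exp (-1) = 1 := by rw [← Real.exp_add]; simp
        have h6 : Real.exp 1 < 3 := Real.exp_one_lt_three
        nlinarith [Real.exp_pos (-1)]
      rw [cutoffDensity_isWeight.zero _ h3]; ring)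
    (fun i x => by
      have h2 : Continuous fun h : ℝ => Real.exp (n * (-h)) * Real.exp (-h) ^ 2 *
        cutoffDensity (Real.exp (-h) • x) * flux w i x := by fun_prop
      have h3 := h2.tendsto 0
      simp only [neg_zero, mul_zero, Real.exp_zero, one_smul, one_pow, one_mul] at h3
      exact h3.mono_left nhdsWithin_le_nhds)
  have hneg : Tendsto (fun h : ℝ => -h) (𝓝[≠] 0) (𝓝[≠] 0) := by
    refine tendsto_nhdsWithin_iff.2 ⟨?_, ?_⟩
    · have : Tendsto (fun h : ℝ => -h) (𝓝 0) (𝓝 0) := by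
        simpa using (continuous_neg (G := ℝ)).tendsto 0
      exact this.mono_left nhdsWithin_le_nhds
    · filter_upwards [self_mem_nhdsWithin] with h hh
      simpa using hh
  have T := T1.add (T2.comp hneg)
  have e : -(2 * ∫ x, cutoffDensity x * ∑ i, homDefect w i x ^ 2) =
      (∫ x, ∑ i, homDefect w i x * (cutoffDensity x * flux w i x)) +
      ∫ x, ∑ i, homDefect w i x * (cutoffDensity x * flux w i x) := by
    rw [← two_mul, ← mul_neg, ← integral_neg]
    congr 1
    have : ∀ x, ∑ i, homDefect w i x * (cutoffDensity x * flux w i x) =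
        cutoffDensity x * ∑ i, homDefect w i x * flux w i x := fun x => by
      rw [Finset.mul_sum]; exact Finset.sum_congr rfl fun i _ => by ring
    simp_rw [this, ← mul_neg]
    refine cutoffDensity_isWeight.integral_congr ?_
    filter_upwards [hw.null] with x hx hx1
    rw [← Finset.sum_neg_distrib]
    refine Finset.sum_congr rfl fun i _ => ?_
    by_cases h : w x = 0
    · have : homDefect w i x = 0 := by
        simp [homDefect, radD, h, hx (ball_subset_ball hR.le hx1) h]
      simp [this]
    · rw [flux, chi_of_ne h]; ring
  rw [e]
  refine T.congr' ?_
  have hev : ∀ᶠ h : ℝ in 𝓝[≠] 0, (1 + R) / 2 ≤ Real.exp h * R := by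
    have h1 : Tendsto (fun h : ℝ => Real.exp h * R) (𝓝 0) (𝓝 R) := by
      have : Continuous fun h : ℝ => Real.exp h * R := by fun_prop
      simpa using this.tendsto 0
    exact (h1.eventually (eventually_ge_nhds (by linarith))).filter_mono nhdsWithin_le_nhds
  filter_upwards [hev] with h hh
  have hv : CritField ((1 + R) / 2) (dil h w) := (hw.rescale h).mono hh
  have hw' : CritField ((1 + R) / 2) w := hw.mono (by linarith)
  have key := hv.energy_sub_energy hw' (by linarith)
  have hlip := hK.dil h
  simp only [zero_add, dil_zero, smul_eq_mul, Function.comp, neg_neg]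
  rw [key, ← integral_dilSlope_flux_dil w h, ← integral_const_mul]
  have lS : ∀ i, LocBdd fun x => dilSlope w h i x := fun i =>
    (LocBdd.const h⁻¹).mul ((hlip.coord_locBdd i).sub (hK.coord_locBdd i))
  have i1 := cutoffDensity_isWeight.integrable_mul
    (LocBdd.sum Finset.univ fun i => (lS i).mul (hK.flux_locBdd i))
  have i2 := cutoffDensity_isWeight.integrable_mul
    (LocBdd.sum Finset.univ fun i => (lS i).mul (hlip.flux_locBdd i))
  have e1 : ∫ x, ∑ i, dilSlope w h i x * (cutoffDensity x * flux w i x) =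
      ∫ x, cutoffDensity x * ∑ i, dilSlope w h i x * flux w i x := by
    congr 1; ext x
    rw [Finset.mul_sum]; exact Finset.sum_congr rfl fun i _ => by ring
  rw [e1, ← integral_add i1 i2]
  congr 1; ext x
  rw [← mul_add, ← Finset.sum_add_distrib, mul_left_comm]
  congr 1
  rw [Finset.mul_sum]
  exact Finset.sum_congr rfl fun i _ => by rw [dilSlope]; ring

theorem hasDerivAt_dil_shift {f : (En n → En n) → ℝ} {t f' : ℝ}
    (h : HasDerivAt (fun h => f (dil h (dil t w))) f' 0) :
    HasDerivAt (fun s => f (dil s w)) f' t := by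
  have h1 : (fun s => f (dil s w)) = fun s => (fun h => f (dil h (dil t w))) (s - t) := by
    ext s; simp only [← dil_add, sub_add_cancel]
  rw [h1]
  exact HasDerivAt.comp_sub_const t t (by simpa using h)

theorem CritField.one_lt_exp {t : ℝ} (ht : 0 < t) : 1 < Real.exp t * 1 := by
  simpa using ht

theorem CritField.energy_dil_antitoneOn (hw : CritField 1 w) :
    AntitoneOn (fun t => energy (dil t w)) (Set.Ioi 0) := by
  have hd : ∀ t ∈ Set.Ioi (0 : ℝ), HasDerivAt (fun t => energy (dil t w))
      (-(2 * ∫ x, cutoffDensity x * ∑ i, homDefect (dil t w) i x ^ 2)) t := fun t ht =>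
    hasDerivAt_dil_shift ((hw.rescale t).energy_hasDerivAt_dil (CritField.one_lt_exp ht))
  refine antitoneOn_of_deriv_nonpos (convex_Ioi 0)
    (fun t ht => (hd t ht).continuousAt.continuousWithinAt)
    (fun t ht => (hd t (interior_subset ht)).differentiableAt.differentiableWithinAt)
    (fun t ht => ?_)
  rw [(hd t (interior_subset ht)).deriv]
  have : 0 ≤ ∫ x, cutoffDensity x * ∑ i, homDefect (dil t w) i x ^ 2 :=
    integral_nonneg fun x => mul_nonneg (cutoffDensity_nonneg x)
      (Finset.sum_nonneg fun i _ => sq_nonneg _)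
  linarith

theorem CritField.bdry_hasDerivAt (hw : CritField 1 w) {t : ℝ} (ht : 0 < t) :
    HasDerivAt (fun t => bdry (dil t w))
      (-(2 * (energy (dil t w) - (∫ x : En n, cutoff x) + zeroMass (dil t w)))) t :=
  hasDerivAt_dil_shift ((hw.rescale t).bdry_hasDerivAt_dil (CritField.one_lt_exp ht))

theorem zeroMass_nonneg (w : En n → En n) : 0 ≤ zeroMass w :=
  integral_nonneg fun x => mul_nonneg (cutoff_nonneg x) (sub_nonneg.2 (chi_le_one w x))

theorem bdry_nonneg (w : En n → En n) : 0 ≤ bdry w :=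
  integral_nonneg fun x => mul_nonneg (cutoffDensity_nonneg x) (sq_nonneg _)

/-- If the energy stays above the mass of the cutoff, then the weighted mass of the zero set is
integrable in logarithmic scale. -/
theorem CritField.integrableOn_zeroMass (hw : CritField 1 w)
    (hE : ∀ t, 0 < t → (∫ x : En n, cutoff x) ≤ energy (dil t w)) {T : ℝ} (hT : 0 < T) :
    IntegrableOn (fun t => zeroMass (dil t w)) (Set.Ioi T) := by
  set J := fun t => bdry (dil t w)
  set J' := fun t => -(2 * (energy (dil t w) - (∫ x : En n, cutoff x) +
    zeroMass (dil t w)))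
  have hJ : ∀ t, 0 < t → HasDerivAt J (J' t) t := fun t ht => hw.bdry_hasDerivAt ht
  have hneg : ∀ t, 0 < t → J' t ≤ 0 := fun t ht => by
    have := hE t ht
    have := zeroMass_nonneg (dil t w)
    simp only [J']; linarith
  have hanti : AntitoneOn J (Set.Ioi 0) := by
    refine antitoneOn_of_deriv_nonpos (convex_Ioi 0)
      (fun t ht => (hJ t ht).continuousAt.continuousWithinAt)
      (fun t ht => (hJ t (interior_subset ht)).differentiableAt.differentiableWithinAt)
      (fun t ht => ?_)
    rw [(hJ t (interior_subset ht)).deriv]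
    exact hneg t (interior_subset ht)
  obtain ⟨l, hl⟩ : ∃ l, Tendsto J atTop (𝓝 l) := by
    have ha : Antitone fun t => J (max t T) := fun a b hab =>
      hanti (lt_max_of_lt_right hT) (lt_max_of_lt_right hT) (max_le_max_right T hab)
    have hb : BddBelow (Set.range fun t => J (max t T)) :=
      ⟨0, by rintro _ ⟨t, rfl⟩; exact bdry_nonneg _⟩
    refine ⟨_, (tendsto_atTop_ciInf ha hb).congr' ?_⟩
    filter_upwards [eventually_ge_atTop T] with t ht
    rw [max_eq_left ht]
  have h_int : IntegrableOn J' (Set.Ioi T) :=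
    integrableOn_Ioi_deriv_of_nonpos (hJ T hT).continuousAt.continuousWithinAt
      (fun t ht => hJ t (hT.trans ht)) (fun t ht => hneg t (hT.trans ht)) hl
  have hmeasE : AEStronglyMeasurable (fun t => energy (dil t w))
      (volume.restrict (Set.Ioi T)) :=
    (aemeasurable_restrict_of_antitoneOn measurableSet_Ioi
      (hw.energy_dil_antitoneOn.mono (Set.Ioi_subset_Ioi hT.le))).aestronglyMeasurable
  have hmeas : AEStronglyMeasurable (fun t => zeroMass (dil t w))
      (volume.restrict (Set.Ioi T)) := by
    have : (fun t => zeroMass (dil t w)) = fun t => -(1 / 2) * J' t -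
        (energy (dil t w) - ∫ x : En n, cutoff x) := by
      ext t; simp only [J']; ring
    rw [this]
    exact (h_int.aestronglyMeasurable.const_mul _).sub
      (hmeasE.sub aestronglyMeasurable_const)
  refine Integrable.mono' (h_int.neg.mul_const (1 / 2)) hmeas ?_
  rw [ae_restrict_iff' measurableSet_Ioi]
  refine Eventually.of_forall fun t ht => ?_
  have := hE t (hT.trans ht)
  have h2 := zeroMass_nonneg (dil t w)
  rw [Real.norm_of_nonneg h2]
  simp only [J', Pi.neg_apply]
  linarith

end Monotonicity

section BlowUp

variable {n : ℕ} {w : En n → En n} {K : NNReal}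

theorem tendsto_bdry {v : ℕ → En n → En n} {q : En n → En n} (hv : ∀ k, LipschitzWith K (v k))
    (hv0 : ∀ k, v k 0 = 0)
    (hlim : ∀ x, ‖x‖ ≤ 1 → Tendsto (fun k => v k x) atTop (𝓝 (q x))) :
    Tendsto (fun k => bdry (v k)) atTop (𝓝 (bdry q)) := by
  obtain ⟨C, hC⟩ := (cutoffDensity_isWeight (n := n)).exists_bound
  refine tendsto_integral_of_bounded (r := 1) (C := C * K ^ 2) ?_ ?_ ?_ ?_
  · exact Eventually.of_forall fun k =>
      (cutoffDensity_isWeight.integrable_mul (hv k).normSq_locBdd).aestronglyMeasurable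
  · refine Eventually.of_forall fun k x hx => ?_
    rw [abs_mul, abs_of_nonneg (sq_nonneg ‖v k x‖)]
    have h1 : ‖v k x‖ ≤ K := ((hv k).norm_le (hv0 k) x).trans
      (mul_le_of_le_one_right K.coe_nonneg hx)
    have h2 := hC x
    gcongr
    exact (abs_nonneg _).trans h2
  · refine Eventually.of_forall fun k x hx => ?_
    rw [cutoffDensity_isWeight.zero x hx.le, zero_mul]
  · refine Eventually.of_forall fun x => ?_
    by_cases hx : ‖x‖ ≤ 1
    · exact ((hlim x hx).norm.pow 2).const_mul _
    · simp only [cutoffDensity_isWeight.zero x (not_le.1 hx).le, zero_mul]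
      exact tendsto_const_nhds

theorem ae_ne_zero_of_ne_zero {L : En n →L[ℝ] En n} (hL : L ≠ 0) : ∀ᵐ x, L x ≠ 0 := by
  have hker : (L : En n →ₗ[ℝ] En n).ker ≠ ⊤ := fun h => by
    rw [LinearMap.ker_eq_top] at h
    exact hL (by ext1 x; exact LinearMap.congr_fun h x)
  have := Measure.addHaar_submodule (volume : Measure (En n)) _ hker
  refine ae_iff.2 (measure_mono_null (fun x hx => ?_) this)
  simpa using hx

theorem tendsto_zeroMass {v : ℕ → En n → En n} {L : En n →L[ℝ] En n} (hL : L ≠ 0)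
    (hv : ∀ k, LipschitzWith K (v k))
    (hlim : ∀ x, ‖x‖ ≤ 1 → Tendsto (fun k => v k x) atTop (𝓝 (L x))) :
    Tendsto (fun k => zeroMass (v k)) atTop (𝓝 0) := by
  have h0 : (0 : ℝ) = ∫ _ : En n, (0 : ℝ) := by simp
  rw [h0]
  refine tendsto_integral_of_bounded (r := 1) (C := 1) ?_ ?_ ?_ ?_
  · exact Eventually.of_forall fun k => (cutoff_isWeight.integrable_mul
      ((LocBdd.const 1).sub (chi_locBdd (hv k).continuous))).aestronglyMeasurable
  · refine Eventually.of_forall fun k x _ => ?_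
    have h1 := chi_le_one (v k) x
    have h2 := chi_nonneg (v k) x
    rw [abs_of_nonneg (mul_nonneg (cutoff_nonneg x) (by linarith))]
    exact mul_le_one₀ (cutoff_le_one x) (by linarith) (by linarith)
  · refine Eventually.of_forall fun k x hx => ?_
    rw [cutoff_isWeight.zero x hx.le, zero_mul]
  · filter_upwards [ae_ne_zero_of_ne_zero hL] with x hLx
    by_cases hx : ‖x‖ ≤ 1
    · refine tendsto_const_nhds.congr' ?_
      filter_upwards [(hlim x hx).eventually_ne hLx] with k hk
      rw [chi_of_ne hk]; ring
    · simp only [cutoff_isWeight.zero x (not_le.1 hx).le, zero_mul]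
      exact tendsto_const_nhds

theorem dil_tendsto_of_uniform {L : En n →L[ℝ] En n} {t s : ℕ → ℝ}
    (hlim : TendstoUniformlyOn (fun k => dil (t k) w) L atTop (closedBall 0 1))
    (hs : ∀ k, s k ∈ Set.Icc 0 (Real.log 2)) {x : En n} (hx : ‖x‖ ≤ 1) :
    Tendsto (fun k => dil (t k + s k) w x) atTop (𝓝 (L x)) := by
  rw [Metric.tendsto_nhds]
  intro ε hε
  filter_upwards [Metric.tendstoUniformlyOn_iff.1 hlim (ε / 2) (by positivity)] with k hk
  have h1 : ‖Real.exp (-s k) • x‖ ≤ 1 := by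
    rw [norm_smul, Real.norm_of_nonneg (Real.exp_pos _).le]
    exact mul_le_one₀ (Real.exp_le_one_iff.2 (by linarith [(hs k).1])) (norm_nonneg x) hx
  have h2 := hk _ (mem_closedBall_zero_iff.2 h1)
  have h3 : L x = Real.exp (s k) • L (Real.exp (-s k) • x) := by
    rw [map_smul, smul_smul, ← Real.exp_add]; simp
  have h4 : Real.exp (s k) ≤ 2 := by
    have := Real.exp_le_exp.2 (hs k).2
    rwa [Real.exp_log two_pos] at this
  rw [add_comm, dil_add, h3, dist_comm, dil, dist_smul₀, Real.norm_of_nonneg (Real.exp_pos _).le]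
  calc _ ≤ 2 * dist (L (Real.exp (-s k) • x)) (dil (t k) w (Real.exp (-s k) • x)) := by gcongr
    _ < 2 * (ε / 2) := by gcongr
    _ = ε := by ring

/-- A nonzero linear blow-up forces the energy to stay above the mass of the cutoff. -/
theorem CritField.integral_cutoff_le_energy (hw : CritField 1 w) {L : En n →L[ℝ] En n}
    (hL : L ≠ 0) {t : ℕ → ℝ} (ht : Tendsto t atTop atTop)
    (hlim : TendstoUniformlyOn (fun k => dil (t k) w) L atTop (closedBall 0 1)) {a : ℝ}
    (ha : 0 < a) : (∫ x : En n, cutoff x) ≤ energy (dil a w) := by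
  obtain ⟨K, hK⟩ := hw.lip
  have hdil0 : ∀ s, dil s w 0 = 0 := fun s => by simp [dil, hw.zero]
  have hlog : 0 < Real.log 2 := Real.log_pos one_lt_two
  by_contra! hlt
  set c : ℝ := ∫ x : En n, cutoff x
  set δ := c - energy (dil a w) with hδ
  have hδ0 : 0 < δ := by linarith
  obtain ⟨k₀, hk₀⟩ := eventually_atTop.1 (ht.eventually_ge_atTop a)
  have hmvt : ∀ k, ∃ s ∈ Set.Icc 0 (Real.log 2), k₀ ≤ k →
      Real.log 2 * (2 * (δ - zeroMass (dil (t k + s) w))) ≤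
        bdry (dil (t k + Real.log 2) w) - bdry (dil (t k + 0) w) := by
    intro k
    by_cases hk : k₀ ≤ k
    · have htk : a ≤ t k := hk₀ k hk
      have hd : ∀ s, t k ≤ s → HasDerivAt (fun t => bdry (dil t w))
          (-(2 * (energy (dil s w) - c + zeroMass (dil s w)))) s :=
        fun s hs => hw.bdry_hasDerivAt (by linarith)
      obtain ⟨s, hs, hs'⟩ := exists_hasDerivAt_eq_slope (fun t => bdry (dil t w)) _
        (lt_add_of_pos_right (t k) hlog)
        (fun s hs => (hd s hs.1).continuousAt.continuousWithinAt)
        (fun s hs => hd s hs.1.le)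
      refine ⟨s - t k, ⟨by linarith [hs.1], by linarith [hs.2]⟩, fun _ => ?_⟩
      have hE : energy (dil s w) ≤ energy (dil a w) := hw.energy_dil_antitoneOn
        (Set.mem_Ioi.2 ha) (Set.mem_Ioi.2 (by linarith [hs.1])) (by linarith [hs.1])
      rw [add_sub_cancel_left, eq_div_iff hlog.ne'] at hs'
      rw [add_zero, add_sub_cancel, ← hs', mul_comm]
      gcongr
      rw [hδ]; linarith
    · exact ⟨0, ⟨le_rfl, hlog.le⟩, fun h => absurd h hk⟩
  choose s hs hs' using hmvt
  have hb : ∀ {s : ℕ → ℝ}, (∀ k, s k ∈ Set.Icc 0 (Real.log 2)) →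
      Tendsto (fun k => bdry (dil (t k + s k) w)) atTop (𝓝 (bdry L)) := fun {s} hs =>
    tendsto_bdry (fun k => hK.dil _) (fun k => hdil0 _)
      (fun x hx => dil_tendsto_of_uniform hlim hs hx)
  have hm : Tendsto (fun k => zeroMass (dil (t k + s k) w)) atTop (𝓝 0) :=
    tendsto_zeroMass hL (fun k => hK.dil _) (fun x hx => dil_tendsto_of_uniform hlim hs hx)
  have h1 := (hb (s := fun _ => Real.log 2) fun _ => ⟨hlog.le, le_rfl⟩).sub
    (hb (s := fun _ => 0) fun _ => ⟨le_rfl, hlog.le⟩)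
  have h2 : Tendsto (fun k => Real.log 2 * (2 * (δ - zeroMass (dil (t k + s k) w)))) atTop
      (𝓝 (Real.log 2 * (2 * (δ - 0)))) :=
    ((tendsto_const_nhds.sub hm).const_mul 2).const_mul _
  have h3 := le_of_tendsto_of_tendsto h2 h1 (eventually_atTop.2 ⟨k₀, fun k hk => hs' k hk⟩)
  have : 0 < Real.log 2 * (2 * (δ - 0)) := by rw [sub_zero]; positivity
  linarith

end BlowUp

section Extraction

variable {n : ℕ} {u : En n → ℝ} {w : En n → En n}

theorem pd_eq_of_hasFDerivAt {D : En n →L[ℝ] En n} {x : En n} (h : HasFDerivAt w D x)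
    (i j : Fin n) : pd w i j x = D (EuclideanSpace.single j 1) i := by
  have h1 : HasFDerivAt (fun y => w y i) ((EuclideanSpace.proj i : En n →L[ℝ] ℝ).comp D) x :=
    ((EuclideanSpace.proj i : En n →L[ℝ] ℝ).hasFDerivAt).comp x h
  exact (h1.hasLineDerivAt _).lineDeriv

theorem trace_eq_divF {D : En n →L[ℝ] En n} {x : En n} (h : HasFDerivAt w D x) :
    LinearMap.trace ℝ (En n) (D : En n →ₗ[ℝ] En n) = divF w x := by
  rw [LinearMap.trace_eq_sum_inner _ (EuclideanSpace.basisFun (Fin n) ℝ)]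
  refine Finset.sum_congr rfl fun i _ => ?_
  rw [pd_eq_of_hasFDerivAt h]
  simp [EuclideanSpace.inner_single_left]

/-- The derivative of a map vanishes at almost every zero of the map. -/
theorem ae_fderiv_eq_zero_of_eq_zero (hw : Continuous w) {s : Set (En n)} (hs : MeasurableSet s)
    {D : En n → En n →L[ℝ] En n} (hD : ∀ x ∈ s, HasFDerivAt w (D x) x) :
    ∀ᵐ x, x ∈ s → w x = 0 → D x = 0 := by
  have hms : MeasurableSet (s ∩ {x | w x = 0}) :=
    hs.inter (isClosed_singleton.preimage hw).measurableSet
  have happ : ApproximatesLinearOn w (0 : En n →L[ℝ] En n) (s ∩ {x | w x = 0}) 0 := by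
    intro x hx y hy
    simp [hx.2.out, hy.2.out]
  have := happ.norm_fderiv_sub_le (μ := volume) hms D
    fun x hx => (hD x hx.1).hasFDerivWithinAt
  filter_upwards [(ae_restrict_iff' hms).1 this] with x hx hxs hx0
  simpa using hx ⟨hxs, hx0⟩

/-- The gradient of a solution extends to a globally defined critical field. -/
theorem SolutionHyp.exists_critField (hu : SolutionHyp u) :
    ∃ W : En n → En n, CritField 1 W ∧ ∀ x ∈ ball (0 : En n) 1, HasGradientAt u (W x) x := by
  obtain ⟨hdiff, ⟨L, hL⟩, hlap, -, h0⟩ := hu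
  obtain ⟨W, hW, hWu⟩ := hL.extend_finite_dimension
  have hWg : ∀ x ∈ ball (0 : En n) 1, gradient u x = W x := fun x hx => hWu hx
  have hgrad : ∀ x ∈ ball (0 : En n) 1, HasGradientAt u (W x) x := fun x hx => by
    rw [← hWg x hx]; exact (hdiff x hx).hasGradientAt
  have hnhds : ∀ x ∈ ball (0 : En n) 1, ball (0 : En n) 1 ∈ 𝓝 x := fun x hx =>
    isOpen_ball.mem_nhds hx
  have hder : ∀ᵐ x, DifferentiableAt ℝ W x := hW.ae_differentiableAt
  refine ⟨W, ⟨⟨_, hW⟩, ?_, ?_, ?_, ?_⟩, hgrad⟩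
  · rw [← hWg 0 (by simp), h0]
  · filter_upwards [hder] with x hx hxB i j
    have h1 : ∀ᶠ y in 𝓝 x, HasFDerivAt u (innerSL ℝ (W y)) y := by
      filter_upwards [hnhds x hxB] with y hy
      exact (hgrad y hy).hasFDerivAt
    have h2 : HasFDerivAt (fun y => innerSL ℝ (W y)) ((innerSL ℝ).comp (fderiv ℝ W x)) x :=
      (innerSL ℝ).hasFDerivAt.comp x hx.hasFDerivAt
    have h3 := second_derivative_symmetric_of_eventually h1 h2 (EuclideanSpace.single i 1)
      (EuclideanSpace.single j 1)
    rw [pd_eq_of_hasFDerivAt hx.hasFDerivAt, pd_eq_of_hasFDerivAt hx.hasFDerivAt]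
    simpa [EuclideanSpace.inner_single_right] using h3.symm
  · filter_upwards [(ae_restrict_iff' measurableSet_ball).1 hlap] with x hx hxB
    obtain ⟨D, hD, hD0, hD1⟩ := hx hxB
    have hDW : HasFDerivAt W D x := hD.congr_of_eventuallyEq (by
      filter_upwards [hnhds x hxB] with y hy using (hWg y hy).symm)
    rw [← trace_eq_divF hDW]
    by_cases hz : W x = 0
    · rw [chi_of_eq hz, hD0 (by rw [hWg x hxB, hz])]
    · rw [chi_of_ne hz, hD1 (by rwa [hWg x hxB])]
  · have hmeas : MeasurableSet {x | DifferentiableAt ℝ W x} := measurableSet_of_differentiableAt ℝ W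
    filter_upwards [hder, ae_fderiv_eq_zero_of_eq_zero hW.continuous hmeas
      (D := fderiv ℝ W) (fun x hx => hx.out.hasFDerivAt)] with x hx hx0 _ hWx i j
    rw [pd_eq_of_hasFDerivAt hx.hasFDerivAt, hx0 hx hWx]
    simp

theorem hasGradientAt_normSq (x : En n) :
    HasGradientAt (fun y : En n => ‖y‖ ^ 2) ((2 : ℝ) • x) x := by
  rw [hasGradientAt_iff_hasFDerivAt]
  refine (hasStrictFDerivAt_norm_sq x).hasFDerivAt.congr_fderiv ?_
  ext y; simp

/-- The linear map associated with a matrix. -/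
def matMap (B : Matrix (Fin n) (Fin n) ℝ) : En n →L[ℝ] En n :=
  Matrix.toEuclideanCLM (𝕜 := ℝ) B

theorem matMap_apply (B : Matrix (Fin n) (Fin n) ℝ) (x : En n) (i : Fin n) :
    matMap B x i = ∑ j, B i j * x j := by
  simp [matMap, Matrix.mulVec, dotProduct]

theorem psiM_eq_inner (B : Matrix (Fin n) (Fin n) ℝ) (x : En n) :
    psiM B x = 1 / 2 * inner ℝ (matMap B x) x := by
  simp only [psiM, PiLp.inner_apply, matMap_apply, RCLike.inner_apply, conj_trivial]
  congr 1
  refine Finset.sum_congr rfl fun i _ => ?_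
  rw [Finset.mul_sum]
  exact Finset.sum_congr rfl fun j _ => by ring

theorem inner_matMap_comm {B : Matrix (Fin n) (Fin n) ℝ} (hB : B.IsSymm) (x y : En n) :
    inner ℝ (matMap B x) y = inner ℝ (matMap B y) x := by
  simp only [PiLp.inner_apply, matMap_apply, RCLike.inner_apply, conj_trivial, Finset.mul_sum]
  rw [Finset.sum_comm]
  refine Finset.sum_congr rfl fun i _ => Finset.sum_congr rfl fun j _ => ?_
  rw [← hB.apply]; ring

theorem hasGradientAt_psiM {B : Matrix (Fin n) (Fin n) ℝ} (hB : B.IsSymm) (x : En n) :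
    HasGradientAt (psiM B) (matMap B x) x := by
  rw [hasGradientAt_iff_hasFDerivAt]
  have h1 := ((matMap B).hasFDerivAt.inner ℝ (hasFDerivAt_id x)).const_mul (1 / 2)
  rw [show psiM B = fun x => 1 / 2 * inner ℝ (matMap B x) (id x) from funext (psiM_eq_inner B)]
  refine h1.congr_fderiv ?_
  ext y
  simp [inner_matMap_comm hB y x]
  ring

theorem hasGradientAt_p0 (x : En n) : HasGradientAt (p0 n) ((n : ℝ)⁻¹ • x) x := by
  rw [hasGradientAt_iff_hasFDerivAt]
  have h1 := (hasGradientAt_normSq x).hasFDerivAt.mul_const (2 * (n : ℝ))⁻¹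
  refine h1.congr_fderiv ?_
  ext y
  simp
  ring

theorem gradient_qB {B : Matrix (Fin n) (Fin n) ℝ} (hB : B.IsSymm) (x : En n) :
    gradient (qB B) x = ((n : ℝ)⁻¹ • ContinuousLinearMap.id ℝ (En n) + matMap B) x := by
  refine HasGradientAt.gradient ?_
  rw [hasGradientAt_iff_hasFDerivAt]
  have h1 := (hasGradientAt_p0 x).hasFDerivAt.add (hasGradientAt_psiM hB x).hasFDerivAt
  refine h1.congr_fderiv ?_
  ext y
  simp

theorem id_add_matMap_ne_zero (hn : 0 < n) {B : Matrix (Fin n) (Fin n) ℝ} (hB : B.trace = 0) :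
    (n : ℝ)⁻¹ • ContinuousLinearMap.id ℝ (En n) + matMap B ≠ 0 := by
  intro h
  have h1 : ∀ i, (n : ℝ)⁻¹ + B i i = 0 := fun i => by
    have := congrArg (fun L : En n →L[ℝ] En n => L (EuclideanSpace.single i 1) i) h
    simpa [matMap_apply] using this
  have h2 : ∑ i, ((n : ℝ)⁻¹ + B i i) = 0 := Finset.sum_eq_zero fun i _ => h1 i
  rw [Finset.sum_add_distrib, show ∑ i, B i i = 0 from hB] at h2
  simp at h2
  omega

theorem gradient_rescale {r : ℝ} (hr : 0 < r) {x : En n} (h : HasGradientAt u (w (r • x)) (r • x)) :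
    gradient (fun y => (u (r • y) - u 0) / r ^ 2) x = r⁻¹ • w (r • x) := by
  refine HasGradientAt.gradient ?_
  rw [hasGradientAt_iff_hasFDerivAt]
  have h1 : HasFDerivAt (fun y : En n => r • y) (r • ContinuousLinearMap.id ℝ (En n)) x :=
    (hasFDerivAt_id x).const_smul r
  have h2 := ((h.hasFDerivAt.comp x h1).sub_const (u 0)).mul_const (r ^ 2)⁻¹
  refine h2.congr_fderiv ?_
  ext y
  simp
  field_simp

theorem integrableOn_zeroMass_of_isSingular (hn : 0 < n) (hw : CritField 1 w)
    (hgrad : ∀ x ∈ ball (0 : En n) 1, HasGradientAt u (w x) x) (hsing : IsSingular u) {T : ℝ}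
    (hT : 0 < T) : IntegrableOn (fun t => zeroMass (dil t w)) (Set.Ioi T) := by
  obtain ⟨r, Bs, hr, hr0, hBs, hlim⟩ := hsing
  refine hw.integrableOn_zeroMass (fun t ht => ?_) hT
  refine hw.integral_cutoff_le_energy (id_add_matMap_ne_zero hn hBs.2)
    (t := fun k => -Real.log (r k)) ?_ ?_ ht
  · refine tendsto_neg_atBot_atTop.comp (Real.tendsto_log_nhdsGT_zero.comp ?_)
    exact tendsto_nhdsWithin_iff.2 ⟨hr0, Eventually.of_forall hr⟩
  · have h1 := (hlim _ (isCompact_closedBall (0 : En n) 1)).2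
    have h2 : TendstoUniformlyOn
        (fun k x => gradient (fun y => (u (r k • y) - u 0) / (r k)^2) x)
        (fun x => ((n : ℝ)⁻¹ • ContinuousLinearMap.id ℝ (En n) + matMap Bs) x) atTop
        (closedBall (0 : En n) 1) := h1.congr_right fun x _ => gradient_qB hBs.1 x
    refine h2.congr ?_
    filter_upwards [hr0.eventually_lt_const one_pos] with k hk x hx
    have hx1 : r k • x ∈ ball (0 : En n) 1 := by
      rw [mem_ball_zero_iff, norm_smul, Real.norm_of_nonneg (hr k).le]
      have := mem_closedBall_zero_iff.1 hx
      nlinarith [hr k, norm_nonneg x]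
    simp only
    rw [gradient_rescale (hr k) (hgrad _ hx1), dil, neg_neg, Real.exp_neg, Real.exp_log (hr k)]

end Extraction

section ZeroSet

variable {n : ℕ} {u : En n → ℝ} {w : En n → En n}

theorem mem_LamT_iff (hgrad : ∀ x ∈ ball (0 : En n) 1, HasGradientAt u (w x) x) {t : ℝ}
    (ht : 0 < t) {x : En n} (hx : x ∈ ball (0 : En n) 1) : x ∈ LamT u t ↔ dil t w x = 0 := by
  have h1 : Real.exp (-t) • x ∈ ball (0 : En n) 1 := by
    rw [mem_ball_zero_iff] at hx ⊢
    rw [norm_smul, Real.norm_of_nonneg (Real.exp_pos _).le]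
    have := Real.exp_lt_one_iff.2 (neg_lt_zero.2 ht)
    nlinarith [norm_nonneg x, Real.exp_pos (-t)]
  rw [LamT, Set.mem_smul_set_iff_inv_smul_mem₀ (Real.exp_pos t).ne', ← Real.exp_neg, dil,
    smul_eq_zero_iff_right (Real.exp_pos t).ne', ← (hgrad _ h1).gradient]
  exact ⟨fun h => h.2, fun h => ⟨h1, h⟩⟩

theorem setIntegral_LamT (hgrad : ∀ x ∈ ball (0 : En n) 1, HasGradientAt u (w x) x)
    (hw : Continuous w) {t : ℝ} (ht : 0 < t) (g : En n → ℝ) :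
    ∫ x in LamT u t ∩ ball (0 : En n) 1, g x =
      ∫ x, (ball (0 : En n) 1).indicator (fun x => (1 - chi (dil t w) x) * g x) x := by
  have hc : Continuous (dil t w) := by unfold dil; fun_prop
  have hset : LamT u t ∩ ball (0 : En n) 1 = {x | dil t w x = 0} ∩ ball (0 : En n) 1 := by
    ext x
    exact and_congr_left fun hx => mem_LamT_iff hgrad ht hx
  have hm : MeasurableSet {x | dil t w x = 0} := (isClosed_singleton.preimage hc).measurableSet
  rw [hset, ← integral_indicator (hm.inter measurableSet_ball)]
  refine integral_congr_ae (Eventually.of_forall fun x => ?_)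
  by_cases hx : x ∈ ball (0 : En n) 1 <;> by_cases hz : dil t w x = 0
  · simp [Set.indicator, hx, hz, chi_of_eq hz]
  · simp [Set.indicator, hz, chi_of_ne hz]
  · simp [Set.indicator, hx]
  · simp [Set.indicator, hx]

theorem stronglyMeasurable_setIntegral_chi (hw : Continuous w) {g : En n → ℝ} (hg : Continuous g) :
    StronglyMeasurable fun t : ℝ =>
      ∫ x, (ball (0 : En n) 1).indicator (fun x => (1 - chi (dil t w) x) * g x) x := by
  have hc : Continuous fun p : ℝ × En n => dil p.1 w p.2 := by unfold dil; fun_prop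
  have hm : Measurable fun p : ℝ × En n => chi (dil p.1 w) p.2 :=
    (measurable_const (a := (1 : ℝ))).indicator (isOpen_ne.preimage hc).measurableSet
  have hm' : Measurable fun p : ℝ × En n => (ball (0 : En n) 1).indicator
      (fun x => (1 - chi (dil p.1 w) x) * g x) p.2 :=
    ((measurable_const.sub hm).mul (hg.measurable.comp measurable_snd)).indicator
      (measurableSet_ball.preimage measurable_snd)
  exact hm'.stronglyMeasurable.integral_prod_right

theorem integrable_setIntegral_chi (hw : Continuous w) (t : ℝ) {g : En n → ℝ}
    (hg : Continuous g) :
    Integrable ((ball (0 : En n) 1).indicator (fun x => (1 - chi (dil t w) x) * g x)) := by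
  have hc : Continuous (dil t w) := by unfold dil; fun_prop
  rw [integrable_indicator_iff measurableSet_ball]
  have h1 := ((LocBdd.const 1).sub (chi_locBdd hc)).mul (LocBdd.of_continuous hg)
  obtain ⟨C, hC⟩ := h1.bdd 1
  refine Measure.integrableOn_of_bounded (M := C) measure_ball_lt_top.ne
    h1.meas ?_
  filter_upwards [ae_restrict_mem measurableSet_ball] with x hx
  exact hC x (mem_ball_zero_iff.1 hx).le

theorem abs_setIntegral_chi_le (hw : Continuous w) (t : ℝ) {g : En n → ℝ}
    {M : ℝ} (hM : ∀ x, |g x| ≤ M * ‖x‖ ^ 2) :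
    |∫ x, (ball (0 : En n) 1).indicator (fun x => (1 - chi (dil t w) x) * g x) x| ≤
      M * ∫ x, (ball (0 : En n) 1).indicator (fun x => (1 - chi (dil t w) x) * ‖x‖ ^ 2) x := by
  rw [← integral_const_mul, ← Real.norm_eq_abs]
  refine norm_integral_le_of_norm_le
    ((integrable_setIntegral_chi hw t (by fun_prop)).const_mul M) (Eventually.of_forall fun x => ?_)
  have h1 : 0 ≤ 1 - chi (dil t w) x := by linarith [chi_le_one (dil t w) x]
  by_cases hx : x ∈ ball (0 : En n) 1
  · simp only [Set.indicator_of_mem hx, norm_mul, Real.norm_of_nonneg h1]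
    calc _ ≤ (1 - chi (dil t w) x) * (M * ‖x‖ ^ 2) := by gcongr; exact hM x
      _ = _ := by ring
  · simp [hx]

theorem setIntegral_chi_le_zeroMass (hw : Continuous w) (t : ℝ) :
    ∫ x, (ball (0 : En n) 1).indicator (fun x => (1 - chi (dil t w) x) * ‖x‖ ^ 2) x ≤
      2 ^ n * (Real.smoothTransition (3 / 4))⁻¹ * zeroMass (dil (t - Real.log 2) w) := by
  have hs : 0 < Real.smoothTransition (3 / 4) := Real.smoothTransition.pos_of_pos (by norm_num)
  have hc : Continuous (dil (t - Real.log 2) w) := by unfold dil; fun_prop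
  have h1 := Measure.integral_comp_smul (volume : Measure (En n))
    ((ball (0 : En n) 1).indicator (fun x => (1 - chi (dil t w) x) * ‖x‖ ^ 2)) (2 : ℝ)
  rw [finrank_euclideanSpace_fin, abs_of_nonneg (by positivity), smul_eq_mul] at h1
  have h2 : ∫ x, (ball (0 : En n) 1).indicator (fun x => (1 - chi (dil t w) x) * ‖x‖ ^ 2)
      ((2 : ℝ) • x) ≤ (Real.smoothTransition (3 / 4))⁻¹ * zeroMass (dil (t - Real.log 2) w) := by
    rw [zeroMass, ← integral_const_mul]
    refine integral_mono_of_nonneg (Eventually.of_forall fun x => ?_)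
      ((cutoff_isWeight.integrable_mul
        ((LocBdd.const 1).sub (chi_locBdd hc))).const_mul _) (Eventually.of_forall fun x => ?_)
    · refine Set.indicator_nonneg (fun y _ => ?_) _
      have : 0 ≤ 1 - chi (dil t w) y := by linarith [chi_le_one (dil t w) y]
      positivity
    · have hx0 : 0 ≤ 1 - chi (dil (t - Real.log 2) w) x := by
        linarith [chi_le_one (dil (t - Real.log 2) w) x]
      have hx1 : chi (dil t w) ((2 : ℝ) • x) = chi (dil (t - Real.log 2) w) x := by
        rw [chi_dil, chi_dil, smul_smul, neg_sub, sub_eq_add_neg, Real.exp_add,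
          Real.exp_log two_pos, mul_comm]
      by_cases hx : (2 : ℝ) • x ∈ ball (0 : En n) 1
      · simp only [Set.indicator_of_mem hx, hx1]
        rw [mem_ball_zero_iff] at hx
        have h3 : ‖(2 : ℝ) • x‖ ^ 2 ≤ 1 := pow_le_one₀ (norm_nonneg _) hx.le
        rw [norm_smul, Real.norm_of_nonneg two_pos.le] at hx
        have h4 := cutoff_lower (x := x) (by linarith)
        rw [← mul_assoc]
        have h5 : 1 ≤ (Real.smoothTransition (3 / 4))⁻¹ * cutoff x := by
          rwa [inv_mul_eq_div, one_le_div hs]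
        rw [mul_comm]
        exact mul_le_mul_of_nonneg_right (h3.trans h5) hx0
      · simp only [Set.indicator_of_notMem hx]
        have := cutoff_nonneg x
        positivity
  rw [h1] at h2
  have h4 : (0 : ℝ) < 2 ^ n := by positivity
  rwa [inv_mul_le_iff₀ h4, ← mul_assoc] at h2

theorem Fdef_eq (hgrad : ∀ x ∈ ball (0 : En n) 1, HasGradientAt u (w x) x)
    (hw : Continuous w) {t : ℝ} (ht : 0 < t) : Fdef u t =
      ∫ x, (ball (0 : En n) 1).indicator (fun x => (1 - chi (dil t w) x) * ‖x‖ ^ 2) x :=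
  setIntegral_LamT hgrad hw ht _

theorem integrableOn_Fdef (hgrad : ∀ x ∈ ball (0 : En n) 1, HasGradientAt u (w x) x)
    (hw : Continuous w) {T : ℝ} (hT : 0 < T)
    (hz : IntegrableOn (fun t => zeroMass (dil t w)) (Set.Ioi T)) :
    IntegrableOn (Fdef u) (Set.Ioi (T + Real.log 2)) := by
  have hlog : 0 < Real.log 2 := Real.log_pos one_lt_two
  have h1 : IntegrableOn (fun t => zeroMass (dil (t - Real.log 2) w))
      (Set.Ioi (T + Real.log 2)) := by
    have := (measurePreserving_sub_right (volume : Measure ℝ)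
      (Real.log 2)).integrableOn_comp_preimage (measurableEmbedding_subRight _) |>.2 hz
    simpa [Function.comp_def] using this
  have h2 : IntegrableOn (fun t => ∫ x, (ball (0 : En n) 1).indicator
      (fun x => (1 - chi (dil t w) x) * ‖x‖ ^ 2) x) (Set.Ioi (T + Real.log 2)) := by
    refine Integrable.mono' (h1.const_mul (2 ^ n * (Real.smoothTransition (3 / 4))⁻¹))
      (stronglyMeasurable_setIntegral_chi hw (by fun_prop)).aestronglyMeasurable
      (Eventually.of_forall fun t => ?_)
    rw [Real.norm_of_nonneg]
    · exact setIntegral_chi_le_zeroMass hw t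
    · refine integral_nonneg fun x => Set.indicator_nonneg (fun y _ => ?_) _
      have : 0 ≤ 1 - chi (dil t w) y := by linarith [chi_le_one (dil t w) y]
      positivity
  refine h2.congr_fun (fun t ht => (Fdef_eq hgrad hw ?_).symm) measurableSet_Ioi
  linarith [Set.mem_Ioi.1 ht]

end ZeroSet

section SphereMeasure

variable {n : ℕ} {μ ν : Measure (En n)}

/-- A finite rotation-invariant measure carried by the unit sphere. -/
structure SphereInvariant (μ : Measure (En n)) : Prop where
  finite : IsFiniteMeasure μ
  carrier : ∀ᵐ x ∂μ, x ∈ sphere (0 : En n) 1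
  map_eq : ∀ g : En n ≃ₗᵢ[ℝ] En n, μ.map g = μ

theorem SphereInvariant.measure_ball_eq (hμ : SphereInvariant μ) {x y : En n}
    (hx : x ∈ sphere (0 : En n) 1) (hy : y ∈ sphere (0 : En n) 1) (r : ℝ) :
    μ (ball x r) = μ (ball y r) := by
  rw [mem_sphere_zero_iff_norm] at hx hy
  set g := (ℝ ∙ (x - y))ᗮ.reflection
  have hg : g x = y := Submodule.reflection_sub (hx.trans hy.symm)
  rw [← hg]
  conv_rhs => rw [← hμ.map_eq g]
  rw [Measure.map_apply g.continuous.measurable measurableSet_ball]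
  congr 1
  rw [← g.image_ball, Set.preimage_image_eq _ g.injective]

theorem SphereInvariant.integrable (hμ : SphereInvariant μ) {f : En n → ℝ}
    (hf : ContinuousOn f (sphere (0 : En n) 1)) : Integrable f μ := by
  have := hμ.finite
  rw [← Measure.restrict_eq_self_of_ae_mem hμ.carrier]
  exact hf.integrableOn_compact (isCompact_sphere 0 1)

theorem SphereInvariant.integral_near (hμ : SphereInvariant μ) (hν : SphereInvariant ν)
    {e : En n} (he : e ∈ sphere (0 : En n) 1) {f : En n → ℝ}
    (hf : ContinuousOn f (sphere (0 : En n) 1)) (r : ℝ) :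
    Integrable ({p : En n × En n | dist p.1 p.2 < r}.indicator fun p => f p.1) (μ.prod ν) ∧
    ∫ p, {p : En n × En n | dist p.1 p.2 < r}.indicator (fun p => f p.1) p ∂(μ.prod ν) =
      ν.real (ball e r) * ∫ x, f x ∂μ := by
  have := hμ.finite
  have := hν.finite
  have hK : MeasurableSet {p : En n × En n | dist p.1 p.2 < r} :=
    (isOpen_lt (continuous_fst.dist continuous_snd) continuous_const).measurableSet
  have h_int : Integrable ({p : En n × En n | dist p.1 p.2 < r}.indicator fun p => f p.1)
      (μ.prod ν) := ((hμ.integrable hf).comp_fst ν).indicator hK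
  refine ⟨h_int, ?_⟩
  rw [integral_prod _ h_int, ← integral_const_mul]
  refine integral_congr_ae ?_
  filter_upwards [hμ.carrier] with x hx
  have h1 : (fun y => {p : En n × En n | dist p.1 p.2 < r}.indicator (fun p => f p.1) (x, y)) =
      (ball x r).indicator fun _ => f x := by
    ext y
    simp [Set.indicator, dist_comm]
  simp only [h1]
  rw [integral_indicator measurableSet_ball, setIntegral_const, smul_eq_mul, Measure.real,
    hν.measure_ball_eq hx he r, Measure.real]

/-- Two rotation-invariant measures on the sphere are proportional. -/
theorem SphereInvariant.integral_proportional (hμ : SphereInvariant μ) (hν : SphereInvariant ν)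
    {f : En n → ℝ} (hf : ContinuousOn f (sphere (0 : En n) 1)) :
    ν.real Set.univ * ∫ x, f x ∂μ = μ.real Set.univ * ∫ x, f x ∂ν := by
  have := hμ.finite
  have := hν.finite
  by_cases hν0 : ν = 0
  · simp [hν0]
  obtain ⟨e, he⟩ : (sphere (0 : En n) 1).Nonempty := by
    by_contra! hne
    refine hν0 (Measure.measure_univ_eq_zero.1 ?_)
    have h := hν.carrier
    rw [hne] at h
    simpa [ae_iff] using h
  have hpos : ∀ r, 0 < r → 0 < ν.real (ball e r) := by
    intro r hr
    refine ENNReal.toReal_pos (fun h0 => hν0 ?_) (measure_ne_top _ _)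
    have h1 : ν (sphere (0 : En n) 1) = 0 :=
      (isCompact_sphere _ _).measure_zero_of_nhdsWithin fun x hx =>
        ⟨ball x r, mem_nhdsWithin_of_mem_nhds (ball_mem_nhds x hr), by
          rw [hν.measure_ball_eq hx he r, h0]⟩
    rw [← Measure.measure_univ_eq_zero, ← Measure.restrict_eq_self_of_ae_mem hν.carrier]
    simpa using h1
  set I := ν.real Set.univ * ∫ x, f x ∂μ - μ.real Set.univ * ∫ x, f x ∂ν with hI
  have key : ∀ ε, 0 < ε → |I| ≤ ε * (μ.real Set.univ * ν.real Set.univ) := by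
    intro ε hε
    obtain ⟨r, hr, hr'⟩ := Metric.uniformContinuousOn_iff.1
      ((isCompact_sphere _ _).uniformContinuousOn_of_continuous hf) ε hε
    obtain ⟨hi1, h1⟩ := hμ.integral_near hν he hf r
    obtain ⟨hi2, h2⟩ := hν.integral_near hμ he hf r
    obtain ⟨hi3, h3⟩ := hμ.integral_near hν he (f := fun _ => 1) continuousOn_const r
    obtain ⟨-, h4⟩ := hν.integral_near hμ he (f := fun _ => 1) continuousOn_const r
    have hswap : ∀ g : En n → ℝ, ({p : En n × En n | dist p.1 p.2 < r}.indicator fun p => g p.1) ∘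
        Prod.swap = {p : En n × En n | dist p.1 p.2 < r}.indicator fun p => g p.2 := by
      intro g
      ext p
      simp [Set.indicator, dist_comm]
    have hi2' := hi2.swap
    rw [hswap] at hi2'
    rw [← integral_prod_swap] at h2 h4
    have e2 := congrArg (fun F => ∫ p, F p ∂(μ.prod ν)) (hswap f)
    have e4 := congrArg (fun F => ∫ p, F p ∂(μ.prod ν)) (hswap fun _ => 1)
    simp only [Function.comp_apply] at e2 e4
    rw [e2] at h2
    rw [e4, h3] at h4
    simp only [integral_const, smul_eq_mul, mul_one] at h3 h4
    have h5 : |∫ p, ({p : En n × En n | dist p.1 p.2 < r}.indicator (fun p => f p.1) p -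
        {p : En n × En n | dist p.1 p.2 < r}.indicator (fun p => f p.2) p) ∂(μ.prod ν)| ≤
        ∫ p, ε * {p : En n × En n | dist p.1 p.2 < r}.indicator (fun _ => (1 : ℝ)) p
          ∂(μ.prod ν) := by
      rw [← Real.norm_eq_abs]
      refine norm_integral_le_of_norm_le (hi3.const_mul ε) ?_
      filter_upwards [Measure.quasiMeasurePreserving_fst.ae hμ.carrier,
        Measure.quasiMeasurePreserving_snd.ae hν.carrier] with p hp1 hp2
      by_cases hp : p ∈ {p : En n × En n | dist p.1 p.2 < r}
      · rw [Set.indicator_of_mem hp, Set.indicator_of_mem hp, Set.indicator_of_mem hp, mul_one]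
        exact (hr' _ hp1 _ hp2 hp).le
      · simp [Set.indicator_of_notMem hp]
    rw [integral_sub hi1 hi2', h1, h2, integral_const_mul, h3] at h5
    have hk := hpos r hr
    have h6 : ν.real (ball e r) * |I| = ν.real Set.univ *
        |ν.real (ball e r) * ∫ x, f x ∂μ - μ.real (ball e r) * ∫ x, f x ∂ν| := by
      have h8 : ν.real (ball e r) * I = ν.real Set.univ *
          (ν.real (ball e r) * ∫ x, f x ∂μ - μ.real (ball e r) * ∫ x, f x ∂ν) := by
        rw [hI]; linear_combination (-∫ x, f x ∂ν) * h4
      have h9 := congrArg abs h8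
      rwa [abs_mul, abs_mul, abs_of_pos hk, abs_of_nonneg measureReal_nonneg] at h9
    have h7 : ν.real (ball e r) * |I| ≤ ν.real (ball e r) *
        (ε * (μ.real Set.univ * ν.real Set.univ)) := by
      rw [h6]
      calc _ ≤ ν.real Set.univ * (ε * (ν.real (ball e r) * μ.real Set.univ)) := by gcongr
        _ = _ := by ring
    exact le_of_mul_le_mul_left h7 hk
  have hI0 : |I| ≤ 0 := by
    refine ge_of_tendsto (x := 𝓝[>] (0 : ℝ))
      (f := fun ε => ε * (μ.real Set.univ * ν.real Set.univ)) ?_ ?_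
    · refine tendsto_nhdsWithin_of_tendsto_nhds ?_
      have : Tendsto (fun ε : ℝ => ε * (μ.real Set.univ * ν.real Set.univ)) (𝓝 0)
        (𝓝 (0 * (μ.real Set.univ * ν.real Set.univ))) := tendsto_id.mul_const _
      simpa using this
    · filter_upwards [self_mem_nhdsWithin] with ε hε using key ε hε
  exact sub_eq_zero.1 (abs_nonpos_iff.1 hI0)

end SphereMeasure

section SphereMeasureInstances

variable {n : ℕ}

/-- The surface measure on the unit sphere coming from polar coordinates. -/
def polarMeas (n : ℕ) : Measure (En n) :=
  (volume : Measure (En n)).toSphere.map Subtype.val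

theorem polarMeas_apply {A : Set (En n)} (hA : MeasurableSet A) :
    polarMeas n A = n * volume (Set.Ioo (0 : ℝ) 1 • (sphere (0 : En n) 1 ∩ A)) := by
  rw [polarMeas, Measure.map_apply measurable_subtype_coe hA,
    Measure.toSphere_apply' _ (measurable_subtype_coe hA), Subtype.image_preimage_coe,
    finrank_euclideanSpace_fin]

theorem polarMeas_sphereInvariant : SphereInvariant (polarMeas n) where
  finite := by unfold polarMeas; infer_instance
  carrier := by
    unfold polarMeas
    exact (ae_map_iff measurable_subtype_coe.aemeasurable isClosed_sphere.measurableSet).2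
      (Eventually.of_forall fun x => x.2)
  map_eq g := by
    ext A hA
    have hgA := g.continuous.measurable hA
    rw [Measure.map_apply g.continuous.measurable hA, polarMeas_apply hgA, polarMeas_apply hA]
    congr 1
    rw [← g.measurePreserving.measure_preimage_emb g.toHomeomorph.measurableEmbedding
      (Set.Ioo (0 : ℝ) 1 • (sphere (0 : En n) 1 ∩ A))]
    congr 1
    ext x
    simp only [Set.mem_smul, Set.mem_preimage, Set.mem_inter_iff, mem_sphere_zero_iff_norm]
    constructor
    · rintro ⟨a, ha, y, ⟨hy, hyA⟩, rfl⟩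
      exact ⟨a, ha, g y, ⟨by simpa using hy, hyA⟩, by simp⟩
    · rintro ⟨a, ha, y, ⟨hy, hyA⟩, hx⟩
      refine ⟨a, ha, g.symm y, ⟨by simpa using hy, by simpa using hyA⟩, ?_⟩
      apply g.injective
      simpa using hx

theorem polarMeas_univ_pos (hn : 0 < n) : 0 < (polarMeas n).real Set.univ := by
  have := polarMeas_sphereInvariant (n := n).finite
  refine ENNReal.toReal_pos ?_ (measure_ne_top _ _)
  have : Nonempty (Fin n) := ⟨⟨0, hn⟩⟩
  rw [polarMeas, Measure.map_apply measurable_subtype_coe MeasurableSet.univ]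
  simp [(measure_ball_pos (volume : Measure (En n)) 0 one_pos).ne', hn.ne']

theorem norm_normalize_sub_le {x y : En n} (hx : 1 ≤ ‖x‖) (hy : 1 ≤ ‖y‖) :
    ‖‖x‖⁻¹ • x - ‖y‖⁻¹ • y‖ ≤ 2 * ‖x - y‖ := by
  have hx0 : 0 < ‖x‖ := by linarith
  have hy0 : 0 < ‖y‖ := by linarith
  have h1 : ‖x‖⁻¹ • x - ‖y‖⁻¹ • y = ‖x‖⁻¹ • ((x - y) + ((‖y‖ - ‖x‖) * ‖y‖⁻¹) • y) := by
    rw [smul_add, smul_sub, smul_smul]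
    have : ‖x‖⁻¹ * ((‖y‖ - ‖x‖) * ‖y‖⁻¹) = ‖x‖⁻¹ - ‖y‖⁻¹ := by field_simp
    rw [this, sub_smul]; abel
  rw [h1, norm_smul, norm_inv, norm_norm, inv_mul_le_iff₀ hx0]
  have h2 : ‖((‖y‖ - ‖x‖) * ‖y‖⁻¹) • y‖ ≤ ‖x - y‖ := by
    rw [norm_smul, norm_mul, norm_inv, norm_norm, mul_assoc, inv_mul_cancel₀ hy0.ne', mul_one,
      norm_sub_rev x y]
    exact abs_norm_sub_norm_le y x
  calc _ ≤ ‖x - y‖ + ‖x - y‖ := (norm_add_le _ _).trans (by gcongr)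
    _ = 1 * (2 * ‖x - y‖) := by ring
    _ ≤ _ := by gcongr

/-- A parametrization of a face of the cube. -/
def cubeFace {m : ℕ} (i : Fin (m + 1)) (s : ℝ) (y : Fin m → ℝ) : En (m + 1) :=
  WithLp.toLp 2 (i.insertNth s y)

theorem cubeFace_apply_self {m : ℕ} (i : Fin (m + 1)) (s : ℝ) (y : Fin m → ℝ) :
    cubeFace i s y i = s := by simp [cubeFace]

theorem exists_lipschitzWith_cubeFace {m : ℕ} (i : Fin (m + 1)) (s : ℝ) :
    ∃ K, LipschitzWith K (cubeFace i s) := by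
  have h1 : LipschitzWith 1 fun y : Fin m → ℝ => (i.insertNth s y : Fin (m + 1) → ℝ) := by
    refine LipschitzWith.of_dist_le_mul fun y z => ?_
    rw [NNReal.coe_one, one_mul, dist_pi_le_iff dist_nonneg]
    intro j
    induction j using Fin.succAboveCases i with
    | x => simp
    | p j => simpa using dist_le_pi_dist y z j
  exact ⟨_, (PiLp.lipschitzWith_toLp 2 (fun _ : Fin (m + 1) => ℝ)).comp h1⟩

theorem norm_coord_le (x : En n) (i : Fin n) : |x i| ≤ ‖x‖ := by
  simpa using PiLp.norm_apply_le x i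

theorem sphere_subset_iUnion_cubeFace {m : ℕ} : sphere (0 : En (m + 1)) 1 ⊆
    ⋃ i : Fin (m + 1), ⋃ s ∈ ({1, -1} : Set ℝ),
      (fun y => ‖cubeFace i s y‖⁻¹ • cubeFace i s y) '' Set.Icc (-1 : Fin m → ℝ) 1 := by
  intro x hx
  rw [mem_sphere_zero_iff_norm] at hx
  obtain ⟨i, -, hi⟩ := Finset.exists_max_image Finset.univ (fun i => |x i|) Finset.univ_nonempty
  have hxi : 0 < |x i| := by
    refine (abs_nonneg _).lt_of_ne fun h0 => ?_
    have : x = 0 := by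
      ext j
      simpa using (hi j (Finset.mem_univ _)).trans h0.symm.le
    simp [this] at hx
  have hxi0 : x i ≠ 0 := abs_pos.1 hxi
  have hface : cubeFace i (x i / |x i|) (fun j => x (i.succAbove j) / |x i|) = |x i|⁻¹ • x := by
    ext j
    induction j using Fin.succAboveCases i with
    | x => simp [cubeFace]; ring
    | p j => simp [cubeFace]; ring
  simp only [Set.mem_iUnion, Set.mem_image]
  refine ⟨i, x i / |x i|, ?_, fun j => x (i.succAbove j) / |x i|, ?_, ?_⟩
  · rcases abs_choice (x i) with h | h <;> rw [h]
    · simp [hxi0]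
    · simp [hxi0]
  · refine ⟨fun j => ?_, fun j => ?_⟩ <;>
      have h := abs_le.1 (hi (i.succAbove j) (Finset.mem_univ _))
    · simp only [Pi.neg_apply, Pi.one_apply]
      rw [le_div_iff₀ hxi]; linarith [h.1]
    · simp only [Pi.one_apply]
      rw [div_le_one₀ hxi]; exact h.2
  · rw [hface, norm_smul, hx, mul_one, norm_inv, Real.norm_eq_abs, abs_abs, inv_inv, smul_smul,
      mul_inv_cancel₀ hxi.ne', one_smul]

theorem hausdorffMeasure_pi_fin {m : ℕ} :
    (Measure.hausdorffMeasure (((m + 1 : ℕ) : ℝ) - 1) : Measure (Fin m → ℝ)) = volume := by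
  have h := hausdorffMeasure_pi_real (ι := Fin m)
  rw [Fintype.card_fin] at h
  rw [← h]
  congr 1
  push_cast; ring

theorem hausdorffMeasure_sphere_lt_top (hn : 0 < n) :
    Measure.hausdorffMeasure ((n : ℝ) - 1) (sphere (0 : En n) 1) < ⊤ := by
  obtain ⟨m, rfl⟩ : ∃ m, n = m + 1 := ⟨n - 1, by omega⟩
  refine (measure_mono sphere_subset_iUnion_cubeFace).trans_lt ?_
  refine (measure_iUnion_fintype_le _ _).trans_lt (ENNReal.sum_lt_top.2 fun i _ => ?_)
  refine measure_biUnion_lt_top (Set.toFinite _) fun s hs => ?_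
  obtain ⟨K, hK⟩ := exists_lipschitzWith_cubeFace i s
  have hnorm : ∀ y : Fin m → ℝ, 1 ≤ ‖cubeFace i s y‖ := fun y => by
    have h := norm_coord_le (cubeFace i s y) i
    rw [cubeFace_apply_self] at h
    rcases hs with rfl | rfl <;> simpa using h
  have hL : LipschitzWith (2 * K) fun y => ‖cubeFace i s y‖⁻¹ • cubeFace i s y := by
    refine LipschitzWith.of_dist_le_mul fun y z => ?_
    rw [dist_eq_norm]
    refine (norm_normalize_sub_le (hnorm y) (hnorm z)).trans ?_
    rw [NNReal.coe_mul, mul_assoc, ← dist_eq_norm]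
    have := hK.dist_le_mul y z
    push_cast
    gcongr
  refine (hL.hausdorffMeasure_image_le (by simp) _).trans_lt ?_
  rw [hausdorffMeasure_pi_fin]
  exact ENNReal.mul_lt_top (ENNReal.rpow_lt_top_of_nonneg (by simp) ENNReal.coe_ne_top)
    isCompact_Icc.measure_lt_top

theorem hausdorffMeasure_sphere_pos (hn : 0 < n) :
    0 < Measure.hausdorffMeasure ((n : ℝ) - 1) (sphere (0 : En n) 1) := by
  obtain ⟨m, rfl⟩ : ∃ m, n = m + 1 := ⟨n - 1, by omega⟩
  have hP : LipschitzWith 1 fun x : En (m + 1) => fun j : Fin m => x j.succ := by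
    refine LipschitzWith.of_dist_le_mul fun x y => ?_
    rw [NNReal.coe_one, one_mul, dist_pi_le_iff dist_nonneg]
    intro j
    have := norm_coord_le (x - y) j.succ
    rwa [← dist_eq_norm] at this
  have hopen : IsOpen {y : Fin m → ℝ | ∑ j, y j ^ 2 < 1} :=
    isOpen_lt (by fun_prop) continuous_const
  have hsub : {y : Fin m → ℝ | ∑ j, y j ^ 2 < 1} ⊆
      (fun x : En (m + 1) => fun j : Fin m => x j.succ) '' sphere (0 : En (m + 1)) 1 := by
    intro y hy
    refine ⟨WithLp.toLp 2 (Fin.cons (Real.sqrt (1 - ∑ j, y j ^ 2)) y), ?_, by simp⟩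
    rw [mem_sphere_zero_iff_norm, EuclideanSpace.norm_eq, Real.sqrt_eq_one, Fin.sum_univ_succ]
    simp [Real.sq_sqrt (sub_nonneg.2 hy.out.le)]
  have h1 : 0 < (volume : Measure (Fin m → ℝ)) {y : Fin m → ℝ | ∑ j, y j ^ 2 < 1} :=
    hopen.measure_pos _ ⟨0, by simp⟩
  have h2 := hP.hausdorffMeasure_image_le (d := ((m + 1 : ℕ) : ℝ) - 1) (by simp)
    (sphere (0 : En (m + 1)) 1)
  rw [hausdorffMeasure_pi_fin, ENNReal.coe_one, ENNReal.one_rpow, one_mul] at h2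
  exact (h1.trans_le (measure_mono hsub)).trans_le h2

theorem sphMeas_sphereInvariant (hn : 0 < n) : SphereInvariant (sphMeas n) where
  finite := ⟨by
    rw [sphMeas, Measure.restrict_apply_univ]
    exact hausdorffMeasure_sphere_lt_top hn⟩
  carrier := ae_restrict_mem isClosed_sphere.measurableSet
  map_eq g := by
    have h := (g.toIsometryEquiv.measurePreserving_hausdorffMeasure
      ((n : ℝ) - 1)).restrict_preimage (isClosed_sphere (x := (0 : En n)) (ε := 1)).measurableSet
    have h1 : g.toIsometryEquiv ⁻¹' sphere (0 : En n) 1 = sphere 0 1 := by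
      ext x; simp
    rw [h1] at h
    exact h.map_eq

theorem sphMeas_univ_pos (hn : 0 < n) : 0 < (sphMeas n).real Set.univ := by
  have := (sphMeas_sphereInvariant hn).finite
  refine ENNReal.toReal_pos ?_ (measure_ne_top _ _)
  rw [sphMeas, Measure.restrict_apply_univ]
  exact (hausdorffMeasure_sphere_pos hn).ne'

end SphereMeasureInstances

section Polar

variable {n : ℕ}

/-- Integration in polar coordinates. -/
theorem integral_eq_integral_polarMeas (hn : 0 < n) {f : En n → ℝ} (hf : Integrable f) :
    ∫ x, f x = ∫ r in Set.Ioi (0 : ℝ), r ^ (n - 1) * ∫ θ, f (r • θ) ∂(polarMeas n) := by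
  have : Nonempty (Fin n) := ⟨⟨0, hn⟩⟩
  have hfin := polarMeas_sphereInvariant (n := n).finite
  have hmp := (volume : Measure (En n)).measurePreserving_homeomorphUnitSphereProd
  have hemb := (homeomorphUnitSphereProd (En n)).measurableEmbedding
  have hsymm : ∀ x : ({(0)}ᶜ : Set (En n)), f x.1 =
      (fun p : sphere (0 : En n) 1 × Set.Ioi (0 : ℝ) => f (p.2.1 • p.1.1))
        (homeomorphUnitSphereProd (En n) x) := fun x => by
    have h := congrArg Subtype.val ((homeomorphUnitSphereProd (En n)).symm_apply_apply x)
    rw [homeomorphUnitSphereProd_symm_apply_coe] at h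
    exact congrArg f h.symm
  have h_int : Integrable (fun p : sphere (0 : En n) 1 × Set.Ioi (0 : ℝ) => f (p.2.1 • p.1.1))
      ((volume : Measure (En n)).toSphere.prod
        (Measure.volumeIoiPow (Module.finrank ℝ (En n) - 1))) := by
    rw [← hmp.integrable_comp_emb hemb]
    have h1 : IntegrableOn f ({(0)}ᶜ : Set (En n)) := hf.integrableOn
    rw [integrableOn_iff_comap_subtypeVal (measurableSet_singleton _).compl] at h1
    exact h1.congr (Eventually.of_forall hsymm)
  calc ∫ x, f x = ∫ x : ({(0)}ᶜ : Set (En n)), f x.1 ∂(volume.comap Subtype.val) := by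
        rw [integral_subtype_comap (measurableSet_singleton _).compl f, restrict_compl_singleton]
    _ = ∫ p : sphere (0 : En n) 1 × Set.Ioi (0 : ℝ), f (p.2.1 • p.1.1)
          ∂((volume : Measure (En n)).toSphere.prod
            (Measure.volumeIoiPow (Module.finrank ℝ (En n) - 1))) := by
        rw [← hmp.integral_comp hemb
          (fun p : sphere (0 : En n) 1 × Set.Ioi (0 : ℝ) => f (p.2.1 • p.1.1))]
        exact integral_congr_ae (Eventually.of_forall hsymm)
    _ = ∫ r : Set.Ioi (0 : ℝ), ∫ θ : sphere (0 : En n) 1, f (r.1 • θ.1)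
          ∂(volume : Measure (En n)).toSphere
            ∂(Measure.volumeIoiPow (Module.finrank ℝ (En n) - 1)) := integral_prod_symm _ h_int
    _ = ∫ r : Set.Ioi (0 : ℝ), (fun r : ℝ => ∫ θ, f (r • θ) ∂(polarMeas n)) r
          ∂(Measure.volumeIoiPow (Module.finrank ℝ (En n) - 1)) := by
        refine integral_congr_ae (Eventually.of_forall fun r => ?_)
        simp only [polarMeas]
        exact ((MeasurableEmbedding.subtype_coe
          isClosed_sphere.measurableSet).integral_map (fun θ => f (r.1 • θ))).symm
    _ = _ := by
        rw [finrank_euclideanSpace_fin]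
        simp only [Measure.volumeIoiPow, ENNReal.ofReal]
        rw [integral_withDensity_eq_integral_smul,
          integral_subtype_comap measurableSet_Ioi
            fun a => Real.toNNReal (a ^ (n - 1)) • ∫ θ, f (a • θ) ∂(polarMeas n),
          setIntegral_congr_fun measurableSet_Ioi fun x hx => ?_]
        · rw [NNReal.smul_def, Real.coe_toNNReal _ (pow_nonneg hx.out.le _), smul_eq_mul]
        · exact (measurable_subtype_coe.pow_const _).real_toNNReal

theorem setIntegral_ball_eq_intervalIntegral (hn : 0 < n) {f : En n → ℝ} (hf : Continuous f)
    {ρ : ℝ} (hρ : 0 ≤ ρ) : ∫ x in ball (0 : En n) ρ, f x =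
      ∫ r in (0 : ℝ)..ρ, r ^ (n - 1) * ∫ θ, f (r • θ) ∂(polarMeas n) := by
  have h_int : Integrable ((ball (0 : En n) ρ).indicator f) :=
    (((hf.continuousOn.integrableOn_compact (isCompact_closedBall 0 ρ))).mono_set
      ball_subset_closedBall).integrable_indicator measurableSet_ball
  rw [← integral_indicator measurableSet_ball, integral_eq_integral_polarMeas hn h_int,
    intervalIntegral.integral_of_le hρ, integral_Ioc_eq_integral_Ioo,
    ← Set.Ioi_inter_Iio, ← setIntegral_indicator measurableSet_Iio]
  refine setIntegral_congr_fun measurableSet_Ioi fun r hr => ?_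
  have hr0 : (0 : ℝ) < r := hr
  have hcar : ∀ᵐ θ ∂(polarMeas n), (ball (0 : En n) ρ).indicator f (r • θ) =
      (Set.Iio ρ).indicator (fun _ => f (r • θ)) r := by
    filter_upwards [polarMeas_sphereInvariant.carrier] with θ hθ
    rw [mem_sphere_zero_iff_norm] at hθ
    have : r • θ ∈ ball (0 : En n) ρ ↔ r ∈ Set.Iio ρ := by
      rw [mem_ball_zero_iff, norm_smul, hθ, mul_one, Real.norm_of_nonneg hr0.le, Set.mem_Iio]
    by_cases h : r ∈ Set.Iio ρ
    · rw [Set.indicator_of_mem (this.2 h), Set.indicator_of_mem h]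
    · rw [Set.indicator_of_notMem (fun h' => h (this.1 h')), Set.indicator_of_notMem h]
  beta_reduce
  rw [integral_congr_ae hcar]
  by_cases h : r ∈ Set.Iio ρ
  · simp only [Set.indicator_of_mem h]
  · simp only [Set.indicator_of_notMem h]; simp

theorem continuous_integral_polarMeas {f : En n → ℝ} (hf : Continuous f) :
    Continuous fun r : ℝ => ∫ θ, f (r • θ) ∂(polarMeas n) := by
  have hfin := polarMeas_sphereInvariant (n := n).finite
  have h : ∀ r : ℝ, ∫ θ, f (r • θ) ∂(polarMeas n) =
      ∫ θ in sphere (0 : En n) 1, f (r • θ) ∂(polarMeas n) := fun r => by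
    rw [Measure.restrict_eq_self_of_ae_mem polarMeas_sphereInvariant.carrier]
  simp_rw [h]
  exact continuous_parametric_integral_of_continuous (by fun_prop) (isCompact_sphere 0 1)

theorem hasDerivAt_setIntegral_ball (hn : 0 < n) {f : En n → ℝ} (hf : Continuous f) :
    HasDerivAt (fun ρ => ∫ x in ball (0 : En n) ρ, f x) (∫ θ, f θ ∂(polarMeas n)) 1 := by
  have hc : Continuous fun r : ℝ => r ^ (n - 1) * ∫ θ, f (r • θ) ∂(polarMeas n) :=
    (continuous_pow _).mul (continuous_integral_polarMeas hf)
  have h := intervalIntegral.integral_hasDerivAt_right (hc.intervalIntegrable 0 1)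
    (hc.stronglyMeasurableAtFilter _ _) hc.continuousAt
  simp only [one_pow, one_mul, one_smul] at h
  refine h.congr_of_eventuallyEq ?_
  filter_upwards [lt_mem_nhds (zero_lt_one' ℝ)] with ρ hρ
  exact setIntegral_ball_eq_intervalIntegral hn hf hρ.le

end Polar

section BallDivergence

variable {n : ℕ}

/-- The positive part of `ρ² - |x|²`. -/
def tent (ρ : ℝ) (x : En n) : ℝ := ρ ^ 2 - min ‖x‖ ρ ^ 2

theorem tent_of_le {ρ : ℝ} {x : En n} (h : ‖x‖ ≤ ρ) : tent ρ x = ρ ^ 2 - ‖x‖ ^ 2 := by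
  rw [tent, min_eq_left h]

theorem tent_of_ge {ρ : ℝ} {x : En n} (h : ρ ≤ ‖x‖) : tent ρ x = 0 := by
  rw [tent, min_eq_right h, sub_self]

theorem tent_eq_max {ρ : ℝ} (hρ : 0 ≤ ρ) (x : En n) : tent ρ x = max 0 (ρ ^ 2 - ‖x‖ ^ 2) := by
  rcases le_total ‖x‖ ρ with h | h
  · rw [tent_of_le h, max_eq_right]
    nlinarith [norm_nonneg x]
  · rw [tent_of_ge h, max_eq_left]
    nlinarith [norm_nonneg x]

theorem continuous_tent (ρ : ℝ) : Continuous (tent (n := n) ρ) := by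
  unfold tent
  fun_prop

theorem exists_lipschitzWith_tent {ρ : ℝ} (hρ : 0 ≤ ρ) :
    ∃ L, LipschitzWith L (tent (n := n) ρ) := by
  refine ⟨Real.toNNReal (2 * ρ), LipschitzWith.of_dist_le_mul fun x y => ?_⟩
  have h1 : |min ‖x‖ ρ - min ‖y‖ ρ| ≤ dist x y := by
    refine (abs_min_sub_min_le_max ‖x‖ ρ ‖y‖ ρ).trans ?_
    simpa [dist_eq_norm] using abs_norm_sub_norm_le x y
  have h2 : |min ‖y‖ ρ + min ‖x‖ ρ| ≤ 2 * ρ := by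
    have hx : 0 ≤ min ‖x‖ ρ := le_min (norm_nonneg x) hρ
    have hy : 0 ≤ min ‖y‖ ρ := le_min (norm_nonneg y) hρ
    rw [abs_of_nonneg (by positivity)]
    linarith [min_le_right ‖x‖ ρ, min_le_right ‖y‖ ρ]
  rw [Real.dist_eq, Real.coe_toNNReal _ (by positivity)]
  have h3 : tent ρ x - tent ρ y = -((min ‖y‖ ρ + min ‖x‖ ρ) * (min ‖x‖ ρ - min ‖y‖ ρ)) := by
    unfold tent; ring
  rw [h3, abs_neg, abs_mul]
  gcongr

theorem tent_hasCompactSupport (ρ : ℝ) : HasCompactSupport (tent (n := n) ρ) :=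
  HasCompactSupport.intro (isCompact_closedBall 0 ρ) fun x hx => tent_of_ge <| by
    simpa using (not_le.1 fun h' => hx (mem_closedBall_zero_iff.2 h')).le

theorem tent_hasLineDerivAt {ρ : ℝ} {x : En n} (hx : ‖x‖ ≠ ρ) (v : En n) :
    HasLineDerivAt ℝ (tent ρ) (-(2 * (ball 0 ρ).indicator (fun x => inner ℝ x v) x)) x v := by
  rcases lt_or_gt_of_ne hx with h | h
  · rw [Set.indicator_of_mem (mem_ball_zero_iff.2 h)]
    have h1 : HasFDerivAt (fun y : En n => ρ ^ 2 - ‖y‖ ^ 2) (-(2 • innerSL ℝ x)) x :=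
      (hasStrictFDerivAt_norm_sq x).hasFDerivAt.const_sub _
    have h2 : HasFDerivAt (tent ρ) (-(2 • innerSL ℝ x)) x := by
      refine h1.congr_of_eventuallyEq ?_
      filter_upwards [isOpen_ball.mem_nhds (mem_ball_zero_iff.2 h)] with y hy
      exact tent_of_le (mem_ball_zero_iff.1 hy).le
    simpa using h2.hasLineDerivAt v
  · rw [Set.indicator_of_notMem fun h' => h.not_gt (mem_ball_zero_iff.1 h')]
    have h2 : HasFDerivAt (tent ρ) (0 : En n →L[ℝ] ℝ) x := by
      refine (hasFDerivAt_const (0 : ℝ) x).congr_of_eventuallyEq ?_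
      filter_upwards [continuous_norm.continuousAt.eventually (lt_mem_nhds h)] with y hy
      exact tent_of_ge hy.le
    simpa using h2.hasLineDerivAt v

theorem LocBdd.integrableOn_closedBall {f : En n → ℝ} (hf : LocBdd f) (r : ℝ) :
    IntegrableOn f (closedBall 0 r) := by
  obtain ⟨C, hC⟩ := hf.bdd r
  refine Measure.integrableOn_of_bounded (M := C) measure_closedBall_lt_top.ne hf.meas ?_
  filter_upwards [ae_restrict_mem isClosed_closedBall.measurableSet] with x hx
  exact hC x (mem_closedBall_zero_iff.1 hx)

theorem LocBdd.integrableOn_ball {f : En n → ℝ} (hf : LocBdd f) (r : ℝ) :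
    IntegrableOn f (ball 0 r) := (hf.integrableOn_closedBall r).mono_set ball_subset_closedBall

theorem LocBdd.integrable_tent_mul {f : En n → ℝ} (hf : LocBdd f) (ρ : ℝ) :
    Integrable fun x => tent ρ x * f x := by
  have h := ((LocBdd.of_continuous (continuous_tent ρ)).mul hf).integrableOn_closedBall ρ
  rw [← integrable_indicator_iff isClosed_closedBall.measurableSet] at h
  refine h.congr (Eventually.of_forall fun x => ?_)
  by_cases hx : x ∈ closedBall (0 : En n) ρ
  · simp [Set.indicator_of_mem hx]
  · have h2 : ρ ≤ ‖x‖ := (not_le.1 fun h' => hx (mem_closedBall_zero_iff.2 h')).le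
    simp [Set.indicator_of_notMem hx, tent_of_ge h2]

variable {d : En n → En n} {D : NNReal}

theorem integral_tent_mul_divF (hn : 0 < n) (hd : LipschitzWith D d) {ρ : ℝ} (hρ : 0 ≤ ρ) :
    ∫ x, tent ρ x * divF d x = 2 * ∫ x in ball (0 : En n) ρ, ∑ i, x i * d x i := by
  have : Nonempty (Fin n) := ⟨⟨0, hn⟩⟩
  have i1 := hd.divF_locBdd.integrable_tent_mul ρ
  have i2 : Integrable ((ball (0 : En n) ρ).indicator fun x => ∑ i, x i * d x i) :=
    ((LocBdd.sum Finset.univ fun i =>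
      (LocBdd.coord i).mul (hd.coord_locBdd i)).integrableOn_ball ρ).integrable_indicator
        measurableSet_ball
  obtain ⟨M, hM⟩ := exists_lipschitzWith_tent (n := n) hρ
  have hL : ∀ i, ∃ L, LipschitzWith L fun x => (tent ρ x • d x) i := fun i =>
    hM.exists_mul_of_hasCompactSupport (tent_hasCompactSupport ρ) (hd.coord i)
  choose L hL using hL
  have hs : ∀ i, HasCompactSupport fun x => (tent ρ x • d x) i := fun i =>
    (tent_hasCompactSupport ρ).mul_right (f' := fun x => d x i)
  have h0 : ∫ x, ∑ i, pd (fun y => tent ρ y • d y) i i x = 0 := by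
    rw [integral_finsetSum _ fun i _ => ?_]
    · exact Finset.sum_eq_zero fun i _ => (hL i).integral_lineDeriv_eq_zero (hs i) _
    · exact (hL i).integrable_lineDeriv_of_hasCompactSupport (hs i) _
  rw [← integral_indicator measurableSet_ball, ← integral_const_mul, ← sub_eq_zero,
    ← integral_sub i1 (i2.const_mul 2), ← h0]
  refine integral_congr_ae ?_
  have hsph : ∀ᵐ x : En n, x ∉ sphere (0 : En n) ρ :=
    measure_eq_zero_iff_ae_notMem.1 (Measure.addHaar_sphere _ 0 ρ)
  filter_upwards [hd.ae_hasLineDerivAt_pd, hsph] with x hx hxρ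
  have hxρ' : ‖x‖ ≠ ρ := fun h => hxρ (mem_sphere_zero_iff_norm.2 h)
  have hpd : ∀ i, pd (fun y => tent ρ y • d y) i i x = tent ρ x * pd d i i x -
      2 * (ball (0 : En n) ρ).indicator (fun x => x i * d x i) x := fun i => by
    have h := ((tent_hasLineDerivAt hxρ' (EuclideanSpace.single i 1)).mul_real (hx i i)).lineDeriv
    rw [pd]
    refine h.trans ?_
    by_cases hb : x ∈ ball (0 : En n) ρ
    · rw [Set.indicator_of_mem hb, Set.indicator_of_mem hb, EuclideanSpace.inner_single_right]
      simp
      ring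
    · rw [Set.indicator_of_notMem hb, Set.indicator_of_notMem hb]
      ring
  simp only [hpd, divF, Finset.mul_sum, Finset.sum_sub_distrib]
  by_cases hb : x ∈ ball (0 : En n) ρ
  · simp only [Set.indicator_of_mem hb, Finset.mul_sum]
  · simp only [Set.indicator_of_notMem hb, Finset.sum_const_zero, mul_zero]

theorem abs_tent_sub_le {ρ σ : ℝ} (hρ : ρ ∈ ball (1 : ℝ) 1) (hσ : σ ∈ ball (1 : ℝ) 1) (x : En n) :
    |tent ρ x - tent σ x| ≤ 4 * |ρ - σ| := by
  rw [Real.ball_eq_Ioo, Set.mem_Ioo] at hρ hσ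
  rw [tent_eq_max (by linarith), tent_eq_max (by linarith)]
  refine (abs_max_sub_max_le_max _ _ _ _).trans ?_
  have h : ρ ^ 2 - ‖x‖ ^ 2 - (σ ^ 2 - ‖x‖ ^ 2) = (ρ + σ) * (ρ - σ) := by ring
  rw [sub_self, abs_zero, h, abs_mul, abs_of_pos (by linarith : 0 < ρ + σ)]
  refine max_le (by positivity) ?_
  gcongr
  linarith

theorem hasDerivAt_tent {x : En n} (hx : ‖x‖ ≠ 1) :
    HasDerivAt (fun ρ => tent ρ x) (2 * (ball (0 : En n) 1).indicator 1 x) 1 := by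
  rcases lt_or_gt_of_ne hx with h | h
  · rw [Set.indicator_of_mem (mem_ball_zero_iff.2 h)]
    have h1 : HasDerivAt (fun ρ : ℝ => ρ ^ 2 - ‖x‖ ^ 2) (2 * 1) 1 := by
      simpa using (hasDerivAt_pow 2 (1 : ℝ)).sub_const (‖x‖ ^ 2)
    refine h1.congr_of_eventuallyEq ?_
    filter_upwards [lt_mem_nhds h] with ρ hρ
    exact tent_of_le hρ.le
  · rw [Set.indicator_of_notMem fun h' => h.not_gt (mem_ball_zero_iff.1 h'), mul_zero]
    refine (hasDerivAt_const (1 : ℝ) (0 : ℝ)).congr_of_eventuallyEq ?_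
    filter_upwards [gt_mem_nhds h] with ρ hρ
    exact tent_of_ge hρ.le

theorem hasDerivAt_integral_tent_mul (hn : 0 < n) {f : En n → ℝ} (hf : LocBdd f) :
    HasDerivAt (fun ρ => ∫ x, tent ρ x * f x) (2 * ∫ x in ball (0 : En n) 1, f x) 1 := by
  have : Nonempty (Fin n) := ⟨⟨0, hn⟩⟩
  have hsph : ∀ᵐ x : En n, x ∉ sphere (0 : En n) 1 :=
    measure_eq_zero_iff_ae_notMem.1 (Measure.addHaar_sphere _ 0 1)
  have hb : Integrable ((closedBall (0 : En n) 2).indicator fun x => 4 * |f x|) :=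
    IntegrableOn.integrable_indicator ((hf.integrableOn_closedBall 2).abs.const_mul 4)
      isClosed_closedBall.measurableSet
  have key := hasDerivAt_integral_of_dominated_loc_of_lip (μ := (volume : Measure (En n)))
    (F := fun ρ x => tent ρ x * f x) (x₀ := (1 : ℝ)) (s := ball (1 : ℝ) 1)
    (F' := fun x => (2 * (ball (0 : En n) 1).indicator 1 x) * f x)
    (bound := (closedBall (0 : En n) 2).indicator fun x => 4 * |f x|)
    (ball_mem_nhds _ one_pos)
    (Eventually.of_forall fun ρ => (hf.integrable_tent_mul ρ).aestronglyMeasurable)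
    (hf.integrable_tent_mul 1)
    ((((measurable_one.indicator measurableSet_ball).const_mul 2).aestronglyMeasurable).mul hf.meas)
    (Eventually.of_forall fun x => LipschitzOnWith.of_dist_le_mul fun ρ hρ σ hσ => ?_) hb ?_
  · refine key.2.congr_deriv ?_
    rw [← integral_indicator measurableSet_ball, ← integral_const_mul]
    refine integral_congr_ae (Eventually.of_forall fun x => ?_)
    by_cases hx : x ∈ ball (0 : En n) 1
    · simp only [Set.indicator_of_mem hx]; simp
    · simp only [Set.indicator_of_notMem hx]; simp
  · rw [Real.dist_eq, Real.dist_eq, ← sub_mul, abs_mul]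
    by_cases hx : x ∈ closedBall (0 : En n) 2
    · rw [Set.indicator_of_mem hx]
      simp only [Real.coe_nnabs, abs_mul, abs_abs, abs_of_pos (four_pos (α := ℝ))]
      have := abs_tent_sub_le hρ hσ x
      calc _ ≤ (4 * |ρ - σ|) * |f x| := by gcongr
        _ = _ := by ring
    · have h2 : 2 < ‖x‖ := not_le.1 fun h' => hx (mem_closedBall_zero_iff.2 h')
      rw [Real.ball_eq_Ioo, Set.mem_Ioo] at hρ hσ
      rw [Set.indicator_of_notMem hx, tent_of_ge (by linarith), tent_of_ge (by linarith)]
      simp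
  · filter_upwards [hsph] with x hx
    exact (hasDerivAt_tent fun h => hx (mem_sphere_zero_iff_norm.2 h)).mul_const (f x)

/-- The divergence theorem on the unit ball for Lipschitz fields. -/
theorem setIntegral_divF_ball (hn : 0 < n) (hd : LipschitzWith D d) :
    ∫ x in ball (0 : En n) 1, divF d x = ∫ x, ∑ i, x i * d x i ∂(polarMeas n) := by
  have hc : Continuous fun x => ∑ i, x i * d x i := by
    have := hd.continuous
    fun_prop
  have h1 := hasDerivAt_integral_tent_mul hn hd.divF_locBdd
  have h2 := (hasDerivAt_setIntegral_ball hn hc).const_mul 2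
  have h3 := h1.unique (h2.congr_of_eventuallyEq (by
    filter_upwards [lt_mem_nhds (zero_lt_one' ℝ)] with ρ hρ
    exact integral_tent_mul_divF hn hd hρ.le))
  linarith

end BallDivergence

section Green

variable {n : ℕ} {C : Matrix (Fin n) (Fin n) ℝ}

theorem contDiff_psiM (C : Matrix (Fin n) (Fin n) ℝ) : ContDiff ℝ 1 (psiM C) := by
  rw [funext (psiM_eq_inner C)]
  exact contDiff_const.mul ((matMap C).contDiff.inner ℝ contDiff_id)

theorem psiM_smul (C : Matrix (Fin n) (Fin n) ℝ) (r : ℝ) (x : En n) :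
    psiM C (r • x) = r ^ 2 * psiM C x := by
  rw [psiM_eq_inner, psiM_eq_inner, map_smul, real_inner_smul_left, real_inner_smul_right]
  ring

/-- The vector field used in the Green identity for `U` and `psiM C`. -/
def greenField (C : Matrix (Fin n) (Fin n) ℝ) (U : En n → ℝ) (V : En n → En n) (x : En n) :
    En n := U x • matMap C x - psiM C x • V x

variable {U : En n → ℝ} {V : En n → En n} {K L : NNReal}

theorem LocallyLipschitz.smul_real {E F : Type*} [NormedAddCommGroup E] [NormedAddCommGroup F]
    [NormedSpace ℝ F] {f : E → ℝ} {g : E → F} (hf : LocallyLipschitz f) (hg : LocallyLipschitz g) :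
    LocallyLipschitz fun x => f x • g x := by
  have h : ContDiff ℝ 1 fun p : ℝ × F => p.1 • p.2 := contDiff_fst.smul contDiff_snd
  exact h.locallyLipschitz.comp (hf.prodMk hg)

theorem LocallyLipschitz.sub_real {E F : Type*} [NormedAddCommGroup E] [NormedAddCommGroup F]
    [NormedSpace ℝ F] {f g : E → F} (hf : LocallyLipschitz f) (hg : LocallyLipschitz g) :
    LocallyLipschitz fun x => f x - g x := by
  have h : ContDiff ℝ 1 fun p : F × F => p.1 - p.2 := contDiff_fst.sub contDiff_snd
  exact h.locallyLipschitz.comp (hf.prodMk hg)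

theorem locallyLipschitz_greenField (C : Matrix (Fin n) (Fin n) ℝ) (hU : LipschitzWith K U)
    (hV : LipschitzWith L V) : LocallyLipschitz (greenField C U V) :=
  (hU.locallyLipschitz.smul_real (matMap C).lipschitz.locallyLipschitz).sub_real
    ((contDiff_psiM C).locallyLipschitz.smul_real hV.locallyLipschitz)

theorem exists_lipschitzWith_greenField (C : Matrix (Fin n) (Fin n) ℝ) (hU : LipschitzWith K U)
    (hV : LipschitzWith L V) :
    ∃ (D : NNReal) (d : En n → En n), LipschitzWith D d ∧
      Set.EqOn (greenField C U V) d (closedBall 0 1) := by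
  have hloc := locallyLipschitz_greenField C hU hV
  obtain ⟨D, hD⟩ := (hloc.locallyLipschitzOn
    (s := closedBall 0 1)).exists_lipschitzOnWith_of_compact (isCompact_closedBall 0 1)
  obtain ⟨d, hd, hXd⟩ := hD.extend_finite_dimension
  exact ⟨_, d, hd, hXd⟩

theorem sum_mul_greenField (x : En n) :
    ∑ i, x i * greenField C U V x i = psiM C x * (2 * U x - inner ℝ x (V x)) := by
  have h1 : ∑ i, x i * greenField C U V x i = inner ℝ (greenField C U V x) x := by
    simp [PiLp.inner_apply]
  rw [h1, greenField, inner_sub_left, real_inner_smul_left, real_inner_smul_left, psiM_eq_inner,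
    real_inner_comm x (V x)]
  ring

/-- The Green identity on the unit ball against a trace-free quadratic form. -/
theorem integral_psiM_mul_polarMeas (hn : 0 < n) (hC : S0 C) (hU : LipschitzWith K U)
    (hV : LipschitzWith L V) (hgrad : ∀ x ∈ ball (0 : En n) 1, HasGradientAt U (V x) x) :
    ∫ x, psiM C x * (2 * U x - inner ℝ x (V x)) ∂(polarMeas n) =
      -∫ x in ball (0 : En n) 1, psiM C x * divF V x := by
  obtain ⟨D, d, hd, hXd⟩ := exists_lipschitzWith_greenField C hU hV
  have h1 : ∫ x, psiM C x * (2 * U x - inner ℝ x (V x)) ∂(polarMeas n) =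
      ∫ x, ∑ i, x i * d x i ∂(polarMeas n) := by
    refine integral_congr_ae ?_
    filter_upwards [polarMeas_sphereInvariant.carrier] with x hx
    rw [← hXd (sphere_subset_closedBall hx), sum_mul_greenField]
  rw [h1, ← setIntegral_divF_ball hn hd, ← integral_neg]
  refine setIntegral_congr_ae measurableSet_ball ?_
  filter_upwards [hV.ae_hasLineDerivAt_pd] with x hx hxB
  have hpd : ∀ i, pd d i i x = (V x i * matMap C x i + U x * C i i) -
      (matMap C x i * V x i + psiM C x * pd V i i x) := fun i => by
    have a1 := (hgrad x hxB).hasFDerivAt.hasLineDerivAt (EuclideanSpace.single i (1 : ℝ))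
    have a2 := (hasGradientAt_psiM hC.1 x).hasFDerivAt.hasLineDerivAt
      (EuclideanSpace.single i (1 : ℝ))
    have a3 := ((EuclideanSpace.proj i : En n →L[ℝ] ℝ).comp (matMap C)).hasFDerivAt
      (x := x) |>.hasLineDerivAt (EuclideanSpace.single i (1 : ℝ))
    have a4 := HasDerivAt.sub (HasLineDerivAt.mul_real a1 a3) (HasLineDerivAt.mul_real a2 (hx i i))
    have a5 : HasLineDerivAt ℝ (fun y => greenField C U V y i) _ x (EuclideanSpace.single i 1) := a4
    have a6 : (fun y => d y i) =ᶠ[𝓝 x] fun y => greenField C U V y i := by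
      filter_upwards [isOpen_ball.mem_nhds hxB] with y hy
      rw [hXd (ball_subset_closedBall hy)]
    rw [pd, a6.lineDeriv_eq, a5.lineDeriv]
    simp [matMap_apply, EuclideanSpace.inner_single_right]
  have htr : ∑ i, C i i = 0 := hC.2
  simp only [divF, hpd, Finset.sum_sub_distrib, Finset.sum_add_distrib, ← Finset.mul_sum, htr]
  simp only [mul_comm]
  ring

theorem integral_psiM_polarMeas (hn : 0 < n) (hC : S0 C) :
    ∫ x, psiM C x ∂(polarMeas n) = 0 := by
  have h := integral_psiM_mul_polarMeas hn hC (LipschitzWith.const (1 : ℝ))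
    (LipschitzWith.const (0 : En n)) fun x _ => hasGradientAt_const x 1
  have h0 : ∀ x : En n, divF (fun _ : En n => (0 : En n)) x = 0 := fun x => by
    simp [divF, pd, lineDeriv]
  simp only [h0, mul_zero, integral_zero, inner_zero_right, sub_zero, mul_one, neg_zero,
    integral_mul_const] at h
  linarith

theorem setIntegral_psiM_ball (hn : 0 < n) (hC : S0 C) :
    ∫ x in ball (0 : En n) 1, psiM C x = 0 := by
  rw [setIntegral_ball_eq_intervalIntegral hn (contDiff_psiM C).continuous zero_le_one]
  simp [psiM_smul, integral_const_mul, integral_psiM_polarMeas hn hC]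

/-- The Green identity for a critical field. -/
theorem CritField.integral_psiM_mul_polarMeas {R : ℝ} (hR : 1 ≤ R) (hn : 0 < n) (hC : S0 C)
    (hU : LipschitzWith K U) (hV : CritField R V)
    (hgrad : ∀ x ∈ ball (0 : En n) 1, HasGradientAt U (V x) x) :
    ∫ x, psiM C x * (2 * U x - inner ℝ x (V x)) ∂(polarMeas n) =
      ∫ x, (ball (0 : En n) 1).indicator (fun x => (1 - chi V x) * psiM C x) x := by
  obtain ⟨L, hL⟩ := hV.lip
  have hψ : LocBdd (psiM C) := .of_continuous (contDiff_psiM C).continuous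
  rw [_root_.integral_psiM_mul_polarMeas hn hC hU hL hgrad, integral_indicator measurableSet_ball]
  have h1 : ∫ x in ball (0 : En n) 1, psiM C x * divF V x =
      ∫ x in ball (0 : En n) 1, psiM C x * chi V x := by
    refine setIntegral_congr_ae measurableSet_ball ?_
    filter_upwards [hV.div] with x hx hxB
    rw [hx (ball_subset_ball hR hxB)]
  have h2 := integral_sub (hψ.integrableOn_ball 1)
    ((hψ.mul (chi_locBdd hL.continuous)).integrableOn_ball 1)
  rw [setIntegral_psiM_ball hn hC, zero_sub] at h2
  rw [h1, ← h2]
  exact integral_congr_ae (Eventually.of_forall fun x => by ring)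

end Green

section Duality

variable {n : ℕ}

theorem psiM_add (B C : Matrix (Fin n) (Fin n) ℝ) (x : En n) :
    psiM (B + C) x = psiM B x + psiM C x := by
  simp [psiM, add_mul, Finset.sum_add_distrib, mul_add]

theorem psiM_smul_matrix (c : ℝ) (B : Matrix (Fin n) (Fin n) ℝ) (x : En n) :
    psiM (c • B) x = c * psiM B x := by
  simp only [psiM, Matrix.smul_apply, smul_eq_mul, Finset.mul_sum]
  exact Finset.sum_congr rfl fun i _ => Finset.sum_congr rfl fun j _ => by ring

theorem abs_psiM_le (B : Matrix (Fin n) (Fin n) ℝ) (x : En n) :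
    |psiM B x| ≤ ‖matMap B‖ * ‖x‖ ^ 2 := by
  have h1 := (abs_real_inner_le_norm (matMap B x) x).trans
    (mul_le_mul_of_nonneg_right ((matMap B).le_opNorm x) (norm_nonneg x))
  rw [psiM_eq_inner, abs_mul, abs_of_pos (by norm_num : (0 : ℝ) < 1 / 2)]
  have h2 : 0 ≤ ‖matMap B‖ * ‖x‖ * ‖x‖ := by positivity
  nlinarith

theorem eq_zero_of_psiM_eq_zero {B : Matrix (Fin n) (Fin n) ℝ} (hB : B.IsSymm)
    (h : ∀ x ∈ ball (0 : En n) 1, psiM B x = 0) : B = 0 := by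
  have h1 : ∀ x ∈ ball (0 : En n) 1, matMap B x = 0 := fun x hx => by
    have h2 : psiM B =ᶠ[𝓝 x] fun _ => 0 := by
      filter_upwards [isOpen_ball.mem_nhds hx] with y hy using h y hy
    exact (hasGradientAt_psiM hB x).unique ((hasGradientAt_const x 0).congr_of_eventuallyEq h2)
  ext i j
  have h3 := h1 ((1 / 2 : ℝ) • EuclideanSpace.single j 1)
    (by rw [mem_ball_zero_iff, norm_smul]; norm_num)
  rw [map_smul, smul_eq_zero] at h3
  have h4 := congrArg (fun y : En n => y i) (h3.resolve_left (by norm_num))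
  simpa [matMap_apply] using h4

/-- The space of symmetric trace-free matrices. -/
def S0Submodule (n : ℕ) : Submodule ℝ (Matrix (Fin n) (Fin n) ℝ) where
  carrier := {B | S0 B}
  add_mem' hB hC := ⟨hB.1.add hC.1, by rw [Matrix.trace_add, hB.2, hC.2, add_zero]⟩
  zero_mem' := ⟨Matrix.isSymm_zero, Matrix.trace_zero _ _⟩
  smul_mem' c _ hB := ⟨hB.1.smul c, by rw [Matrix.trace_smul, hB.2, smul_zero]⟩

theorem integrable_psiM_mul_psiM (hn : 0 < n) (B C : Matrix (Fin n) (Fin n) ℝ) :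
    Integrable (fun x => psiM B x * psiM C x) (sphMeas n) :=
  (sphMeas_sphereInvariant hn).integrable
    ((contDiff_psiM B).continuous.mul (contDiff_psiM C).continuous).continuousOn

/-- The pairing of quadratic forms in `L²` of the unit sphere. -/
def spherePairing (hn : 0 < n) :
    S0Submodule n →ₗ[ℝ] S0Submodule n →ₗ[ℝ] ℝ :=
  LinearMap.mk₂ ℝ (fun B C => ∫ x, psiM B.1 x * psiM C.1 x ∂(sphMeas n))
    (fun B B' C => by
      rw [← integral_add (integrable_psiM_mul_psiM hn _ _) (integrable_psiM_mul_psiM hn _ _)]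
      simp only [Submodule.coe_add, psiM_add, add_mul])
    (fun c B C => by
      rw [smul_eq_mul, ← integral_const_mul]
      simp only [Submodule.coe_smul, psiM_smul_matrix, mul_assoc])
    (fun B C C' => by
      rw [← integral_add (integrable_psiM_mul_psiM hn _ _) (integrable_psiM_mul_psiM hn _ _)]
      simp only [Submodule.coe_add, psiM_add, mul_add])
    (fun c B C => by
      rw [smul_eq_mul, ← integral_const_mul]
      simp only [Submodule.coe_smul, psiM_smul_matrix, mul_left_comm])

theorem spherePairing_apply (hn : 0 < n) (B C : S0Submodule n) :
    spherePairing hn B C = ∫ x, psiM B.1 x * psiM C.1 x ∂(sphMeas n) := rfl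

theorem eq_zero_of_integral_psiM_sq (hn : 0 < n) {B : Matrix (Fin n) (Fin n) ℝ} (hB : B.IsSymm)
    (h : ∫ x, psiM B x * psiM B x ∂(sphMeas n) = 0) : B = 0 := by
  have hc : Continuous fun x => psiM B x * psiM B x :=
    (contDiff_psiM B).continuous.mul (contDiff_psiM B).continuous
  have h1 := (sphMeas_sphereInvariant hn).integral_proportional polarMeas_sphereInvariant
    hc.continuousOn
  rw [h, mul_zero, zero_eq_mul, or_iff_right (sphMeas_univ_pos hn).ne'] at h1
  have h2 : ∫ x in ball (0 : En n) 1, psiM B x * psiM B x = 0 := by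
    rw [setIntegral_ball_eq_intervalIntegral hn hc zero_le_one]
    have h3 : ∀ r : ℝ, ∫ θ, psiM B (r • θ) * psiM B (r • θ) ∂(polarMeas n) = 0 := fun r => by
      have e : ∀ θ, psiM B (r • θ) * psiM B (r • θ) = r ^ 4 * (psiM B θ * psiM B θ) :=
        fun θ => by rw [psiM_smul]; ring
      simp_rw [e, integral_const_mul, h1, mul_zero]
    simp [h3]
  rw [setIntegral_eq_zero_iff_of_nonneg_ae (Eventually.of_forall fun x => mul_self_nonneg _)
    ((LocBdd.of_continuous hc).integrableOn_ball 1)] at h2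
  have h4 := Measure.eqOn_open_of_ae_eq h2 isOpen_ball hc.continuousOn continuousOn_const
  exact eq_zero_of_psiM_eq_zero hB fun x hx => mul_self_eq_zero.1 (h4 hx)

/-- Matrix entries are represented by the `L²` pairing on the sphere. -/
theorem exists_entry_eq_integral (hn : 0 < n) (i j : Fin n) :
    ∃ C : Matrix (Fin n) (Fin n) ℝ, S0 C ∧
      ∀ B, S0 B → B i j = ∫ x, psiM B x * psiM C x ∂(sphMeas n) := by
  have hinj : Function.Injective (spherePairing hn) := by
    rw [injective_iff_map_eq_zero]
    intro B hB
    have h := LinearMap.congr_fun hB B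
    rw [spherePairing_apply, LinearMap.zero_apply] at h
    exact Subtype.ext (eq_zero_of_integral_psiM_sq hn B.2.1 h)
  have hsurj := (LinearMap.injective_iff_surjective_of_finrank_eq_finrank
    (Subspace.dual_finrank_eq (K := ℝ) (V := S0Submodule n)).symm).1 hinj
  obtain ⟨C, hC⟩ := hsurj ((Matrix.entryLinearMap ℝ ℝ i j).comp (S0Submodule n).subtype)
  refine ⟨C, C.2, fun B hB => ?_⟩
  have h := LinearMap.congr_fun hC ⟨B, hB⟩
  rw [spherePairing_apply] at h
  simp only [mul_comm (psiM B _)]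
  exact h.symm

end Duality

section Coefficient

variable {n : ℕ} {u v : En n → ℝ} {w : En n → En n} {K L : NNReal}

theorem exp_neg_smul_mem_ball {t : ℝ} (ht : 0 < t) {x : En n} (hx : ‖x‖ ≤ 1) :
    Real.exp (-t) • x ∈ ball (0 : En n) 1 := by
  rw [mem_ball_zero_iff, norm_smul, Real.norm_of_nonneg (Real.exp_pos _).le]
  have := Real.exp_lt_one_iff.2 (neg_lt_zero.2 ht)
  nlinarith [norm_nonneg x, Real.exp_pos (-t)]

/-- A function with Lipschitz gradient on the unit ball extends to a Lipschitz function. -/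
theorem exists_lipschitzWith_extension (hw : LipschitzWith L w) (h0 : w 0 = 0)
    (hgrad : ∀ x ∈ ball (0 : En n) 1, HasGradientAt u (w x) x) :
    ∃ v, LipschitzWith L v ∧ Set.EqOn u v (ball (0 : En n) 1) := by
  refine LipschitzOnWith.extend_real (Convex.lipschitzOnWith_of_nnnorm_hasFDerivWithin_le
    (𝕜 := ℝ) (fun x hx => (hgrad x hx).hasFDerivAt.hasFDerivWithinAt) (fun x hx => ?_)
    (convex_ball 0 1))
  rw [LinearIsometryEquiv.nnnorm_map, ← NNReal.coe_le_coe, coe_nnnorm]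
  have h1 := hw.norm_le h0 x
  have h2 := mem_ball_zero_iff.1 hx
  nlinarith [L.coe_nonneg]

theorem LipschitzWith.ut (hv : LipschitzWith K v) (t : ℝ) : ∃ M, LipschitzWith M (ut v t) := by
  refine ⟨Real.toNNReal (Real.exp (2 * t)) * (K * Real.toNNReal (Real.exp (-t))),
    LipschitzWith.of_dist_le_mul fun x y => ?_⟩
  have h := hv.dist_le_mul (Real.exp (-t) • x) (Real.exp (-t) • y)
  rw [dist_smul₀, Real.norm_of_nonneg (Real.exp_pos _).le] at h
  have h1 : dist (_root_.ut v t x) (_root_.ut v t y) =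
      Real.exp (2 * t) * dist (v (Real.exp (-t) • x)) (v (Real.exp (-t) • y)) := by
    rw [_root_.ut, _root_.ut, Real.dist_eq, Real.dist_eq, ← mul_sub, abs_mul, Real.abs_exp]
    congr 2; ring
  rw [h1]
  push_cast
  rw [Real.coe_toNNReal _ (Real.exp_pos _).le, Real.coe_toNNReal _ (Real.exp_pos _).le,
    mul_assoc, mul_assoc]
  gcongr

theorem hasGradientAt_ut {t : ℝ} {x : En n}
    (h : HasGradientAt v (w (Real.exp (-t) • x)) (Real.exp (-t) • x)) :
    HasGradientAt (ut v t) (dil t w x) x := by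
  rw [hasGradientAt_iff_hasFDerivAt]
  have h1 : HasFDerivAt (fun y : En n => Real.exp (-t) • y)
      (Real.exp (-t) • ContinuousLinearMap.id ℝ (En n)) x := (hasFDerivAt_id x).fun_const_smul _
  have h2 := ((h.hasFDerivAt.comp x h1).sub_const (v 0)).const_mul (Real.exp (2 * t))
  refine h2.congr_fderiv ?_
  ext y
  have h3 : Real.exp (2 * t) * Real.exp (-t) = Real.exp t := by
    rw [← Real.exp_add]; ring_nf
  simp [dil, ← mul_assoc, h3]

theorem hasDerivAt_ut {t : ℝ} {x : En n}
    (h : HasGradientAt v (w (Real.exp (-t) • x)) (Real.exp (-t) • x)) :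
    HasDerivAt (fun s => ut v s x) (2 * ut v t x - inner ℝ x (dil t w x)) t := by
  have h1 : HasDerivAt (fun s : ℝ => Real.exp (-s) • x) (-(Real.exp (-t)) • x) t := by
    have := (((hasDerivAt_id t).neg).exp).smul_const x
    simpa using this
  have h2 : HasDerivAt (fun s : ℝ => Real.exp (2 * s)) (2 * Real.exp (2 * t)) t := by
    have := ((hasDerivAt_id t).const_mul 2).exp
    simpa [mul_comm] using this
  have h3 := h2.mul ((h.hasFDerivAt.comp_hasDerivAt t h1).sub_const (v 0))
  refine h3.congr_deriv ?_
  have h4 : Real.exp (2 * t) * Real.exp (-t) = Real.exp t := by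
    rw [← Real.exp_add]; ring_nf
  simp [ut, dil, real_inner_smul_right, real_inner_comm x, ← mul_assoc, h4]
  ring

theorem abs_ut_le (hv : LipschitzWith K v) (t : ℝ) (x : En n) :
    |ut v t x| ≤ Real.exp t * (K * ‖x‖) := by
  have h := hv.dist_le_mul (Real.exp (-t) • x) 0
  rw [dist_zero_right, norm_smul, Real.norm_of_nonneg (Real.exp_pos _).le, Real.dist_eq] at h
  rw [ut, abs_mul, Real.abs_exp]
  have h4 : Real.exp (2 * t) * Real.exp (-t) = Real.exp t := by
    rw [← Real.exp_add]; ring_nf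
  calc _ ≤ Real.exp (2 * t) * (K * (Real.exp (-t) * ‖x‖)) := by gcongr
    _ = (Real.exp (2 * t) * Real.exp (-t)) * (K * ‖x‖) := by ring
    _ = _ := by rw [h4]

theorem hasDerivAt_integral_ut_mul_psiM (hn : 0 < n) (hv : LipschitzWith K v)
    (hw : LipschitzWith L w) (h0 : w 0 = 0)
    (hgrad : ∀ x ∈ ball (0 : En n) 1, HasGradientAt v (w x) x)
    (C : Matrix (Fin n) (Fin n) ℝ) {t : ℝ} (ht : 0 < t) :
    HasDerivAt (fun s => ∫ x, ut v s x * psiM C x ∂(sphMeas n))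
      (∫ x, psiM C x * (2 * ut v t x - inner ℝ x (dil t w x)) ∂(sphMeas n)) t := by
  have hinv := sphMeas_sphereInvariant hn
  have hfin := hinv.finite
  have hψ := (contDiff_psiM C).continuous
  have hu : ∀ s, Continuous (ut v s) := fun s => (hv.ut s).choose_spec.continuous
  have hd : ∀ s, Continuous (dil s w) := fun s => (hw.dil s).continuous
  refine (hasDerivAt_integral_of_dominated_loc_of_deriv_le (μ := sphMeas n)
    (F := fun s x => ut v s x * psiM C x)
    (F' := fun s x => psiM C x * (2 * ut v s x - inner ℝ x (dil s w x)))
    (bound := fun _ => ‖matMap C‖ * (2 * (Real.exp (2 * t) * K) + L))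
    (s := ball t t) (ball_mem_nhds t ht)
    (Eventually.of_forall fun s => ((hu s).mul hψ).aestronglyMeasurable)
    (hinv.integrable ((hu t).mul hψ).continuousOn)
    (hψ.mul ((continuous_const.mul (hu t)).sub
      (continuous_id.inner (hd t)))).aestronglyMeasurable
    ?_ (integrable_const _) ?_).2
  · filter_upwards [hinv.carrier] with x hx s hs
    rw [mem_sphere_zero_iff_norm] at hx
    rw [Real.ball_eq_Ioo, Set.mem_Ioo] at hs
    have a1 := abs_psiM_le C x
    have a2 := abs_ut_le hv s x
    have a3 := (abs_real_inner_le_norm x (dil s w x)).trans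
      (mul_le_mul_of_nonneg_left ((hw.dil s).norm_le (by simp [dil, h0]) x) (norm_nonneg x))
    rw [hx] at a1 a2 a3
    have a4 : Real.exp s ≤ Real.exp (2 * t) := Real.exp_le_exp.2 (by linarith)
    rw [norm_mul, Real.norm_eq_abs, Real.norm_eq_abs]
    gcongr
    · simpa using a1
    · refine (abs_sub _ _).trans ?_
      rw [abs_mul, abs_two]
      have a5 : Real.exp s * K ≤ Real.exp (2 * t) * K := by gcongr
      simp only [mul_one, one_mul] at a2 a3
      linarith
  · filter_upwards [hinv.carrier] with x hx s hs
    rw [Real.ball_eq_Ioo, Set.mem_Ioo] at hs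
    have h := hasDerivAt_ut (v := v) (w := w) (t := s) (x := x) (hgrad _
      (exp_neg_smul_mem_ball (by linarith) (mem_sphere_zero_iff_norm.1 hx).le))
    exact (h.mul_const (psiM C x)).congr_deriv (mul_comm _ _)

/-- The time derivative of a moment on the sphere is a moment of the coincidence set. -/
theorem CritField.integral_psiM_mul_sphMeas (hn : 0 < n) (hv : LipschitzWith K v)
    (hw : CritField 1 w) (hgrad : ∀ x ∈ ball (0 : En n) 1, HasGradientAt v (w x) x)
    {C : Matrix (Fin n) (Fin n) ℝ} (hC : S0 C) {t : ℝ} (ht : 0 < t) :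
    ∫ x, psiM C x * (2 * ut v t x - inner ℝ x (dil t w x)) ∂(sphMeas n) =
      (sphMeas n).real Set.univ / (polarMeas n).real Set.univ *
        ∫ x, (ball (0 : En n) 1).indicator (fun x => (1 - chi (dil t w) x) * psiM C x) x := by
  obtain ⟨L, hL⟩ := hw.lip
  obtain ⟨M, hM⟩ := hv.ut t
  have hR : (1 : ℝ) ≤ Real.exp t * 1 := by rw [mul_one]; exact Real.one_le_exp ht.le
  rw [← CritField.integral_psiM_mul_polarMeas hR hn hC hM (hw.rescale t) fun x hx =>
    hasGradientAt_ut (hgrad _ (exp_neg_smul_mem_ball ht (mem_ball_zero_iff.1 hx).le))]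
  have hc : Continuous fun x => psiM C x * (2 * ut v t x - inner ℝ x (dil t w x)) :=
    (contDiff_psiM C).continuous.mul ((continuous_const.mul hM.continuous).sub
      (continuous_id.inner (hL.dil t).continuous))
  rw [div_mul_eq_mul_div, eq_div_iff (polarMeas_univ_pos hn).ne', mul_comm]
  exact (sphMeas_sphereInvariant hn).integral_proportional polarMeas_sphereInvariant
    hc.continuousOn

theorem BProp.entry_eq {B : ℝ → Matrix (Fin n) (Fin n) ℝ} (hn : 0 < n) (hB : BProp u B)
    (hv : LipschitzWith K v) (huv : Set.EqOn u v (ball (0 : En n) 1))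
    {C : Matrix (Fin n) (Fin n) ℝ} (hC : S0 C) {i j : Fin n}
    (hrep : ∀ B, S0 B → B i j = ∫ x, psiM B x * psiM C x ∂(sphMeas n)) {t : ℝ} (ht : 0 < t) :
    B t i j = (∫ x, ut v t x * psiM C x ∂(sphMeas n)) -
      ∫ x, p0 n x * psiM C x ∂(sphMeas n) := by
  have hinv := sphMeas_sphereInvariant hn
  have hψ := (contDiff_psiM C).continuous
  have hu : Continuous (ut v t) := (hv.ut t).choose_spec.continuous
  have hp : Continuous (p0 n) := by unfold p0; fun_prop
  have i1 : Integrable (fun x => ut v t x * psiM C x) (sphMeas n) :=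
    hinv.integrable (hu.mul hψ).continuousOn
  have i2 : Integrable (fun x => p0 n x * psiM C x) (sphMeas n) :=
    hinv.integrable (hp.mul hψ).continuousOn
  have i3 : Integrable (fun x => ut v t x * psiM C x - p0 n x * psiM C x) (sphMeas n) :=
    i1.sub i2
  have h := (hB t ht).2 C hC
  have h1 : ∫ x, (ut u t x - p0 n x - psiM (B t) x) * psiM C x ∂(sphMeas n) =
      ∫ x, ut v t x * psiM C x - p0 n x * psiM C x - psiM (B t) x * psiM C x ∂(sphMeas n) := by
    refine integral_congr_ae ?_
    filter_upwards [hinv.carrier] with x hx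
    have h2 : ut u t x = ut v t x := by
      rw [ut, ut, huv (exp_neg_smul_mem_ball ht (mem_sphere_zero_iff_norm.1 hx).le),
        huv (mem_ball_self one_pos)]
    rw [h2]; ring
  rw [h1, integral_sub i3 (integrable_psiM_mul_psiM hn _ _), integral_sub i1 i2,
    ← hrep _ (hB t ht).1] at h
  linarith

/-- The entries of the quadratic coefficient are differentiable, with derivative controlled by the
second moment of the coincidence set. -/
theorem BProp.exists_hasDerivAt {B : ℝ → Matrix (Fin n) (Fin n) ℝ} (hn : 0 < n) (hB : BProp u B)
    (hw : CritField 1 w) (hgrad : ∀ x ∈ ball (0 : En n) 1, HasGradientAt u (w x) x) {T : ℝ}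
    (hT : 0 < T) (hF : IntegrableOn (Fdef u) (Set.Ioi T)) (i j : Fin n) :
    ∃ b : ℝ → ℝ, (∀ t ∈ Set.Ioi T, HasDerivAt (fun s => B s i j) (b t) t) ∧
      IntegrableOn b (Set.Ioi T) := by
  obtain ⟨L, hL⟩ := hw.lip
  obtain ⟨v, hv, huv⟩ := exists_lipschitzWith_extension hL hw.zero hgrad
  have hgrad' : ∀ x ∈ ball (0 : En n) 1, HasGradientAt v (w x) x := fun x hx =>
    (hgrad x hx).congr_of_eventuallyEq (by
      filter_upwards [isOpen_ball.mem_nhds hx] with y hy using (huv hy).symm)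
  obtain ⟨C, hC, hrep⟩ := exists_entry_eq_integral hn i j
  refine ⟨fun t => (sphMeas n).real Set.univ / (polarMeas n).real Set.univ *
    ∫ x, (ball (0 : En n) 1).indicator (fun x => (1 - chi (dil t w) x) * psiM C x) x,
    fun t ht => ?_, Integrable.const_mul ?_ _⟩
  · have ht0 : 0 < t := hT.trans ht
    have h := (hasDerivAt_integral_ut_mul_psiM hn hv hL hw.zero hgrad' C ht0).sub_const
      (∫ x, p0 n x * psiM C x ∂(sphMeas n))
    rw [hw.integral_psiM_mul_sphMeas hn hv hgrad' hC ht0] at h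
    refine h.congr_of_eventuallyEq ?_
    filter_upwards [lt_mem_nhds ht0] with s hs
    exact hB.entry_eq hn hv huv hC hrep hs
  · refine Integrable.mono' (hF.const_mul ‖matMap C‖) (stronglyMeasurable_setIntegral_chi
      hL.continuous (contDiff_psiM C).continuous).aestronglyMeasurable ?_
    filter_upwards [ae_restrict_mem measurableSet_Ioi] with t ht
    rw [Fdef_eq hgrad hL.continuous (hT.trans ht)]
    exact abs_setIntegral_chi_le hL.continuous t (abs_psiM_le C)

theorem frob_le_sum (M : Matrix (Fin n) (Fin n) ℝ) : frob M ≤ ∑ i, ∑ j, |M i j| := by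
  refine Real.sqrt_le_iff.2 ⟨by positivity, ?_⟩
  calc ∑ i, ∑ j, M i j ^ 2 ≤ ∑ i, (∑ j, |M i j|) ^ 2 := by
        refine Finset.sum_le_sum fun i _ => ?_
        simpa using Finset.sum_sq_le_sq_sum_of_nonneg (s := Finset.univ)
          (f := fun j => |M i j|) fun j _ => abs_nonneg _
    _ ≤ _ := Finset.sum_sq_le_sq_sum_of_nonneg fun i _ => by positivity

theorem integrable_frob {α : Type*} [MeasurableSpace α] {μ : Measure α}
    {M : α → Matrix (Fin n) (Fin n) ℝ} (h : ∀ i j, Integrable (fun a => M a i j) μ) :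
    Integrable (fun a => frob (M a)) μ := by
  have hm : AEMeasurable (fun a => ∑ i, ∑ j, M a i j ^ 2) μ :=
    Finset.aemeasurable_fun_sum _ fun i _ => Finset.aemeasurable_fun_sum _ fun j _ =>
      (h i j).aestronglyMeasurable.aemeasurable.pow_const 2
  refine Integrable.mono' (integrable_finsetSum Finset.univ fun i _ =>
    integrable_finsetSum Finset.univ fun j _ => (h i j).abs)
    hm.sqrt.aestronglyMeasurable (Eventually.of_forall fun a => ?_)
  exact (Real.norm_of_nonneg (Real.sqrt_nonneg _)).trans_le (frob_le_sum (M a))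

theorem tendsto_frob_sub {α : Type*} {l : Filter α} {M : α → Matrix (Fin n) (Fin n) ℝ}
    {N : Matrix (Fin n) (Fin n) ℝ} (h : ∀ i j, Tendsto (fun a => M a i j) l (𝓝 (N i j))) :
    Tendsto (fun a => frob (M a - N)) l (𝓝 0) := by
  have h1 : Tendsto (fun a => ∑ i, ∑ j, |(M a - N) i j|) l (𝓝 (∑ _i : Fin n, ∑ _j : Fin n, 0)) :=
    tendsto_finsetSum _ fun i _ => tendsto_finsetSum _ fun j _ => by
      simpa using ((h i j).sub_const (N i j)).abs
  simp only [Finset.sum_const_zero] at h1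
  exact squeeze_zero (fun _ => Real.sqrt_nonneg _) (fun a => frob_le_sum _) h1

theorem S0.of_tendsto {α : Type*} {l : Filter α} [l.NeBot] {M : α → Matrix (Fin n) (Fin n) ℝ}
    {N : Matrix (Fin n) (Fin n) ℝ} (h : ∀ i j, Tendsto (fun a => M a i j) l (𝓝 (N i j)))
    (hM : ∀ᶠ a in l, S0 (M a)) : S0 N := by
  constructor
  · refine Matrix.IsSymm.ext fun i j => tendsto_nhds_unique_of_eventuallyEq (h j i) (h i j) ?_
    filter_upwards [hM] with a ha using ha.1.apply i j
  · have h1 : Tendsto (fun a => (M a).trace) l (𝓝 N.trace) :=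
      tendsto_finsetSum _ fun i _ => h i i
    refine tendsto_nhds_unique_of_eventuallyEq h1 tendsto_const_nhds ?_
    filter_upwards [hM] with a ha using ha.2

end Coefficient

/-- finite dissipation and convergence of the quadratic coefficient. -/
theorem stmt_18 (n : ℕ) (hn : 2 ≤ n) (u : En n → ℝ) (hu : SolutionHyp u)
    (B : ℝ → Matrix (Fin n) (Fin n) ℝ) (hB : BProp u B)
    (hsing : IsSingular u) :
    ∃ T : ℝ, 0 < T ∧ IntegrableOn (Fdef u) (Set.Ioi T) ∧
      (∃ B' : ℝ → Matrix (Fin n) (Fin n) ℝ,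
        (∀ i j, ∀ᵐ t ∂(volume.restrict (Set.Ioi T)),
          HasDerivAt (fun s => B s i j) (B' t i j) t) ∧
        IntegrableOn (fun t => frob (B' t)) (Set.Ioi T)) ∧
      ∃ Binf : Matrix (Fin n) (Fin n) ℝ, S0 Binf ∧
        Tendsto (fun t => frob (B t - Binf)) atTop (nhds 0) := by
  have hn' : 0 < n := by lia
  obtain ⟨w, hw, hgrad⟩ := hu.exists_critField
  obtain ⟨L, hL⟩ := hw.lip
  have hF := integrableOn_Fdef hgrad hL.continuous one_pos
    (integrableOn_zeroMass_of_isSingular hn' hw hgrad hsing one_pos)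
  have hT : 0 < 1 + Real.log 2 := by positivity
  choose b hb hbi using hB.exists_hasDerivAt hn' hw hgrad hT hF
  have hlim : ∀ i j, Tendsto (fun s => B s i j) atTop
      (𝓝 (limUnder atTop fun s => B s i j)) := fun i j =>
    tendsto_limUnder_of_hasDerivAt_of_integrableOn_Ioi (hb i j) (hbi i j)
  refine ⟨1 + Real.log 2, hT, hF, ⟨fun t => Matrix.of fun i j => b i j t, fun i j => ?_,
    integrable_frob hbi⟩, Matrix.of fun i j => limUnder atTop fun s => B s i j,
    S0.of_tendsto hlim ((eventually_gt_atTop 0).mono fun t ht => (hB t ht).1),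
    tendsto_frob_sub hlim⟩
  filter_upwards [ae_restrict_mem measurableSet_Ioi] with t ht using hb i j t ht

end
end
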